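/- arXiv:0711.3514 — 3 statements merged into one kernel-verified Lean document; each statement's English description precedes it below -/
import Mathlib

section
/- Let r ≥ 2 and let N be a nontrivial normal subgroup of the free group F_r on r generators. For n ≥ 0 let γ_n denote the number of elements of N whose reduced word length (with respect to the r free generators) equals n. Then the sequence of ratios γ_{2n+2}/γ_{2n} converges as n → ∞, and its limit equals γ², the square of the cogrowth exponent γ = lim_{n→∞} (γ_{2n})^{1/(2n)}. -/
open Filter

/-- A summable perturbation of an antitone real sequence that is bounded below converges. -/
theorem exists_tendsto_of_le_add_summable {s ε : ℕ → ℝ} (hs : ∀ n, 0 ≤ s n) (hε : ∀ n, 0 ≤ ε n)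
    (hsum : Summable ε) (h : ∀ n, s (n + 1) ≤ s n + ε n) :
    ∃ l, Tendsto s atTop (nhds l) := by
  set t : ℕ → ℝ := fun n => s n - ∑ k ∈ Finset.range n, ε k with ht
  have hanti : Antitone t := by
    refine antitone_nat_of_succ_le fun n => ?_
    simp only [ht, Finset.sum_range_succ]
    linarith [h n]
  have hbdd : BddBelow (Set.range t) := by
    refine ⟨-∑' k, ε k, ?_⟩
    rintro _ ⟨n, rfl⟩
    have := hsum.sum_le_tsum (Finset.range n) (fun k _ => hε k)
    simp only [ht]
    linarith [hs n]
  refine ⟨_, ((tendsto_atTop_ciInf hanti hbdd).add hsum.hasSum.tendsto_sum_nat).congr fun n => ?_⟩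
  simp [ht]

theorem tendsto_zero_of_ratio_lt_one {f : ℕ → ℝ} {l : ℝ} (hl : l < 1) (hf : ∀ n, 0 < f n)
    (h : Tendsto (fun n => f (n + 1) / f n) atTop (nhds l)) : Tendsto f atTop (nhds 0) := by
  refine (summable_of_ratio_test_tendsto_lt_one hl (.of_forall fun n => (hf n).ne')
    (h.congr fun n => ?_)).tendsto_atTop_zero
  rw [Real.norm_of_nonneg (hf _).le, Real.norm_of_nonneg (hf _).le]

/-- A sequence of exponential growth that is almost log-convex has convergent ratios. -/
theorem exists_ratio_tendsto {W : ℕ → ℝ} (hW : ∀ n, 1 ≤ W n) (hmono : Monotone W)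
    (hconv : ∀ n, (W (n + 1) - 1) ^ 2 ≤ W n * W (n + 2))
    {A : ℝ} (hA : ∀ n, W n ≤ A ^ n) {a β : ℝ} (ha : 0 < a) (hβ : 1 < β)
    (hlow : ∀ᶠ n in atTop, a * β ^ n ≤ W n) :
    ∃ ρ, 1 < ρ ∧ Tendsto (fun n => W (n + 1) / W n) atTop (nhds ρ) := by
  have hpos : ∀ n, 0 < W n := fun n => zero_lt_one.trans_le (hW n)
  have hβ0 : 0 < β := zero_lt_one.trans hβ
  have hsumW : Summable fun n => 1 / W n := by
    refine Summable.of_norm_bounded_eventually_nat (g := fun n => a⁻¹ * β⁻¹ ^ n)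
      ((summable_geometric_of_lt_one (by positivity) (inv_lt_one_of_one_lt₀ hβ)).mul_left _) ?_
    filter_upwards [hlow] with n hn
    rw [Real.norm_of_nonneg (by have := hpos n; positivity), inv_pow, ← mul_inv, one_div]
    exact inv_anti₀ (by positivity) hn
  have hA0 : 0 < A := by
    have := (hpos 1).trans_le (hA 1)
    simpa using this
  obtain ⟨s, hs⟩ := exists_tendsto_of_le_add_summable (s := fun n => W n / W (n + 1))
    (ε := fun n => 2 * (1 / W (n + 1))) (fun n => (div_pos (hpos _) (hpos _)).le)
    (fun n => by have := hpos (n + 1); positivity)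
    (((summable_nat_add_iff 1).2 hsumW).mul_left 2) (fun n => by
      have h1 := hpos n
      have h2 := hpos (n + 1)
      have h3 := hpos (n + 2)
      have h4 := hconv n
      have h5 := hmono (Nat.le_succ (n + 1))
      rw [Nat.succ_eq_add_one] at h5
      change W (n + 1) / W (n + 2) ≤ _
      rw [mul_one_div, ← add_div, div_le_div_iff₀ h3 h2]
      nlinarith)
  have hs0 : 0 ≤ s := ge_of_tendsto' hs fun n => (div_pos (hpos _) (hpos _)).le
  have hs1 : 0 < s := by
    refine lt_of_le_of_ne hs0 fun h0 => ?_
    have := tendsto_zero_of_ratio_lt_one (f := fun n => A ^ n / W n) zero_lt_one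
      (fun n => div_pos (pow_pos hA0 n) (hpos n)) (by
        have := hs.const_mul A
        rw [← h0, mul_zero] at this
        refine this.congr fun n => ?_
        have h1 := hpos n
        have h2 := hpos (n + 1)
        field_simp
        ring)
    have := ge_of_tendsto' this fun n => (one_le_div (hpos n)).2 (hA n)
    linarith
  have hinv : Tendsto (fun n => W (n + 1) / W n) atTop (nhds s⁻¹) :=
    (hs.inv₀ hs1.ne').congr fun n => by rw [inv_div]
  refine ⟨s⁻¹, ?_, hinv⟩
  by_contra hle
  rw [not_lt] at hle
  have := tendsto_zero_of_ratio_lt_one (f := fun n => W n / β ^ n) (l := s⁻¹ / β)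
    ((div_lt_one hβ0).2 (hle.trans_lt hβ))
    (fun n => div_pos (hpos n) (pow_pos hβ0 n)) ((hinv.div_const β).congr fun n => by
      have h1 := hpos n
      field_simp
      ring)
  have := ge_of_tendsto this (b := a) (hlow.mono fun n hn => (le_div_iff₀ (pow_pos hβ0 n)).2 hn)
  linarith

theorem ratio_tendsto_sub {X : ℕ → ℝ} (hX : ∀ n, 0 < X n) {L : ℝ} (hL : 1 < L)
    (h : Tendsto (fun n => X (n + 1) / X n) atTop (nhds L)) :
    Tendsto (fun n => (X (n + 2) - X (n + 1)) / (X (n + 1) - X n)) atTop (nhds L) := by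
  have h' : Tendsto (fun n => X (n + 2) / X (n + 1)) atTop (nhds L) :=
    h.comp (tendsto_add_atTop_nat 1)
  have := ((h'.sub_const 1).mul h).div (h.sub_const 1) (by linarith)
  rw [mul_div_cancel_left₀ _ (by linarith)] at this
  refine this.congr fun n => ?_
  have h1 := hX n
  have h2 := hX (n + 1)
  simp only [Pi.div_apply]
  rw [show (X (n + 2) / X (n + 1) - 1) * (X (n + 1) / X n) = (X (n + 2) - X (n + 1)) / X n by
    field_simp, show X (n + 1) / X n - 1 = (X (n + 1) - X n) / X n by field_simp]
  rw [div_div_div_cancel_right₀ h1.ne']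

/-- If the ratios of a positive sequence converge to a positive limit, the roots have the
same limit. -/
theorem eq_of_ratio_tendsto_of_root_tendsto {g : ℕ → ℝ} (hg : ∀ᶠ n in atTop, 0 < g n)
    {L c : ℝ} (hL : 0 < L)
    (hratio : Tendsto (fun n => g (n + 1) / g n) atTop (nhds L))
    (hroot : Tendsto (fun n : ℕ => g n ^ ((1 : ℝ) / (2 * n))) atTop (nhds c)) : c ^ 2 = L := by
  obtain ⟨n₀, hn₀⟩ := eventually_atTop.1 hg
  have hlog : Tendsto (fun n => Real.log (g (n + 1)) - Real.log (g n)) atTop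
      (nhds (Real.log L)) := by
    refine (hratio.log hL.ne').congr' ?_
    filter_upwards [eventually_ge_atTop n₀] with n hn
    rw [Real.log_div (hn₀ _ (by omega)).ne' (hn₀ _ hn).ne']
  have h1 := hlog.cesaro
  simp only [Finset.sum_range_sub (fun n => Real.log (g n))] at h1
  have h2 : Tendsto (fun n : ℕ => (n : ℝ)⁻¹ * Real.log (g n)) atTop (nhds (Real.log L)) := by
    have := h1.add ((tendsto_inv_atTop_nhds_zero_nat (𝕜 := ℝ)).mul_const (Real.log (g 0)))
    rw [zero_mul, add_zero] at this
    exact this.congr fun n => by ring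
  have h3 := (Real.continuous_exp.tendsto _).comp h2
  rw [Real.exp_log hL] at h3
  refine tendsto_nhds_unique ((hroot.pow 2).congr' ?_) h3
  filter_upwards [eventually_ge_atTop n₀, eventually_gt_atTop 0] with n hn hn'
  have hgn := hn₀ n hn
  rw [Function.comp_apply, Real.rpow_def_of_pos hgn, ← Real.exp_nat_mul]
  congr 1
  have : (n : ℝ) ≠ 0 := by positivity
  push_cast
  field_simp

/-- Rescaled Chebyshev polynomials of the second kind: `u_{n+2} = X u_{n+1} - q u_n`. -/
noncomputable def scaledChebyshev (q : ℝ) : ℕ → Polynomial ℝ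
  | 0 => 1
  | 1 => Polynomial.X
  | n + 2 => Polynomial.X * scaledChebyshev q (n + 1) - Polynomial.C q * scaledChebyshev q n

theorem scaledChebyshev_add (q : ℝ) (m n : ℕ) :
    scaledChebyshev q (m + n + 2) = scaledChebyshev q (m + 1) * scaledChebyshev q (n + 1) -
      Polynomial.C q * (scaledChebyshev q m * scaledChebyshev q n) := by
  induction m using Nat.twoStepInduction generalizing n with
  | zero => simp [scaledChebyshev]
  | one =>
    rw [show 1 + n + 2 = n + 1 + 2 by ring]
    simp only [scaledChebyshev]
    ring
  | more m h1 h2 =>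
    rw [show m + 2 + n + 2 = m + n + 2 + 2 by ring, scaledChebyshev,
      show m + n + 2 + 1 = m + 1 + n + 2 by ring, h1, h2,
      show m + 2 + 1 = m + 1 + 2 by ring, scaledChebyshev.eq_3 q (m + 1), scaledChebyshev.eq_3 q m]
    ring

theorem scaledChebyshev_sq (q : ℝ) (n : ℕ) :
    scaledChebyshev q (n + 1) * scaledChebyshev q (n + 1) = scaledChebyshev q (2 * (n + 1)) +
      Polynomial.C q * (scaledChebyshev q n * scaledChebyshev q n) := by
  rw [show 2 * (n + 1) = n + n + 2 by ring, scaledChebyshev_add]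
  ring

theorem scaledChebyshev_mul_add_two (q : ℝ) (n : ℕ) :
    scaledChebyshev q n * scaledChebyshev q (n + 2) =
      scaledChebyshev q (n + 1) * scaledChebyshev q (n + 1) - Polynomial.C (q ^ (n + 1)) := by
  induction n with
  | zero => simp [scaledChebyshev]
  | succ n ih =>
    rw [scaledChebyshev.eq_3 q (n + 1), scaledChebyshev.eq_3 q n] at *
    simp only [Polynomial.C_pow] at *
    rw [pow_succ]
    linear_combination Polynomial.C q * ih

namespace FreeGroup

section
variable {r : ℕ}

theorem finite_norm_le (n : ℕ) : {x : FreeGroup (Fin r) | norm x ≤ n}.Finite :=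
  (List.finite_length_le (Fin r × Bool) n).preimage toWord_injective.injOn

/-- Elements of length at most `n` and of the same parity as `n`. -/
noncomputable def parityBall (r n : ℕ) : Finset (FreeGroup (Fin r)) :=
  ((finite_norm_le n).subset
    (t := {x : FreeGroup (Fin r) | norm x ≤ n ∧ norm x % 2 = n % 2}) fun _ h => h.1).toFinset

theorem mem_parityBall {n : ℕ} {x : FreeGroup (Fin r)} :
    x ∈ parityBall r n ↔ norm x ≤ n ∧ norm x % 2 = n % 2 := by
  simp [parityBall]

theorem inv_mem_parityBall {n : ℕ} {x : FreeGroup (Fin r)} :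
    x⁻¹ ∈ parityBall r n ↔ x ∈ parityBall r n := by
  simp [mem_parityBall]

theorem parityBall_zero : parityBall r 0 = {1} := by
  ext x
  simp [mem_parityBall]
  rintro rfl
  simp

/-- The inverse of a letter. -/
def letterInv (s : Fin r × Bool) : Fin r × Bool := (s.1, !s.2)

theorem letterInv_letterInv (s : Fin r × Bool) : letterInv (letterInv s) = s := by
  simp [letterInv]

theorem inv_mk_singleton (s : Fin r × Bool) : (mk [s])⁻¹ = mk [letterInv s] := by
  simp [inv_mk, invRev, letterInv]

theorem letterInv_involutive : Function.Involutive (letterInv (r := r)) := letterInv_letterInv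

theorem eq_letterInv_iff {s t : Fin r × Bool} : s = letterInv t ↔ s.1 = t.1 ∧ s.2 = !t.2 :=
  Prod.ext_iff

theorem norm_mk_singleton_mul (s : Fin r × Bool) (y : FreeGroup (Fin r)) :
    norm (mk [s] * y) = match y.toWord with
      | [] => 1
      | a :: _ => if s = letterInv a then norm y - 1 else norm y + 1 := by
  have h : (mk [s] * y).toWord = reduce (s :: y.toWord) := by
    rw [toWord_mul, toWord_mk, reduce_singleton, List.singleton_append]
  rw [norm, h, reduce.cons, reduce_toWord]
  rcases hy : y.toWord with _ | ⟨a, l⟩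
  · simp
  · have hn : norm y = l.length + 1 := by rw [norm, hy, List.length_cons]
    simp only [← eq_letterInv_iff]
    split_ifs <;> simp [hn]

theorem card_letters_mul_mem_parityBall (n : ℕ) (y : FreeGroup (Fin r)) :
    ((Finset.univ.filter fun s : Fin r × Bool => mk [s] * y ∈ parityBall r (n + 1)).card : ℝ) =
      (if y ∈ parityBall r (n + 2) then 1 else 0) +
        (2 * r - 1) * (if y ∈ parityBall r n then 1 else 0) := by
  have hall : ∀ {p : Fin r × Bool → Prop} [DecidablePred p], (∀ s, p s) →
      ((Finset.univ.filter p).card : ℝ) = 2 * r := by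
    intro p _ hp
    rw [Finset.filter_true_of_mem fun s _ => hp s]
    simp
    ring
  have hnone : ∀ {p : Fin r × Bool → Prop} [DecidablePred p], (∀ s, ¬ p s) →
      ((Finset.univ.filter p).card : ℝ) = 0 := by
    intro p _ hp
    rw [Finset.filter_false_of_mem fun s _ => hp s]
    simp
  simp only [mem_parityBall, norm_mk_singleton_mul]
  rcases hy : y.toWord with _ | ⟨a, l⟩
  · have hn : norm y = 0 := by rw [norm, hy, List.length_nil]
    by_cases h : n % 2 = 0
    · rw [hall fun s => by simp; omega, if_pos (by omega), if_pos (by omega)]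
      ring
    · rw [hnone fun s => by simp; omega, if_neg (by omega), if_neg (by omega)]
      ring
  · have hn : norm y = l.length + 1 := by rw [norm, hy, List.length_cons]
    by_cases h : norm y % 2 = n % 2
    · by_cases h1 : norm y ≤ n
      · rw [hall fun s => by dsimp only; split_ifs <;> omega, if_pos (by omega), if_pos (by omega)]
        ring
      · by_cases h2 : norm y ≤ n + 2
        · rw [if_pos (by omega), if_neg (by omega)]
          have : (Finset.univ.filter fun s : Fin r × Bool =>
              (if s = letterInv a then norm y - 1 else norm y + 1) ≤ n + 1 ∧
              (if s = letterInv a then norm y - 1 else norm y + 1) % 2 = (n + 1) % 2) =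
                {letterInv a} := by
            ext s
            simp only [Finset.mem_filter, Finset.mem_univ, true_and, Finset.mem_singleton]
            split_ifs with hs
            · simp only [hs, iff_true]; omega
            · simp only [hs, iff_false]; omega
          rw [this]
          simp
        · rw [hnone fun s => by dsimp only; split_ifs <;> omega, if_neg (by omega),
            if_neg (by omega)]
          ring
    · rw [hnone fun s => by dsimp only; split_ifs <;> omega, if_neg (by omega), if_neg (by omega)]
      ring

theorem sum_letters_sum_parityBall (n : ℕ) (ψ : FreeGroup (Fin r) → ℝ) :
    ∑ s : Fin r × Bool, ∑ x ∈ parityBall r (n + 1), ψ (mk [s] * x) =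
      ∑ y ∈ parityBall r (n + 2), ψ y + (2 * r - 1) * ∑ y ∈ parityBall r n, ψ y := by
  classical
  have hsub : parityBall r n ⊆ parityBall r (n + 2) := fun x hx => by
    rw [mem_parityBall] at *
    omega
  have h1 : ∀ s : Fin r × Bool, ∑ x ∈ parityBall r (n + 1), ψ (mk [s] * x) =
      ∑ y ∈ parityBall r (n + 2), if mk [letterInv s] * y ∈ parityBall r (n + 1)
        then ψ y else 0 := by
    intro s
    rw [← Finset.sum_filter]
    refine Finset.sum_bij (fun x _ => mk [s] * x) ?_ ?_ ?_ ?_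
    · intro x hx
      rw [Finset.mem_filter, ← inv_mk_singleton, inv_mul_cancel_left]
      refine ⟨?_, hx⟩
      rw [mem_parityBall] at *
      rw [norm_mk_singleton_mul]
      rcases hw : x.toWord with _ | ⟨a, l⟩
      · have hn : norm x = 0 := by rw [norm, hw, List.length_nil]
        dsimp only
        omega
      · have hn : norm x = l.length + 1 := by rw [norm, hw, List.length_cons]
        dsimp only
        split_ifs <;> omega
    · intro x _ x' _ h
      exact mul_left_cancel h
    · intro y hy
      rw [Finset.mem_filter, ← inv_mk_singleton] at hy
      exact ⟨_, hy.2, mul_inv_cancel_left _ _⟩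
    · intro x _
      rfl
  simp_rw [h1]
  rw [Finset.sum_comm]
  have h2 : ∀ y, (∑ s : Fin r × Bool, if mk [letterInv s] * y ∈ parityBall r (n + 1)
      then ψ y else 0) = (if y ∈ parityBall r (n + 2) then ψ y else 0) +
        (2 * r - 1) * (if y ∈ parityBall r n then ψ y else 0) := by
    intro y
    rw [letterInv_involutive.bijective.sum_comp
      (fun s => if mk [s] * y ∈ parityBall r (n + 1) then ψ y else 0), ← Finset.sum_filter,
      Finset.sum_const, nsmul_eq_mul, card_letters_mul_mem_parityBall]
    split_ifs <;> ring
  simp_rw [h2]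
  rw [Finset.sum_add_distrib, ← Finset.mul_sum, Finset.sum_ite_mem, Finset.inter_self,
    Finset.sum_ite_mem, Finset.inter_eq_right.2 hsub]

/-- Sum over the right neighbours in the Cayley graph. -/
noncomputable def neighborSum (r : ℕ) : Module.End ℝ (FreeGroup (Fin r) → ℝ) where
  toFun φ g := ∑ s : Fin r × Bool, φ (g * mk [s])
  map_add' φ ψ := by ext g; simp [Finset.sum_add_distrib]
  map_smul' c φ := by ext g; simp [Finset.mul_sum]

theorem aeval_scaledChebyshev_apply (n : ℕ) (φ : FreeGroup (Fin r) → ℝ) (g : FreeGroup (Fin r)) :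
    Polynomial.aeval (neighborSum r) (scaledChebyshev (2 * r - 1) n) φ g =
      ∑ x ∈ parityBall r n, φ (g * x) := by
  induction n using Nat.twoStepInduction generalizing g with
  | zero => simp [scaledChebyshev, parityBall_zero]
  | one =>
    have h : parityBall r 1 = Finset.univ.image fun s : Fin r × Bool => mk [s] := by
      ext x
      simp only [mem_parityBall, Finset.mem_image, Finset.mem_univ, true_and]
      constructor
      · rintro ⟨h1, h2⟩
        have : x.toWord.length = 1 := by change norm x = 1; omega
        obtain ⟨s, hs⟩ := List.length_eq_one_iff.1 this
        exact ⟨s, by rw [← hs, mk_toWord]⟩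
      · rintro ⟨s, rfl⟩
        simp [norm]
    have hinj : Function.Injective fun s : Fin r × Bool => (mk [s] : FreeGroup (Fin r)) := by
      intro s t hst
      have := congrArg toWord hst
      simpa using this
    rw [h, Finset.sum_image hinj.injOn]
    simp [scaledChebyshev, neighborSum]
  | more n h1 h2 =>
    have h3 := sum_letters_sum_parityBall n (fun x => φ (g * x))
    rw [scaledChebyshev, map_sub, _root_.map_mul, _root_.map_mul, Polynomial.aeval_X,
      Polynomial.aeval_C, LinearMap.sub_apply, Module.End.mul_apply, Module.End.mul_apply,
      Pi.sub_apply, Module.algebraMap_end_apply, Pi.smul_apply, h1, smul_eq_mul,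
      sub_eq_iff_eq_add, ← h3]
    change ∑ s : Fin r × Bool, _ = _
    simp only [h2, mul_assoc]

variable (N : Subgroup (FreeGroup (Fin r)))

/-- The number of pairs in `parityBall r m × parityBall r n` whose product lies in `N`. -/
noncomputable def pairCount (m n : ℕ) : ℝ :=
  ∑ x ∈ parityBall r m, ∑ y ∈ parityBall r n, (N : Set (FreeGroup (Fin r))).indicator 1 (x * y)

/-- The number of elements of `N` in `parityBall r n`. -/
noncomputable def ballCount (n : ℕ) : ℝ :=
  ∑ x ∈ parityBall r n, (N : Set (FreeGroup (Fin r))).indicator 1 x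

theorem pairCount_eq_aeval (m n : ℕ) : pairCount N m n =
    Polynomial.aeval (neighborSum r) (scaledChebyshev (2 * r - 1) m * scaledChebyshev (2 * r - 1) n)
      ((N : Set (FreeGroup (Fin r))).indicator 1) 1 := by
  rw [_root_.map_mul, Module.End.mul_apply, aeval_scaledChebyshev_apply]
  simp only [aeval_scaledChebyshev_apply, one_mul, pairCount]

theorem ballCount_eq_aeval (n : ℕ) : ballCount N n =
    Polynomial.aeval (neighborSum r) (scaledChebyshev (2 * r - 1) n)
      ((N : Set (FreeGroup (Fin r))).indicator 1) 1 := by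
  rw [aeval_scaledChebyshev_apply]
  simp only [one_mul, ballCount]

theorem pairCount_succ_succ (n : ℕ) : pairCount N (n + 1) (n + 1) =
    ballCount N (2 * (n + 1)) + (2 * r - 1) * pairCount N n n := by
  rw [pairCount_eq_aeval, pairCount_eq_aeval, ballCount_eq_aeval, scaledChebyshev_sq, map_add,
    _root_.map_mul (Polynomial.aeval _) (Polynomial.C _), Polynomial.aeval_C, LinearMap.add_apply,
    Module.End.mul_apply, Module.algebraMap_end_apply]
  rfl

theorem pairCount_add_two (n : ℕ) : pairCount N n (n + 2) =
    pairCount N (n + 1) (n + 1) - (2 * r - 1) ^ (n + 1) := by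
  rw [pairCount_eq_aeval, pairCount_eq_aeval, scaledChebyshev_mul_add_two, map_sub,
    Polynomial.aeval_C, LinearMap.sub_apply, Pi.sub_apply, Module.algebraMap_end_apply,
    Pi.smul_apply, Set.indicator_of_mem (one_mem N)]
  simp

theorem pairCount_zero : pairCount N 0 0 = 1 := by
  simp [pairCount, parityBall_zero]

theorem sq_pairCount_le (m n : ℕ) : pairCount N m n ^ 2 ≤ pairCount N m m * pairCount N n n := by
  classical
  let Q := FreeGroup (Fin r) ⧸ N
  let π : FreeGroup (Fin r) → Q := fun x => (x : Q)
  let f : ℕ → Q → ℝ := fun k c => ∑ x ∈ parityBall r k, if π x = c then 1 else 0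
  let T : Finset Q := (parityBall r m ∪ parityBall r n).image π
  have key : ∀ k l, (k = m ∨ k = n) → pairCount N k l = ∑ c ∈ T, f k c * f l c := by
    intro k l hk
    have hinv : pairCount N k l = ∑ x ∈ parityBall r k, ∑ y ∈ parityBall r l,
        (N : Set (FreeGroup (Fin r))).indicator 1 (x⁻¹ * y) := by
      refine Finset.sum_bij (fun x _ => x⁻¹) (fun x hx => inv_mem_parityBall.2 hx)
        (fun x _ y _ h => inv_injective h)
        (fun x hx => ⟨x⁻¹, inv_mem_parityBall.2 hx, inv_inv x⟩) (fun x _ => by rw [inv_inv])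
    rw [hinv]
    simp only [f, Finset.sum_mul_sum]
    rw [Finset.sum_comm (s := T)]
    refine Finset.sum_congr rfl fun x hx => ?_
    rw [Finset.sum_comm (s := T)]
    refine Finset.sum_congr rfl fun y _ => ?_
    have hxT : π x ∈ T := by
      refine Finset.mem_image_of_mem _ (Finset.mem_union.2 ?_)
      rcases hk with rfl | rfl
      · exact Or.inl hx
      · exact Or.inr hx
    have : π y = π x ↔ x⁻¹ * y ∈ N := by
      rw [eq_comm]
      exact QuotientGroup.eq
    rw [Finset.sum_eq_single_of_mem _ hxT fun c _ hc => by rw [if_neg hc.symm, zero_mul]]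
    simp [Set.indicator_apply, this]
  rw [key m n (Or.inl rfl), key m m (Or.inl rfl), key n n (Or.inr rfl)]
  simpa only [← pow_two] using Finset.sum_mul_sq_le_sq_mul_sq T (f m) (f n)


theorem isReduced_append_iff {A B : List (Fin r × Bool)} : IsReduced (A ++ B) ↔
    IsReduced A ∧ IsReduced B ∧ ∀ a ∈ A.getLast?, ∀ b ∈ B.head?, b ≠ letterInv a := by
  have h : ∀ a b : Fin r × Bool, (a.1 = b.1 → a.2 = b.2) ↔ b ≠ letterInv a := by
    rintro ⟨i, ε⟩ ⟨j, η⟩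
    cases ε <;> cases η <;> simp [letterInv, eq_comm]
  simp only [IsReduced, List.isChain_append, h]

theorem isReduced_cons_iff {a : Fin r × Bool} {B : List (Fin r × Bool)} : IsReduced (a :: B) ↔
    IsReduced B ∧ ∀ b ∈ B.head?, b ≠ letterInv a := by
  rw [← List.singleton_append, isReduced_append_iff]
  simp

theorem ne_letterInv_comm {a b : Fin r × Bool} : a ≠ letterInv b ↔ b ≠ letterInv a := by
  constructor <;> rintro h rfl <;> exact h (letterInv_letterInv _).symm

theorem exists_letter_ne (hr : 2 ≤ r) (a b c : Fin r × Bool) : ∃ f, f ≠ a ∧ f ≠ b ∧ f ≠ c := by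
  have h : ({a, b, c} : Finset (Fin r × Bool)).card < Fintype.card (Fin r × Bool) := by
    refine Finset.card_le_three.trans_lt ?_
    simp
    omega
  obtain ⟨f, hf⟩ := Finset.exists_mem_notMem_of_card_lt_card (s := {a, b, c})
    (t := Finset.univ) (by rwa [Finset.card_univ])
  exact ⟨f, by simpa using hf.2⟩

theorem mk_conj_mem {N : Subgroup (FreeGroup (Fin r))} (hN : N.Normal) {w : List (Fin r × Bool)}
    (hw : mk w ∈ N) (f : Fin r × Bool) : mk (f :: w ++ [letterInv f]) ∈ N := by
  have h : (mk (f :: w ++ [letterInv f]) : FreeGroup (Fin r)) = mk [f] * mk w * (mk [f])⁻¹ := by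
    rw [inv_mk_singleton, mul_mk, mul_mk]
    rfl
  rw [h]
  exact hN.conj_mem _ hw _

/-- A nontrivial normal subgroup contains, for every letter `f`, a reduced word of a fixed even
length that starts with `f` and ends with the inverse of `f`. -/
theorem exists_reduced_words_mem (hr : 2 ≤ r) {N : Subgroup (FreeGroup (Fin r))} (hN : N.Normal)
    (hbot : N ≠ ⊥) : ∃ (L : ℕ) (F : (Fin r × Bool) → List (Fin r × Bool)), Even L ∧
      ∀ f, IsReduced (F f) ∧ mk (F f) ∈ N ∧ (F f).length = L ∧ (F f).head? = some f ∧
        (F f).getLast? = some (letterInv f) := by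
  obtain ⟨x, hxN, hx⟩ := N.bot_or_exists_ne_one.resolve_left hbot
  have hW : IsReduced x.toWord := isReduced_toWord
  have hWN : mk x.toWord ∈ N := by rwa [mk_toWord]
  have hne : x.toWord ≠ [] := by rwa [Ne, toWord_eq_nil_iff]
  generalize x.toWord = w at hW hWN hne
  obtain ⟨p, hp⟩ : ∃ p, w.head? = some p := ⟨_, List.head?_eq_some_head hne⟩
  obtain ⟨l, hl⟩ : ∃ l, w.getLast? = some l := ⟨_, List.getLast?_eq_some_getLast hne⟩
  obtain ⟨s, hs1, hs2, hs3⟩ := exists_letter_ne hr (letterInv p) (letterInv l) l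
  obtain ⟨s', hs'1, hs'2, -⟩ := exists_letter_ne hr (letterInv p) (letterInv s) p
  have hinj : ∀ {a b : Fin r × Bool}, letterInv a = letterInv b ↔ a = b :=
    letterInv_involutive.injective.eq_iff
  choose k hk1 hk2 _ using fun f => exists_letter_ne hr (letterInv f) (letterInv s') f
  refine ⟨2 * w.length + 8, fun f => f :: (k f :: (s' :: (w ++ (s :: w ++ [letterInv s])) ++
    [letterInv s']) ++ [letterInv (k f)]) ++ [letterInv f], ⟨w.length + 4, by ring⟩,
    fun f => ⟨?_, ?_, ?_, ?_, ?_⟩⟩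
  · have h1 := ne_letterInv_comm.1 (hk2 f)
    simp [-isReduced_cons_cons, isReduced_append_iff, isReduced_cons_iff, hp, hl,
      letterInv_letterInv, hinj, hW]
    exact ⟨⟨⟨⟨⟨⟨⟨⟨(hk1 f).symm, h1.symm⟩, (ne_letterInv_comm.1 hs'2).symm⟩, hs3⟩,
      ne_letterInv_comm.1 hs1⟩, hs2⟩, ne_letterInv_comm.1 hs'1⟩, h1⟩, hk1 f⟩
  · refine mk_conj_mem hN (mk_conj_mem hN (mk_conj_mem hN ?_ _) _) _
    rw [← mul_mk]
    exact N.mul_mem hWN (mk_conj_mem hN hWN s)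
  · simp
    ring
  · simp
  · exact List.getLast?_concat

/-- Triples `(a, Z, X)` such that `a :: Z` and `a :: X` are reduced words in the same coset. -/
structure IsInsertionPair (N : Subgroup (FreeGroup (Fin r))) (L m : ℕ)
    (p : (Fin r × Bool) × List (Fin r × Bool) × List (Fin r × Bool)) : Prop where
  reduced_left : IsReduced (p.1 :: p.2.1)
  reduced_right : IsReduced (p.1 :: p.2.2)
  length_right : p.2.2.length = m
  length_left : p.2.1.length ≤ (L + 1) * m
  even_length : Even (p.2.1.length + m)
  mem : mk (p.1 :: p.2.1) * (mk (p.1 :: p.2.2))⁻¹ ∈ N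

theorem exists_insertionPairs (hr : 2 ≤ r) {N : Subgroup (FreeGroup (Fin r))} (hN : N.Normal)
    {L : ℕ} (hL : Even L) {F : (Fin r × Bool) → List (Fin r × Bool)}
    (hF : ∀ f, IsReduced (F f) ∧ mk (F f) ∈ N ∧ (F f).length = L ∧ (F f).head? = some f ∧
        (F f).getLast? = some (letterInv f)) (t : ℝ) (m : ℕ) :
    ∃ Q : Finset ((Fin r × Bool) × List (Fin r × Bool) × List (Fin r × Bool)),
      (∀ p ∈ Q, IsInsertionPair N L m p) ∧
      ∑ p ∈ Q, t ^ p.2.1.length = ((2 * r - 1) * t * (1 + t ^ L)) ^ m := by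
  classical
  induction m with
  | zero =>
    refine ⟨{((⟨0, by omega⟩, true), [], [])}, fun p hp => ?_, by simp⟩
    rw [Finset.mem_singleton] at hp
    subst hp
    exact ⟨IsReduced.singleton, IsReduced.singleton, rfl, by simp, by simp,
      by rw [mul_inv_cancel]; exact N.one_mem⟩
  | succ m ih =>
    obtain ⟨Q, hQ, hsum⟩ := ih
    choose sel hsel1 hsel2 _ using fun b a : Fin r × Bool => exists_letter_ne hr (letterInv b) a a
    let step : (((Fin r × Bool) × List (Fin r × Bool) × List (Fin r × Bool)) ×
        (Fin r × Bool) × Bool) → (Fin r × Bool) × List (Fin r × Bool) × List (Fin r × Bool) :=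
      fun c => (c.2.1, (if c.2.2 then F (sel c.2.1 c.1.1) else []) ++ c.1.1 :: c.1.2.1,
        c.1.1 :: c.1.2.2)
    have hinj : Function.Injective step := by
      rintro ⟨⟨a, Z, X⟩, b, ε⟩ ⟨⟨a', Z', X'⟩, b', ε'⟩ h
      simp only [step, Prod.mk.injEq, List.cons.injEq] at h
      obtain ⟨rfl, h, rfl, rfl⟩ := h
      have hhead : ∀ Z Z' : List (Fin r × Bool), a :: Z ≠ F (sel b a) ++ a :: Z' := by
        intro Z Z' h
        have := congrArg List.head? h
        rw [List.head?_append, (hF _).2.2.2.1] at this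
        simp at this
        exact hsel2 b a this.symm
      cases ε <;> cases ε' <;> simp at h
      · rw [h]
      · exact absurd h (hhead _ _)
      · exact absurd h.symm (hhead _ _)
      · rw [h]
    refine ⟨((Q ×ˢ Finset.univ).filter fun c => c.2.1 ≠ letterInv c.1.1).image step, ?_, ?_⟩
    · intro p hp
      simp only [Finset.mem_image, Finset.mem_filter, Finset.mem_product] at hp
      obtain ⟨⟨⟨a, Z, X⟩, b, ε⟩, ⟨⟨hp, -⟩, hb⟩, rfl⟩ := hp
      obtain ⟨h1, h2, h3, h4, h5, h6⟩ := hQ _ hp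
      simp only at h1 h2 h3 h4 h5 h6 hb
      have hb' := ne_letterInv_comm.1 hb
      obtain ⟨f1, f2, f3, f4, f5⟩ := hF (sel b a)
      have hs1 := hsel1 b a
      have hs2 := (hsel2 b a).symm
      have hmem : mk (b :: (a :: Z)) * (mk (b :: a :: X))⁻¹ ∈ N := by
        have : (mk (b :: (a :: Z)) * (mk (b :: a :: X))⁻¹ : FreeGroup (Fin r)) =
            mk [b] * (mk (a :: Z) * (mk (a :: X))⁻¹) * (mk [b])⁻¹ := by
          rw [← List.singleton_append, ← mul_mk, ← List.singleton_append (l := a :: X), ← mul_mk]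
          group
        rw [this]
        exact hN.conj_mem _ h6 _
      refine ⟨?_, ?_, ?_, ?_, ?_, ?_⟩
      · cases ε
        · simpa [step, isReduced_cons_iff (a := b), h1] using hb'
        · simp [step, isReduced_cons_iff (a := b), isReduced_append_iff, h1, f1, f4, f5,
            letterInv_letterInv, hs1, hs2]
      · simpa [step, isReduced_cons_iff (a := b), h2] using hb'
      · simp [step, h3]
      · cases ε
        · simp [step]; nlinarith
        · simp [step, f3]; nlinarith
      · cases ε
        · simp [step]; rw [show Z.length + 1 + (m + 1) = Z.length + m + 2 by ring]
          exact h5.add (by norm_num)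
        · simp [step, f3]
          rw [show L + (Z.length + 1) + (m + 1) = Z.length + m + L + 2 by ring]
          exact (h5.add hL).add (by norm_num)
      · cases ε
        · simpa [step] using hmem
        · have : (mk (b :: (F (sel b a) ++ a :: Z)) * (mk (b :: a :: X))⁻¹ : FreeGroup (Fin r)) =
              (mk [b] * mk (F (sel b a)) * (mk [b])⁻¹) *
                (mk (b :: (a :: Z)) * (mk (b :: a :: X))⁻¹) := by
            rw [← List.singleton_append, ← mul_mk, ← mul_mk,
              ← List.singleton_append (l := a :: Z), ← mul_mk]
            group
          simp only [step, if_true]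
          rw [this]
          exact N.mul_mem (hN.conj_mem _ f2 _) hmem
    · rw [Finset.sum_image hinj.injOn, Finset.sum_filter, Finset.sum_product, pow_succ, ← hsum,
        Finset.sum_mul]
      refine Finset.sum_congr rfl fun p _ => ?_
      rw [Fintype.sum_prod_type]
      have hcard : ((Finset.univ.filter fun b : Fin r × Bool => b ≠ letterInv p.1).card : ℝ) =
          2 * r - 1 := by
        rw [Finset.filter_ne', Finset.card_erase_of_mem (Finset.mem_univ _), Finset.card_univ,
          Fintype.card_prod, Fintype.card_fin, Fintype.card_bool, Nat.cast_sub (by omega)]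
        push_cast
        ring
      have : ∀ b : Fin r × Bool, (∑ ε : Bool, if b ≠ letterInv p.1 then
          t ^ (step (p, b, ε)).2.1.length else 0) =
          if b ≠ letterInv p.1 then t ^ p.2.1.length * (t * (1 + t ^ L)) else 0 := by
        intro b
        split_ifs
        · simp [step, (hF _).2.2.1]
          ring
        · simp
      rw [Finset.sum_congr rfl fun b _ => this b, ← Finset.sum_filter, Finset.sum_const,
        nsmul_eq_mul, hcard]
      ring

theorem exists_finset_exponential_weight (hr : 2 ≤ r) {N : Subgroup (FreeGroup (Fin r))}
    (hN : N.Normal) (hbot : N ≠ ⊥) (t : ℝ) (ht : (2 * r - 1) * t ^ 2 = 1) :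
    ∃ L : ℕ, ∀ m : ℕ, ∃ T : Finset (FreeGroup (Fin r)), (∀ x ∈ T, x ∈ N) ∧
      T ⊆ parityBall r (2 * ((L + 2) * (m + 1))) ∧
      ∑ x ∈ T, t ^ norm x = t ^ (L + 2) * (1 + t ^ L) ^ m := by
  classical
  obtain ⟨L, F, hL, hF⟩ := exists_reduced_words_mem hr hN hbot
  refine ⟨L, fun m => ?_⟩
  obtain ⟨Q, hQ, hsum⟩ := exists_insertionPairs hr hN hL hF t m
  choose sel hsel _ _ using fun a : Fin r × Bool => exists_letter_ne hr a a a
  let word : (Fin r × Bool) × List (Fin r × Bool) × List (Fin r × Bool) → List (Fin r × Bool) :=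
    fun p => invRev (p.1 :: p.2.2) ++ (F (sel p.1) ++ p.1 :: p.2.1)
  have hred : ∀ p ∈ Q, IsReduced (word p) := by
    intro p hp
    obtain ⟨h1, h2, -⟩ := hQ p hp
    obtain ⟨f1, f2, f3, f4, f5⟩ := hF (sel p.1)
    have h2' : IsReduced (invRev (p.1 :: p.2.2)) := by
      rw [isReduced_iff_reduce_eq, reduce_invRev, h2.reduce_eq]
    have hlast : (invRev (p.1 :: p.2.2)).getLast? = some (letterInv p.1) := by
      simp [invRev, letterInv]
    simp only [word, isReduced_append_iff, h2', f1, h1, hlast, List.head?_append, f4, f5]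
    simpa [letterInv_letterInv] using ⟨(hsel p.1).symm, hsel p.1⟩
  have hnorm : ∀ p ∈ Q, norm (mk (word p)) = p.2.1.length + (m + 2 + L) := by
    intro p hp
    rw [norm, toWord_mk, (hred p hp).reduce_eq]
    simp [word, (hF _).2.2.1, (hQ p hp).length_right]
    ring
  have hinj : Set.InjOn (fun p => (mk (word p) : FreeGroup (Fin r))) Q := by
    rintro ⟨a, Z, X⟩ hp ⟨a', Z', X'⟩ hp' h
    have h := congrArg toWord h
    simp only [toWord_mk, (hred _ hp).reduce_eq, (hred _ hp').reduce_eq] at h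
    obtain ⟨h1, h2⟩ := List.append_inj h (by
      have h1 := (hQ _ hp).length_right
      have h2 := (hQ _ hp').length_right
      simp only at h1 h2
      simp [h1, h2])
    have h1 := invRev_injective h1
    simp only [List.cons.injEq] at h1
    obtain ⟨rfl, rfl⟩ := h1
    have h2 := List.append_cancel_left h2
    simp only [List.cons.injEq, true_and] at h2
    rw [h2]
  refine ⟨Q.image fun p => mk (word p), ?_, ?_, ?_⟩
  · intro x hx
    obtain ⟨p, hp, rfl⟩ := Finset.mem_image.1 hx
    have : (mk (word p) : FreeGroup (Fin r)) = (mk (p.1 :: p.2.2))⁻¹ * (mk (F (sel p.1)) *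
        (mk (p.1 :: p.2.1) * (mk (p.1 :: p.2.2))⁻¹)) * ((mk (p.1 :: p.2.2))⁻¹)⁻¹ := by
      simp only [word, ← mul_mk, ← inv_mk]
      group
    rw [this]
    exact hN.conj_mem _ (N.mul_mem (hF _).2.1 (hQ p hp).mem) _
  · intro x hx
    obtain ⟨p, hp, rfl⟩ := Finset.mem_image.1 hx
    rw [mem_parityBall, hnorm p hp]
    have h1 := (hQ p hp).length_left
    obtain ⟨e, he⟩ := (hQ p hp).even_length
    obtain ⟨d, hd⟩ := hL
    constructor
    · nlinarith
    · omega
  · rw [Finset.sum_image hinj, Finset.sum_congr rfl fun p hp => by rw [hnorm p hp, pow_add],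
      ← Finset.sum_mul, hsum]
    calc ((2 * r - 1) * t * (1 + t ^ L)) ^ m * t ^ (m + 2 + L)
        = ((2 * r - 1) * t ^ 2) ^ m * (t ^ (L + 2) * (1 + t ^ L) ^ m) := by
          simp only [mul_pow]; ring
      _ = _ := by rw [ht, one_pow, one_mul]

theorem ballCount_zero : ballCount N 0 = 1 := by
  simp [ballCount, parityBall_zero]

theorem ballCount_eq_card (n : ℕ) :
    ballCount N n = Nat.card {x : FreeGroup (Fin r) // x ∈ N ∧ x ∈ parityBall r n} := by
  classical
  rw [Nat.subtype_card ((parityBall r n).filter fun x => x ∈ N) fun x => by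
    rw [Finset.mem_filter, and_comm]]
  simp [ballCount, Set.indicator_apply]

theorem ballCount_add_two (n : ℕ) : ballCount N (n + 2) = ballCount N n +
    Nat.card {x : FreeGroup (Fin r) // x ∈ N ∧ norm x = n + 2} := by
  classical
  have hdisj : Disjoint ((parityBall r n).filter fun x => x ∈ N)
      ((parityBall r (n + 2)).filter fun x => x ∈ N ∧ norm x = n + 2) := by
    rw [Finset.disjoint_left]
    intro x hx hx'
    simp only [Finset.mem_filter, mem_parityBall] at hx hx'
    omega
  have h1 : Nat.card {x : FreeGroup (Fin r) // x ∈ N ∧ x ∈ parityBall r n} =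
      ((parityBall r n).filter fun x => x ∈ N).card :=
    Nat.subtype_card _ fun x => by rw [Finset.mem_filter, and_comm]
  have h2 : Nat.card {x : FreeGroup (Fin r) // x ∈ N ∧ norm x = n + 2} =
      ((parityBall r (n + 2)).filter fun x => x ∈ N ∧ norm x = n + 2).card :=
    Nat.subtype_card _ fun x => by
      rw [Finset.mem_filter, mem_parityBall]
      exact ⟨fun h => h.2, fun h => ⟨by omega, h⟩⟩
  have h3 : Nat.card {x : FreeGroup (Fin r) // x ∈ N ∧ x ∈ parityBall r (n + 2)} =
      (((parityBall r n).filter fun x => x ∈ N) ∪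
        (parityBall r (n + 2)).filter fun x => x ∈ N ∧ norm x = n + 2).card := by
    refine Nat.subtype_card _ fun x => ?_
    simp only [Finset.mem_union, Finset.mem_filter, mem_parityBall]
    constructor
    · rintro (⟨h1, h2⟩ | ⟨h1, h2, -⟩)
      · exact ⟨h2, by omega, by omega⟩
      · exact ⟨h2, h1⟩
    · rintro ⟨h1, h2, h3⟩
      by_cases h : norm x = n + 2
      · exact Or.inr ⟨⟨h2, h3⟩, h1, h⟩
      · exact Or.inl ⟨by omega, h1⟩
  rw [ballCount_eq_card, ballCount_eq_card, h3, h1, h2, ← Nat.cast_add,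
    Finset.card_union_of_disjoint hdisj]

theorem ballCount_le (n : ℕ) : ballCount N n ≤ (2 * r + 1) ^ n := by
  have hinj : Function.Injective
      fun (x : {x : FreeGroup (Fin r) // x ∈ N ∧ x ∈ parityBall r n}) (i : Fin n) =>
        x.1.toWord[(i : ℕ)]? := by
    intro x y h
    refine Subtype.ext (toWord_injective (List.ext_getElem? fun i => ?_))
    by_cases hi : i < n
    · exact congrFun h ⟨i, hi⟩
    · have hx := (mem_parityBall.1 x.2.2).1
      have hy := (mem_parityBall.1 y.2.2).1
      rw [norm] at hx hy
      rw [List.getElem?_eq_none (by omega), List.getElem?_eq_none (by omega)]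
  have := Nat.card_le_card_of_injective _ hinj
  rw [ballCount_eq_card]
  refine (Nat.cast_le.2 this).trans_eq ?_
  simp [mul_comm]

/-- `pairCount N n n` normalised by `(2 * r - 1) ^ n`. -/
noncomputable def normalizedPairCount (n : ℕ) : ℝ := pairCount N n n / (2 * r - 1) ^ n

theorem normalizedPairCount_zero : normalizedPairCount N 0 = 1 := by
  simp [normalizedPairCount, pairCount_zero]

theorem normalizedPairCount_succ (hr : 2 ≤ r) (n : ℕ) :
    normalizedPairCount N (n + 1) = normalizedPairCount N n +
      ballCount N (2 * (n + 1)) / (2 * r - 1) ^ (n + 1) := by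
  have hr' : (2 : ℝ) ≤ r := by exact_mod_cast hr
  have hq : (2 * r - 1 : ℝ) ≠ 0 := by linarith
  rw [normalizedPairCount, normalizedPairCount, pairCount_succ_succ]
  field_simp
  ring

theorem ballCount_pos (n : ℕ) : 0 < ballCount N (2 * n) := by
  induction n with
  | zero => simp [ballCount_zero]
  | succ n ih =>
    rw [show 2 * (n + 1) = 2 * n + 2 by ring, ballCount_add_two]
    positivity

theorem normalizedPairCount_mono (hr : 2 ≤ r) : Monotone (normalizedPairCount N) := by
  refine monotone_nat_of_le_succ fun n => ?_
  have hr' : (2 : ℝ) ≤ r := by exact_mod_cast hr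
  have hq : (0 : ℝ) < 2 * r - 1 := by linarith
  have := ballCount_pos N (n + 1)
  rw [normalizedPairCount_succ N hr, le_add_iff_nonneg_right]
  positivity

theorem one_le_normalizedPairCount (hr : 2 ≤ r) (n : ℕ) : 1 ≤ normalizedPairCount N n := by
  rw [← normalizedPairCount_zero N]
  exact normalizedPairCount_mono N hr n.zero_le

theorem normalizedPairCount_conv (hr : 2 ≤ r) (n : ℕ) :
    (normalizedPairCount N (n + 1) - 1) ^ 2 ≤
      normalizedPairCount N n * normalizedPairCount N (n + 2) := by
  have hr' : (2 : ℝ) ≤ r := by exact_mod_cast hr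
  have hq : (0 : ℝ) < 2 * r - 1 := by linarith
  have h := sq_pairCount_le N n (n + 2)
  rw [pairCount_add_two] at h
  have h1 : (normalizedPairCount N (n + 1) - 1) ^ 2 =
      (pairCount N (n + 1) (n + 1) - (2 * r - 1) ^ (n + 1)) ^ 2 / (2 * r - 1) ^ (2 * n + 2) := by
    rw [normalizedPairCount]
    field_simp
    ring
  rw [h1, normalizedPairCount, normalizedPairCount, div_mul_div_comm, ← pow_add,
    show n + (n + 2) = 2 * n + 2 by ring]
  gcongr

theorem normalizedPairCount_le (hr : 2 ≤ r) (n : ℕ) :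
    normalizedPairCount N n ≤ ((2 * r + 1) ^ 2 + 1) ^ n := by
  have hr' : (2 : ℝ) ≤ r := by exact_mod_cast hr
  induction n with
  | zero => simp [normalizedPairCount_zero]
  | succ n ih =>
    set A : ℝ := (2 * r + 1) ^ 2 with hA
    have hA1 : 0 ≤ A := by positivity
    have h1 : ballCount N (2 * (n + 1)) / (2 * r - 1) ^ (n + 1) ≤ A ^ (n + 1) := by
      have hone : (1 : ℝ) ≤ (2 * r - 1) ^ (n + 1) := one_le_pow₀ (by linarith)
      refine (div_le_self (ballCount_pos N _).le hone).trans ((ballCount_le N _).trans_eq ?_)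
      rw [hA, pow_mul]
    have h2 : A ^ n ≤ (A + 1) ^ n := by gcongr; linarith
    have h3 : A ^ n * A ≤ (A + 1) ^ n * A := by gcongr
    rw [pow_succ A] at h1
    rw [normalizedPairCount_succ N hr, pow_succ (A + 1)]
    linarith

theorem sum_indicator_mul_pow_norm_le (hr : 2 ≤ r) {t : ℝ} (ht : (2 * r - 1) * t ^ 2 = 1)
    (n : ℕ) : ∑ x ∈ parityBall r (2 * n), (N : Set (FreeGroup (Fin r))).indicator 1 x * t ^ norm x ≤
      normalizedPairCount N n := by
  classical
  have hr' : (2 : ℝ) ≤ r := by exact_mod_cast hr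
  have hq : (0 : ℝ) < 2 * r - 1 := by linarith
  have ht2 : t ^ 2 = (2 * r - 1 : ℝ)⁻¹ := eq_inv_of_mul_eq_one_right ht
  have hI : ∀ x, 0 ≤ (N : Set (FreeGroup (Fin r))).indicator (1 : FreeGroup (Fin r) → ℝ) x :=
    fun x => Set.indicator_nonneg (fun _ _ => zero_le_one) x
  induction n with
  | zero => simp [parityBall_zero, normalizedPairCount_zero]
  | succ n ih =>
    have hsub : parityBall r (2 * n) ⊆ parityBall r (2 * (n + 1)) := fun x hx => by
      rw [mem_parityBall] at *
      omega
    have htn : t ^ (2 * (n + 1)) = ((2 * r - 1 : ℝ) ^ (n + 1))⁻¹ := by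
      rw [pow_mul, ht2, inv_pow]
    rw [normalizedPairCount_succ N hr, ← Finset.sum_sdiff hsub, add_comm]
    refine add_le_add ih ?_
    rw [div_eq_mul_inv, ← htn, ballCount, Finset.sum_mul]
    refine (Finset.sum_congr rfl fun x hx => ?_).trans_le
      (Finset.sum_le_sum_of_subset_of_nonneg Finset.sdiff_subset fun x _ _ =>
        mul_nonneg (hI x) (by rw [htn]; positivity))
    simp only [Finset.mem_sdiff, mem_parityBall] at hx
    rw [show norm x = 2 * (n + 1) by omega]

theorem exists_exponential_le_normalizedPairCount (hr : 2 ≤ r) (hN : N.Normal) (hbot : N ≠ ⊥) :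
    ∃ a β : ℝ, 0 < a ∧ 1 < β ∧ ∀ᶠ n in atTop, a * β ^ n ≤ normalizedPairCount N n := by
  classical
  have hr' : (2 : ℝ) ≤ r := by exact_mod_cast hr
  have hq : (0 : ℝ) < 2 * r - 1 := by linarith
  set t : ℝ := √(2 * r - 1)⁻¹ with ht_def
  have ht0 : 0 < t := Real.sqrt_pos.2 (by positivity)
  have ht : (2 * r - 1) * t ^ 2 = 1 := by
    rw [ht_def, Real.sq_sqrt (by positivity), mul_inv_cancel₀ hq.ne']
  obtain ⟨L, hT⟩ := exists_finset_exponential_weight hr hN hbot t ht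
  have hlow : ∀ m, t ^ (L + 2) * (1 + t ^ L) ^ m ≤
      normalizedPairCount N ((L + 2) * (m + 1)) := by
    intro m
    obtain ⟨T, hTN, hTB, hsum⟩ := hT m
    rw [← hsum]
    refine le_trans ?_ (sum_indicator_mul_pow_norm_le N hr ht _)
    refine (Finset.sum_congr rfl fun x hx => ?_).trans_le
      (Finset.sum_le_sum_of_subset_of_nonneg hTB fun x _ _ =>
        mul_nonneg (Set.indicator_nonneg (fun _ _ => zero_le_one) x) (by positivity))
    rw [Set.indicator_of_mem (hTN x hx), Pi.one_apply, one_mul]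
  set δ := t ^ L with hδ_def
  have hδ : 0 < δ := by positivity
  set β : ℝ := (1 + δ) ^ ((1 : ℝ) / (L + 2 : ℕ)) with hβ_def
  have hβ : 1 < β := Real.one_lt_rpow (by linarith) (by positivity)
  have hβpow : β ^ (L + 2) = 1 + δ := by
    rw [hβ_def, one_div]
    exact Real.rpow_inv_natCast_pow (by linarith) (by omega)
  refine ⟨t ^ (L + 2) / (1 + δ) ^ 2, β, by positivity, hβ, ?_⟩
  filter_upwards [eventually_ge_atTop (L + 2)] with n hn
  obtain ⟨m, hm⟩ : ∃ m, n / (L + 2) = m + 1 :=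
    Nat.exists_eq_succ_of_ne_zero (Nat.div_pos hn (by omega)).ne'
  have h1 : (L + 2) * (m + 1) ≤ n := hm ▸ Nat.mul_div_le n (L + 2)
  have h2 : n ≤ (L + 2) * (m + 2) := by
    have := Nat.lt_mul_div_succ n (show 0 < L + 2 by omega)
    rw [hm] at this
    exact this.le
  refine le_trans ?_ ((hlow m).trans (normalizedPairCount_mono N hr h1))
  have h3 : β ^ n ≤ (1 + δ) ^ m * (1 + δ) ^ 2 := by
    rw [← pow_add, ← hβpow, ← pow_mul]
    exact pow_le_pow_right₀ hβ.le h2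
  calc t ^ (L + 2) / (1 + δ) ^ 2 * β ^ n
      ≤ t ^ (L + 2) / (1 + δ) ^ 2 * ((1 + δ) ^ m * (1 + δ) ^ 2) := by gcongr
    _ = _ := by field_simp

/-- The ratios of the even cogrowth coefficients converge to some real number greater than `1`. -/
theorem exists_cogrowth_ratio_tendsto (hr : 2 ≤ r) (hN : N.Normal) (hbot : N ≠ ⊥) {g : ℕ → ℝ}
    (hg : ∀ n, g n = Nat.card {x : FreeGroup (Fin r) // x ∈ N ∧ norm x = 2 * n}) :
    ∃ L, 1 < L ∧ Tendsto (fun n => g (n + 1) / g n) atTop (nhds L) := by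
  have hr' : (2 : ℝ) ≤ r := by exact_mod_cast hr
  have hq : (0 : ℝ) < 2 * r - 1 := by linarith
  obtain ⟨a, β, ha, hβ, hlow⟩ := exists_exponential_le_normalizedPairCount N hr hN hbot
  obtain ⟨ρ, hρ, hW⟩ := exists_ratio_tendsto (one_le_normalizedPairCount N hr)
    (normalizedPairCount_mono N hr) (normalizedPairCount_conv N hr) (normalizedPairCount_le N hr)
    ha hβ hlow
  have hL : 1 < (2 * r - 1) * ρ := by nlinarith
  have hU : Tendsto (fun n => ballCount N (2 * (n + 1)) / ballCount N (2 * n)) atTop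
      (nhds ((2 * r - 1) * ρ)) := by
    rw [← tendsto_add_atTop_iff_nat 1]
    have := (ratio_tendsto_sub
      (fun n => zero_lt_one.trans_le (one_le_normalizedPairCount N hr n)) hρ hW).const_mul
      (2 * r - 1 : ℝ)
    refine this.congr fun n => ?_
    have h1 := ballCount_pos N (n + 1)
    rw [normalizedPairCount_succ N hr (n + 1), normalizedPairCount_succ N hr n,
      add_sub_cancel_left, add_sub_cancel_left]
    field_simp
    ring
  refine ⟨(2 * r - 1) * ρ, hL, ?_⟩
  rw [← tendsto_add_atTop_iff_nat 1]
  refine (ratio_tendsto_sub (ballCount_pos N) hL hU).congr fun n => ?_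
  rw [hg, hg, show 2 * (n + 2) = 2 * (n + 1) + 2 by ring, ballCount_add_two, add_sub_cancel_left,
    show 2 * (n + 1) = 2 * n + 2 by ring, ballCount_add_two, add_sub_cancel_left]

end

end FreeGroup

/-- Let `r ≥ 2` and let `N` be a nontrivial normal subgroup of the free
group on `r` generators. Let `γ n` be the number of elements of `N` of reduced word
length `n`, and let `c = lim (γ (2n))^(1/(2n))` be the cogrowth exponent (the limit is
known to exist, Grigorchuk). Then `γ (2n+2) / γ (2n)` converges, and its limit is `c ^ 2`. -/
theorem cogrowth_ratio_tendsto_sq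
    (r : ℕ) (hr : 2 ≤ r)
    (N : Subgroup (FreeGroup (Fin r))) (hNnormal : N.Normal) (hNbot : N ≠ ⊥)
    (γ : ℕ → ℕ)
    (hγ : ∀ n, γ n = Nat.card {x : FreeGroup (Fin r) // x ∈ N ∧ FreeGroup.norm x = n})
    (c : ℝ)
    (hc : Tendsto (fun n : ℕ => ((γ (2 * n) : ℝ)) ^ ((1 : ℝ) / (2 * n))) atTop (nhds c)) :
    Tendsto (fun n : ℕ => (γ (2 * n + 2) : ℝ) / (γ (2 * n) : ℝ)) atTop (nhds (c ^ 2)) := by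
  have hg : ∀ n, ((γ (2 * n) : ℕ) : ℝ) =
      Nat.card {x : FreeGroup (Fin r) // x ∈ N ∧ FreeGroup.norm x = 2 * n} := fun n => by rw [hγ]
  obtain ⟨L, hL, hratio⟩ := FreeGroup.exists_cogrowth_ratio_tendsto N hr hNnormal hNbot hg
  have hpos : ∀ᶠ n in atTop, 0 < (γ (2 * n) : ℝ) := by
    filter_upwards [hratio.eventually (lt_mem_nhds (zero_lt_one.trans hL))] with n hn
    exact lt_of_le_of_ne (Nat.cast_nonneg _) fun h => by simp [← h] at hn
  rw [eq_of_ratio_tendsto_of_root_tendsto hpos (zero_lt_one.trans hL) hratio hc]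
  exact hratio
end

section
/- Let r ≥ 2, q = 2r − 1, and let N be a nontrivial normal subgroup of the free group F_r on r generators. Let γ_n be the number of elements of N of reduced length n. Let S be the 2r-element set consisting of the generators and their inverses, let W_n be the number of n-tuples (s_1,…,s_n) ∈ S^n whose product lies in N, and let ρ = lim_{n→∞} (W_{2n})^{1/(2n)}/(2√q) (the spectral radius of the associated random walk, a limit that exists). Then γ_{2n+2}/γ_{2n} → q·(ρ + √(ρ² − 1))² as n → ∞. -/
open Filter

/-- The polynomials expressing the sum of the reduced words of length `n` in terms of the sum of
the reduced words of length `1`, in a free group of rank `(q + 1) / 2`. -/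
noncomputable def spherePoly (q : ℝ) : ℕ → Polynomial ℝ
  | 0 => 1
  | 1 => Polynomial.X
  | 2 => Polynomial.X ^ 2 - Polynomial.C (q + 1)
  | n + 3 => Polynomial.X * spherePoly q (n + 2) - Polynomial.C q * spherePoly q (n + 1)

theorem spherePoly_sub_eq_dickson_sub (q : ℝ) (n : ℕ) :
    spherePoly q (n + 3) - Polynomial.C q * spherePoly q (n + 1) =
      Polynomial.dickson 1 q (n + 3) - Polynomial.dickson 1 q (n + 1) := by
  induction n using Nat.twoStepInduction with
  | zero => simp [spherePoly, Polynomial.dickson]; ring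
  | one => simp [spherePoly, Polynomial.dickson]; ring
  | more n h₁ h₂ =>
    have e₁ : spherePoly q (n + 2 + 3) = Polynomial.X * spherePoly q (n + 1 + 3) -
      Polynomial.C q * spherePoly q (n + 3) := rfl
    have e₂ : spherePoly q (n + 3) = Polynomial.X * spherePoly q (n + 1 + 1) -
      Polynomial.C q * spherePoly q (n + 1) := rfl
    have e₃ : Polynomial.dickson 1 q (n + 2 + 3) = Polynomial.X * Polynomial.dickson 1 q (n + 1 + 3)
      - Polynomial.C q * Polynomial.dickson 1 q (n + 3) := Polynomial.dickson_add_two ..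
    have e₄ : Polynomial.dickson 1 q (n + 3) = Polynomial.X * Polynomial.dickson 1 q (n + 1 + 1)
      - Polynomial.C q * Polynomial.dickson 1 q (n + 1) := Polynomial.dickson_add_two ..
    linear_combination Polynomial.X * h₂ - Polynomial.C q * h₁ + e₁ - Polynomial.C q * e₂ - e₃ + e₄

theorem dickson_add_mul_dickson (q : ℝ) (k m : ℕ) :
    Polynomial.dickson 1 q (m + k) * Polynomial.dickson 1 q k =
      Polynomial.dickson 1 q (m + 2 * k) + Polynomial.C (q ^ k) * Polynomial.dickson 1 q m := by
  induction k using Nat.twoStepInduction generalizing m with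
  | zero => simp [Polynomial.dickson_zero]; ring
  | one =>
    rw [show m + 2 * 1 = m + 2 from rfl, Polynomial.dickson_add_two, Polynomial.dickson_one]
    simp; ring
  | more k h₁ h₂ =>
    have e₁ := h₁ (m + 2)
    have e₂ := h₂ (m + 1)
    rw [show m + 2 + k = m + (k + 2) by ring, show m + 2 + 2 * k = m + 2 * k + 2 by ring] at e₁
    rw [show m + 1 + (k + 1) = m + (k + 2) by ring,
      show m + 1 + 2 * (k + 1) = m + 2 * k + 2 + 1 by ring] at e₂
    have e₃ := Polynomial.dickson_add_two 1 q (m + 2 * k + 2)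
    have e₄ := Polynomial.dickson_add_two 1 q m
    rw [Polynomial.dickson_add_two (n := k), show m + 2 * (k + 2) = m + 2 * k + 2 + 2 by ring, e₃]
    simp only [pow_succ, Polynomial.C_mul] at e₁ e₂ ⊢
    linear_combination Polynomial.X * e₂ - Polynomial.C q * e₁ -
      Polynomial.C (q ^ k) * Polynomial.C q * e₄

theorem linearMap_mul_sq_le {R : Type*} [CommRing R] [Algebra ℝ R] (φ : R →ₗ[ℝ] ℝ)
    (hφ : ∀ p, 0 ≤ φ (p ^ 2)) (p p' : R) :
    φ (p * p') ^ 2 ≤ φ (p ^ 2) * φ (p' ^ 2) := by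
  have h : ∀ x : ℝ, 0 ≤ φ (p ^ 2) * (x * x) + 2 * φ (p * p') * x + φ (p' ^ 2) := by
    intro x
    have := hφ (x • p + p')
    rw [show (x • p + p') ^ 2 = (x * x) • p ^ 2 + (2 * x) • (p * p') + p' ^ 2 by
      simp only [Algebra.smul_def, map_mul, map_ofNat]; ring] at this
    simp only [map_add, map_smul, smul_eq_mul] at this
    linarith
  have := discrim_le_zero h
  rw [discrim] at this
  linarith

/-- A sequence of nonnegative reals which is log-convex up to bounded errors and has exponential
growth has a ratio limit, possibly infinite. -/
theorem ratio_tendsto_of_almost_logConvex (f : ℕ → ℝ)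
    (hconv : ∀ n, 4 ≤ f (n + 1) → (f (n + 1) - 4) ^ 2 ≤ f (n + 2) * f n)
    (hf : ∀ n, 0 ≤ f n) (l : ℝ) (hl : 1 < l) (hgrow : ∀ C, ∃ n, C * l ^ n < f n) :
    Tendsto f atTop atTop ∧ (Tendsto (fun n => f (n + 1) / f n) atTop atTop ∨
      ∃ L, 1 < L ∧ Tendsto (fun n => f (n + 1) / f n) atTop (nhds L)) := by
  obtain ⟨l', hl', hl'l⟩ := exists_between hl
  obtain ⟨θ, hθ, hθl⟩ := exists_between hl'
  have hθ0 : 0 < θ := by linarith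
  have hθinv := inv_lt_one_of_one_lt₀ hθ
  have hδ : 0 < (l' - θ) * (1 - θ⁻¹) := mul_pos (by linarith) (by linarith)
  obtain ⟨M, hM5, hM, hMl⟩ : ∃ M : ℝ, 5 ≤ M ∧ 8 / M ≤ (l' - θ) * (1 - θ⁻¹) ∧
      8 * l ≤ (l - l') * M := by
    refine ⟨max 5 (max (8 / ((l' - θ) * (1 - θ⁻¹))) (8 * l / (l - l'))), le_max_left _ _, ?_, ?_⟩
    · rw [div_le_iff₀ (by positivity)]
      have := (le_max_left _ _).trans
        (le_max_right 5 (max (8 / ((l' - θ) * (1 - θ⁻¹))) (8 * l / (l - l'))))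
      rw [div_le_iff₀ hδ] at this
      linarith
    · have := (le_max_right _ _).trans
        (le_max_right 5 (max (8 / ((l' - θ) * (1 - θ⁻¹))) (8 * l / (l - l'))))
      rw [div_le_iff₀ (by linarith)] at this
      linarith
  obtain ⟨m, hm1, hm2⟩ : ∃ m, M ≤ f (m + 1) ∧ l * f m < f (m + 1) := by
    by_contra! hcon
    obtain ⟨n, hn⟩ := hgrow (max M (f 0))
    refine hn.not_ge ?_
    clear hn
    induction n with
    | zero => simp
    | succ n ih =>
      rcases le_or_gt M (f (n + 1)) with h | h
      · calc f (n + 1) ≤ l * f n := hcon n h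
          _ ≤ l * (max M (f 0) * l ^ n) := by gcongr
          _ = _ := by ring
      · calc f (n + 1) ≤ max M (f 0) * 1 := by rw [mul_one]; exact h.le.trans (le_max_left _ _)
          _ ≤ _ := by gcongr; exact one_le_pow₀ hl.le
  have hm3 : l' * f (m + 1) ≤ f (m + 2) := by
    have h1 := hconv m (by linarith)
    have h0 : 0 < f m := (hf m).lt_of_ne fun h => by
      rw [← h] at h1
      nlinarith
    have h2 : l' * f m ≤ f (m + 1) - 8 := by
      have h3 := mul_le_mul_of_nonneg_left hm2.le (show 0 ≤ l' by linarith)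
      have h4 := mul_le_mul_of_nonneg_left hm1 (show 0 ≤ l - l' by linarith)
      exact le_of_mul_le_mul_left (a := l) (by linarith) (by linarith)
    have h3 := mul_le_mul_of_nonneg_right h2 (show 0 ≤ f (m + 1) by linarith)
    exact le_of_mul_le_mul_right (by nlinarith) h0
  have key : ∀ k, M * θ ^ k ≤ f (m + 1 + k) ∧
      (θ + (l' - θ) * θ⁻¹ ^ k) * f (m + 1 + k) ≤ f (m + 1 + k + 1) := by
    intro k
    induction k with
    | zero => exact ⟨by simpa using hm1, by simpa using hm3⟩
    | succ k ih =>
      obtain ⟨h1, h2⟩ := ih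
      have hpow : 1 ≤ θ ^ k := one_le_pow₀ hθ.le
      have hipow : 0 < θ⁻¹ ^ k := by positivity
      have hF : 0 < f (m + 1 + k) := by nlinarith
      have h3 : θ * f (m + 1 + k) ≤ f (m + 1 + k + 1) := by
        refine le_trans ?_ h2
        gcongr
        have : 0 ≤ (l' - θ) * θ⁻¹ ^ k := mul_nonneg (by linarith) hipow.le
        linarith
      have h4 : M * θ ^ (k + 1) ≤ f (m + 1 + k + 1) := by
        calc M * θ ^ (k + 1) = θ * (M * θ ^ k) := by ring
          _ ≤ θ * f (m + 1 + k) := by gcongr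
          _ ≤ _ := h3
      refine ⟨h4, ?_⟩
      have h5 : M ≤ f (m + 1 + k + 1) :=
        le_trans (le_mul_of_one_le_right (by linarith) (one_le_pow₀ hθ.le)) h4
      have h6 := hconv (m + 1 + k) (by linarith)
      have h7 : 8 ≤ (l' - θ) * (1 - θ⁻¹) * θ⁻¹ ^ k * f (m + 1 + k) := by
        rw [div_le_iff₀ (by linarith)] at hM
        calc (8 : ℝ) ≤ (l' - θ) * (1 - θ⁻¹) * M := hM
          _ = (l' - θ) * (1 - θ⁻¹) * θ⁻¹ ^ k * (M * θ ^ k) := by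
            rw [inv_pow]; field_simp
          _ ≤ _ := by gcongr
      have h8 : (θ + (l' - θ) * θ⁻¹ ^ (k + 1)) * f (m + 1 + k) ≤ f (m + 1 + k + 1) - 8 := by
        rw [pow_succ]; nlinarith
      have h9 : (θ + (l' - θ) * θ⁻¹ ^ (k + 1)) * f (m + 1 + k) * f (m + 1 + k + 1) ≤
          f (m + 1 + k + 2) * f (m + 1 + k) := by
        nlinarith [mul_le_mul_of_nonneg_right h8 (show 0 ≤ f (m + 1 + k + 1) by linarith)]
      change (θ + (l' - θ) * θ⁻¹ ^ (k + 1)) * f (m + 1 + k + 1) ≤ f (m + 1 + k + 2)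
      exact le_of_mul_le_mul_right (by linarith) hF
  have hpos : ∀ k, 0 < f (m + 1 + k) := fun k =>
    lt_of_lt_of_le (by positivity) (key k).1
  have hsum : Summable fun k => 8 / f (m + 1 + k) := by
    refine Summable.of_nonneg_of_le (fun k => by have := hpos k; positivity) (fun k => ?_)
      ((summable_geometric_of_lt_one (by positivity) hθinv).mul_left (8 / M))
    rw [inv_pow, div_mul_eq_mul_div, div_le_div_iff₀ (hpos k) (by linarith)]
    have := (key k).1
    rw [← div_eq_mul_inv, div_mul_eq_mul_div, le_div_iff₀ (by positivity)]
    nlinarith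
  have htop : Tendsto f atTop atTop := by
    rw [← tendsto_add_atTop_iff_nat (m + 1)]
    refine tendsto_atTop_mono (fun k => ?_)
      ((tendsto_pow_atTop_atTop_of_one_lt hθ).const_mul_atTop (show 0 < M by linarith))
    rw [add_comm k]
    exact (key k).1
  refine ⟨htop, ?_⟩
  set t : ℕ → ℝ := fun k => f (m + 1 + k + 1) / f (m + 1 + k) +
    ∑ i ∈ Finset.range k, 8 / f (m + 1 + i) with ht
  have hmono : Monotone t := by
    refine monotone_nat_of_le_succ fun k => ?_
    simp only [ht, Finset.sum_range_succ]
    have h1 := hpos k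
    have h2 := hpos (k + 1)
    rw [← add_assoc] at h2
    have h6 : f (m + 1 + k + 1) * (f (m + 1 + k + 1) - 8) ≤ f (m + 1 + k + 2) * f (m + 1 + k) := by
      have := hconv (m + 1 + k) (by
        have := (key (k + 1)).1
        rw [← add_assoc] at this
        nlinarith [one_le_pow₀ hθ.le (n := k + 1)])
      nlinarith
    have : f (m + 1 + k + 1) / f (m + 1 + k) - 8 / f (m + 1 + k) ≤
        f (m + 1 + k + 2) / f (m + 1 + k + 1) := by
      rw [← sub_div, div_le_div_iff₀ h1 h2]
      linarith
    rw [show m + 1 + (k + 1) = m + 1 + k + 1 by ring]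
    linarith
  have hlim := hsum.hasSum.tendsto_sum_nat
  have hratio : (fun k => f (k + (m + 1) + 1) / f (k + (m + 1))) =
      fun k => t k - ∑ i ∈ Finset.range k, 8 / f (m + 1 + i) := by
    funext k
    simp [ht, add_comm k]
  rcases tendsto_atTop_of_monotone hmono with h | ⟨T, h⟩
  · left
    rw [← tendsto_add_atTop_iff_nat (m + 1), hratio]
    simp_rw [sub_eq_add_neg]
    exact h.atTop_add hlim.neg
  · right
    have h' := h.sub hlim
    rw [← hratio] at h'
    refine ⟨_, lt_of_lt_of_le hθ (ge_of_tendsto' h' fun k => ?_), (tendsto_add_atTop_iff_nat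
      (f := fun n => f (n + 1) / f n) (m + 1)).1 h'⟩
    rw [add_comm k, le_div_iff₀ (hpos k)]
    refine le_trans ?_ (key k).2
    gcongr
    · exact (hpos k).le
    · have : 0 ≤ (l' - θ) * θ⁻¹ ^ k := mul_nonneg (by linarith) (by positivity)
      linarith

/-- The sum in the group algebra of the steps `g s` of a random walk. -/
noncomputable def stepSum {G S : Type*} [Group G] [Fintype S] (g : S → G) : MonoidAlgebra ℝ G :=
  ∑ s, MonoidAlgebra.single (g s) 1

section Walk

variable {G S : Type*} [Group G] [Fintype S] (g : S → G)

omit [Group G] in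
theorem coeff_sum_apply {ι : Type*} (t : Finset ι) (f : ι → MonoidAlgebra ℝ G) (x : G) :
    (∑ i ∈ t, f i).coeff x = ∑ i ∈ t, (f i).coeff x := by
  simp [MonoidAlgebra.coeff_sum]

theorem coeff_one_apply [DecidableEq G] (x : G) :
    (1 : MonoidAlgebra ℝ G).coeff x = if x = 1 then 1 else 0 := by
  rw [MonoidAlgebra.one_def, MonoidAlgebra.coeff_single, Finsupp.single_apply]
  simp only [eq_comm]

theorem coeff_stepSum_mul (f : MonoidAlgebra ℝ G) (x : G) :
    (stepSum g * f).coeff x = ∑ s, f.coeff ((g s)⁻¹ * x) := by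
  simp [stepSum, Finset.sum_mul]

theorem coeff_mul_stepSum (f : MonoidAlgebra ℝ G) (x : G) :
    (f * stepSum g).coeff x = ∑ s, f.coeff (x * (g s)⁻¹) := by
  simp [stepSum, Finset.mul_sum]

theorem coeff_stepSum_pow_nonneg (n : ℕ) (x : G) : 0 ≤ (stepSum g ^ n).coeff x := by
  classical
  induction n generalizing x with
  | zero =>
    rw [pow_zero, coeff_one_apply]
    split_ifs <;> norm_num
  | succ n ih =>
    rw [pow_succ, coeff_mul_stepSum]
    exact Finset.sum_nonneg fun s _ => ih _

theorem coeff_stepSum_mul_nonneg (f : MonoidAlgebra ℝ G) (hf : ∀ x, 0 ≤ f.coeff x) (x : G) :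
    0 ≤ (stepSum g * f).coeff x := by
  rw [coeff_stepSum_mul]
  exact Finset.sum_nonneg fun s _ => hf _

variable (e : S ≃ S) (he : ∀ s, g (e s) = (g s)⁻¹)
include he

theorem coeff_stepSum_pow_inv (n : ℕ) (x : G) :
    (stepSum g ^ n).coeff x⁻¹ = (stepSum g ^ n).coeff x := by
  classical
  induction n generalizing x with
  | zero => simp [coeff_one_apply]
  | succ n ih =>
    rw [pow_succ, coeff_mul_stepSum, ← pow_succ, pow_succ', coeff_stepSum_mul, ← e.sum_comp]
    refine Finset.sum_congr rfl fun s _ => ?_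
    rw [he, inv_inv, ← ih, mul_inv_rev, inv_inv]

theorem coeff_aeval_stepSum_inv (p : Polynomial ℝ) (x : G) :
    (Polynomial.aeval (stepSum g) p).coeff x⁻¹ = (Polynomial.aeval (stepSum g) p).coeff x := by
  rw [Polynomial.aeval_eq_sum_range, coeff_sum_apply, coeff_sum_apply]
  refine Finset.sum_congr rfl fun n _ => ?_
  rw [MonoidAlgebra.coeff_smul_apply, MonoidAlgebra.coeff_smul_apply,
    coeff_stepSum_pow_inv g e he]

theorem coeff_aeval_stepSum_sq_nonneg (p : Polynomial ℝ) :
    0 ≤ (Polynomial.aeval (stepSum g) (p ^ 2)).coeff 1 := by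
  rw [map_pow, sq, MonoidAlgebra.coeff_mul_apply_left]
  refine Finset.sum_nonneg fun x _ => ?_
  beta_reduce
  rw [mul_one, coeff_aeval_stepSum_inv g e he]
  exact mul_self_nonneg _

omit he

/-- The number of `n`-step walks from `1` to `x` which do not return to `1`. -/
noncomputable def walkAvoid [DecidableEq G] : ℕ → G → ℝ
  | 0, x => if x = 1 then 1 else 0
  | n + 1, x => if x = 1 then 0 else ∑ s, walkAvoid n (x * (g s)⁻¹)

theorem walkAvoid_nonneg [DecidableEq G] (n : ℕ) (x : G) : 0 ≤ walkAvoid g n x := by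
  induction n generalizing x with
  | zero => rw [walkAvoid]; split_ifs <;> norm_num
  | succ n ih =>
    rw [walkAvoid]
    split_ifs
    exacts [le_rfl, Finset.sum_nonneg fun s _ => ih _]

theorem walkAvoid_one [DecidableEq G] (n : ℕ) (x : G) (hx : x ≠ 1) :
    walkAvoid g (n + 1) x = ∑ s, walkAvoid g n (x * (g s)⁻¹) := by
  rw [walkAvoid, if_neg hx]

theorem sum_walk_mul_walkAvoid_le [DecidableEq G] (n : ℕ) (y x : G) :
    ∑ k ∈ Finset.range (n + 1), (stepSum g ^ (n - k)).coeff y * walkAvoid g k x ≤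
      (stepSum g ^ n).coeff (y * x) := by
  induction n generalizing x with
  | zero =>
    simp [walkAvoid]
    split_ifs with h
    · simp [h]
    · exact coeff_stepSum_pow_nonneg g 0 _
  | succ n ih =>
    rw [Finset.sum_range_succ']
    simp only [Nat.add_sub_add_right, Nat.sub_zero]
    by_cases hx : x = 1
    · subst hx
      simp [walkAvoid]
    · rw [show walkAvoid g 0 x = 0 by simp [walkAvoid, hx], mul_zero, add_zero, pow_succ,
        coeff_mul_stepSum]
      simp_rw [walkAvoid_one g _ x hx, Finset.mul_sum]
      rw [Finset.sum_comm]
      refine Finset.sum_le_sum fun s _ => ?_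
      rw [mul_assoc]
      exact ih _

theorem sum_walk_mul_walkAvoid_eq [DecidableEq G] (n : ℕ) (x : G) :
    ∑ k ∈ Finset.range (n + 1), (stepSum g ^ (n - k)).coeff 1 * walkAvoid g k x =
      (stepSum g ^ n).coeff x := by
  induction n generalizing x with
  | zero => simp [walkAvoid, coeff_one_apply]
  | succ n ih =>
    rw [Finset.sum_range_succ']
    simp only [Nat.add_sub_add_right, Nat.sub_zero]
    by_cases hx : x = 1
    · subst hx
      simp [walkAvoid]
    · rw [show walkAvoid g 0 x = 0 by simp [walkAvoid, hx], mul_zero, add_zero, pow_succ,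
        coeff_mul_stepSum]
      simp_rw [walkAvoid_one g _ x hx, Finset.mul_sum]
      rw [Finset.sum_comm]
      exact Finset.sum_congr rfl fun s _ => ih _

/-- The Green function of the walk at `z`. -/
noncomputable def green (z : ℝ) (x : G) : ℝ := ∑' n, (stepSum g ^ n).coeff x * z ^ n

theorem coeff_stepSum_pow_le (n : ℕ) (x : G) (s : S) :
    (stepSum g ^ n).coeff (x * (g s)⁻¹) ≤ (stepSum g ^ (n + 1)).coeff x := by
  rw [pow_succ, coeff_mul_stepSum]
  exact Finset.single_le_sum (f := fun s => (stepSum g ^ n).coeff (x * (g s)⁻¹))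
    (fun s _ => coeff_stepSum_pow_nonneg g n _) (Finset.mem_univ s)

variable {z : ℝ} (hz : 0 < z)
include hz

theorem summable_green_mul_inv {x : G} (h : Summable fun n => (stepSum g ^ n).coeff x * z ^ n)
    (s : S) : Summable fun n => (stepSum g ^ n).coeff (x * (g s)⁻¹) * z ^ n := by
  refine Summable.of_nonneg_of_le
    (fun n => mul_nonneg (coeff_stepSum_pow_nonneg g n _) (by positivity)) (fun n => ?_)
    (((summable_nat_add_iff 1).2 h).mul_left z⁻¹)
  calc _ ≤ (stepSum g ^ (n + 1)).coeff x * z ^ n := by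
        gcongr; exact coeff_stepSum_pow_le g n x s
    _ = _ := by field_simp; ring

theorem green_nonneg (x : G) : 0 ≤ green g z x :=
  tsum_nonneg fun n => mul_nonneg (coeff_stepSum_pow_nonneg g n _) (by positivity)

theorem green_eq [DecidableEq G] {x : G}
    (h : Summable fun n => (stepSum g ^ n).coeff x * z ^ n) :
    green g z x = (if x = 1 then 1 else 0) + z * ∑ s, green g z (x * (g s)⁻¹) := by
  rw [green, h.tsum_eq_zero_add]
  congr 1
  · simp [coeff_one_apply]
  · simp_rw [green]
    rw [← Summable.tsum_finsetSum fun s _ => summable_green_mul_inv g hz h s, ← tsum_mul_left]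
    refine tsum_congr fun n => ?_
    rw [pow_succ, coeff_mul_stepSum, Finset.sum_mul, Finset.mul_sum]
    exact Finset.sum_congr rfl fun s _ => by ring

theorem green_mul_green_le {x y : G}
    (h1 : Summable fun n => (stepSum g ^ n).coeff 1 * z ^ n)
    (hx : Summable fun n => (stepSum g ^ n).coeff x * z ^ n)
    (hy : Summable fun n => (stepSum g ^ n).coeff y * z ^ n)
    (hyx : Summable fun n => (stepSum g ^ n).coeff (y * x) * z ^ n) :
    green g z y * green g z x ≤ green g z 1 * green g z (y * x) := by
  classical
  have hQ0 : ∀ n, 0 ≤ walkAvoid g n x * z ^ n := fun n =>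
    mul_nonneg (walkAvoid_nonneg g n x) (by positivity)
  have hQ : Summable fun n => walkAvoid g n x * z ^ n := by
    refine Summable.of_nonneg_of_le hQ0 (fun n => ?_) hx
    gcongr
    rw [← sum_walk_mul_walkAvoid_eq, Finset.sum_range_succ]
    simp only [Nat.sub_self, pow_zero, coeff_one_apply, if_true, one_mul, le_add_iff_nonneg_left]
    exact Finset.sum_nonneg fun k _ =>
      mul_nonneg (coeff_stepSum_pow_nonneg g _ _) (walkAvoid_nonneg g k x)
  have hnorm : ∀ u : ℕ → ℝ, (∀ n, 0 ≤ u n) → Summable u → Summable fun n => ‖u n‖ :=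
    fun u h0 h => h.congr fun n => (Real.norm_of_nonneg (h0 n)).symm
  have hP0 : ∀ (w : G) n, 0 ≤ (stepSum g ^ n).coeff w * z ^ n := fun w n =>
    mul_nonneg (coeff_stepSum_pow_nonneg g n w) (by positivity)
  have hconv : ∀ (w : G) (n : ℕ), ∑ k ∈ Finset.range (n + 1),
      walkAvoid g k x * z ^ k * ((stepSum g ^ (n - k)).coeff w * z ^ (n - k)) =
      (∑ k ∈ Finset.range (n + 1), (stepSum g ^ (n - k)).coeff w * walkAvoid g k x) * z ^ n := by
    intro w n
    rw [Finset.sum_mul]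
    refine Finset.sum_congr rfl fun k hk => ?_
    rw [← Nat.add_sub_of_le (Nat.lt_succ_iff.1 (Finset.mem_range.1 hk)), pow_add]
    simp only [Nat.add_sub_cancel_left]
    ring
  have e1 : (∑' n, walkAvoid g n x * z ^ n) * green g z 1 = green g z x := by
    rw [green, tsum_mul_tsum_eq_tsum_sum_range_of_summable_norm (hnorm _ hQ0 hQ)
      (hnorm _ (hP0 1) h1)]
    simp_rw [hconv, sum_walk_mul_walkAvoid_eq]
    rfl
  have e2 : (∑' n, walkAvoid g n x * z ^ n) * green g z y ≤ green g z (y * x) := by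
    rw [green, tsum_mul_tsum_eq_tsum_sum_range_of_summable_norm (hnorm _ hQ0 hQ)
      (hnorm _ (hP0 y) hy)]
    refine Summable.tsum_le_tsum (fun n => ?_)
      (summable_norm_sum_mul_range_of_summable_norm (hnorm _ hQ0 hQ)
        (hnorm _ (hP0 y) hy)).of_norm hyx
    rw [hconv]
    gcongr
    exact sum_walk_mul_walkAvoid_le g n y x
  rw [← e1]
  have := mul_le_mul_of_nonneg_left e2 (green_nonneg g hz 1)
  linarith

include he

/-- A quantitative form of the fact that a symmetric walk cannot be recurrent below the trivial
eigenvalue. -/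
theorem green_one_mul_le (h1 : Summable fun n => (stepSum g ^ n).coeff 1 * z ^ n) :
    green g z 1 * (Fintype.card S * z - 1) ≤ Fintype.card S := by
  classical
  set K := green g z 1 with hK
  have hinv : ∀ s, Summable fun n => (stepSum g ^ n).coeff (g s)⁻¹ * z ^ n := fun s => by
    simpa using summable_green_mul_inv g hz h1 s
  have hsteps : ∀ s, Summable fun n => (stepSum g ^ n).coeff (g s) * z ^ n := fun s => by
    simpa [he] using hinv (e s)
  have hsymm : ∀ s, green g z (g s)⁻¹ = green g z (g s) := fun s => by
    simp_rw [green, coeff_stepSum_pow_inv g e he]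
  have hK1 := green_eq g hz h1
  rw [if_pos rfl, ← hK] at hK1
  simp only [one_mul, hsymm] at hK1
  have hKpos : 0 < K := by
    have : 0 ≤ z * ∑ s, green g z (g s) :=
      mul_nonneg hz.le (Finset.sum_nonneg fun s _ => green_nonneg g hz _)
    linarith
  have key : ∀ s, K - z⁻¹ ≤ green g z (g s) := by
    intro s
    have h2 := green_eq g hz (hsteps s)
    have hterm : ∀ t, 0 ≤ K * green g z (g s * (g t)⁻¹) - green g z (g s) * green g z (g t) := by
      intro t
      have := green_mul_green_le g hz h1 (hinv t) (hsteps s)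
        (summable_green_mul_inv g hz (hsteps s) t)
      rw [hsymm] at this
      linarith
    have h3 := Finset.single_le_sum (f := fun t => K * green g z (g s * (g t)⁻¹) -
      green g z (g s) * green g z (g t)) (fun t _ => hterm t) (Finset.mem_univ s)
    simp only [mul_inv_cancel, ← hK, Finset.sum_sub_distrib, ← Finset.mul_sum] at h3
    have h4 : z * ∑ t, green g z (g s * (g t)⁻¹) ≤ green g z (g s) := by
      split_ifs at h2 <;> linarith
    have h5 : z * (K * K - green g z (g s) * green g z (g s)) ≤ green g z (g s) := by
      calc _ ≤ z * (K * ∑ t, green g z (g s * (g t)⁻¹) -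
            green g z (g s) * ∑ t, green g z (g t)) := by gcongr
        _ = K * (z * ∑ t, green g z (g s * (g t)⁻¹)) -
            green g z (g s) * (z * ∑ t, green g z (g t)) := by ring
        _ ≤ K * green g z (g s) - green g z (g s) * (z * ∑ t, green g z (g t)) := by gcongr
        _ = K * green g z (g s) - green g z (g s) * (K - 1) := by rw [hK1]; ring
        _ = _ := by ring
    have h0 := green_nonneg g hz (g s)
    by_contra! hlt
    have h6 : 1 < z * (K - green g z (g s)) := by
      have := mul_lt_mul_of_pos_left hlt hz
      rw [mul_sub, mul_inv_cancel₀ hz.ne'] at this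
      linarith
    nlinarith
  have h7 : (Fintype.card S : ℝ) * (K - z⁻¹) ≤ ∑ s, green g z (g s) := by
    simpa [mul_sub] using Finset.sum_le_sum fun s (_ : s ∈ Finset.univ) => key s
  have h8 := mul_le_mul_of_nonneg_left h7 hz.le
  have h9 : z * (Fintype.card S * (K - z⁻¹)) = Fintype.card S * z * K - Fintype.card S := by
    field_simp
  linarith

omit hz in
theorem coeff_stepSum_pow_odd_le (n : ℕ) : 2 * (stepSum g ^ (2 * n + 1)).coeff 1 ≤
    (stepSum g ^ (2 * n)).coeff 1 + (stepSum g ^ (2 * n + 2)).coeff 1 := by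
  have h := coeff_aeval_stepSum_sq_nonneg g e he (Polynomial.X ^ n - Polynomial.X ^ (n + 1))
  rw [show (Polynomial.X ^ n - Polynomial.X ^ (n + 1)) ^ 2 = (Polynomial.X ^ (2 * n) -
    (2 : ℝ) • Polynomial.X ^ (2 * n + 1) + Polynomial.X ^ (2 * n + 2) : Polynomial ℝ) by
      simp only [Algebra.smul_def, map_ofNat]; ring] at h
  simp only [map_add, map_sub, map_smul, map_pow, Polynomial.aeval_X, MonoidAlgebra.coeff_add,
    MonoidAlgebra.coeff_sub, MonoidAlgebra.coeff_smul_apply, Finsupp.add_apply, Finsupp.sub_apply,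
    smul_eq_mul] at h
  linarith

omit hz in
theorem coeff_stepSum_pow_le_of_even {ν : ℝ} (hν : 0 < ν) {C : ℝ}
    (hC : ∀ n, (stepSum g ^ (2 * n)).coeff 1 ≤ C * ν ^ (2 * n)) :
    ∃ C', ∀ n, (stepSum g ^ n).coeff 1 ≤ C' * ν ^ n := by
  have hC0 : 0 ≤ C := by simpa using (coeff_stepSum_pow_nonneg g _ _).trans (hC 0)
  refine ⟨C + C * (ν⁻¹ + ν), fun n => ?_⟩
  rcases n.even_or_odd' with ⟨m, rfl | rfl⟩
  · refine (hC m).trans ?_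
    gcongr
    have : 0 ≤ C * (ν⁻¹ + ν) := by positivity
    linarith
  · have h1 := coeff_stepSum_pow_odd_le g e he m
    have h2 := hC m
    have h3 := hC (m + 1)
    rw [mul_add, mul_one] at h3
    have h4 : C * ν ^ (2 * m) + C * ν ^ (2 * m + 2) = C * (ν⁻¹ + ν) * ν ^ (2 * m + 1) := by
      field_simp
      ring
    have h5 : 0 ≤ C * ν ^ (2 * m + 1) := by positivity
    have h6 := coeff_stepSum_pow_nonneg g (2 * m + 1) 1
    linarith

omit hz in
theorem summable_walk_of_growth {μ : ℝ} (hμ : 0 < μ) (hμS : μ < Fintype.card S)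
    (hgrow : ∀ ν, μ < ν → ∃ C, ∀ n, (stepSum g ^ (2 * n)).coeff 1 ≤ C * ν ^ (2 * n)) :
    Summable fun n => (stepSum g ^ n).coeff 1 * μ⁻¹ ^ n := by
  have hS : (0 : ℝ) < Fintype.card S := hμ.trans hμS
  obtain ⟨z₀, hz₀, hz₀μ⟩ := exists_between ((inv_lt_inv₀ hS hμ).2 hμS)
  have hz₀pos : 0 < z₀ := (inv_pos.2 hS).trans hz₀
  have hz₀S : 0 < Fintype.card S * z₀ - 1 := by
    have := mul_lt_mul_of_pos_left hz₀ hS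
    rw [mul_inv_cancel₀ hS.ne'] at this
    linarith
  have hsum : ∀ z, 0 < z → z < μ⁻¹ → Summable fun n => (stepSum g ^ n).coeff 1 * z ^ n := by
    intro z hz hzμ
    obtain ⟨ν, hν, hνz⟩ := exists_between ((lt_inv_comm₀ hz hμ).1 hzμ)
    have hν0 : 0 < ν := hμ.trans hν
    obtain ⟨C, hC⟩ := hgrow ν hν
    obtain ⟨C', hC'⟩ := coeff_stepSum_pow_le_of_even g e he hν0 hC
    refine Summable.of_nonneg_of_le
      (fun n => mul_nonneg (coeff_stepSum_pow_nonneg g n _) (by positivity)) (fun n => ?_)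
      ((summable_geometric_of_lt_one (r := ν * z) (by positivity) ?_).mul_left C')
    · rw [mul_pow, ← mul_assoc]
      gcongr
      exact hC' n
    · calc ν * z < z⁻¹ * z := by gcongr
        _ = 1 := inv_mul_cancel₀ hz.ne'
  refine summable_of_sum_range_le (c := Fintype.card S / (Fintype.card S * z₀ - 1))
    (fun n => mul_nonneg (coeff_stepSum_pow_nonneg g n _) (by positivity)) fun n => ?_
  have hcont : Continuous fun z : ℝ =>
      ∑ i ∈ Finset.range n, (stepSum g ^ i).coeff 1 * z ^ i := by fun_prop
  refine le_of_tendsto ((hcont.tendsto μ⁻¹).mono_left (nhdsWithin_le_nhds (s := Set.Iio μ⁻¹))) ?_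
  filter_upwards [Ioo_mem_nhdsLT hz₀μ] with z hz
  have hz0 := hz₀pos.trans hz.1
  have h1 := hsum z hz0 hz.2
  have h2 := green_one_mul_le g e he hz0 h1
  have h3 : ∑ i ∈ Finset.range n, (stepSum g ^ i).coeff 1 * z ^ i ≤ green g z 1 :=
    h1.sum_le_tsum _ fun i _ => mul_nonneg (coeff_stepSum_pow_nonneg g i _) (by positivity)
  refine h3.trans ?_
  rw [le_div_iff₀ hz₀S]
  refine le_trans ?_ h2
  have := green_nonneg g hz0 1
  have := hz.1.le
  gcongr

end Walk

theorem le_succ_of_concave_of_nonneg (e : ℕ → ℝ) (he : ∀ n, 0 ≤ e n)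
    (hconc : ∀ n, e (n + 2) + e n ≤ 2 * e (n + 1)) (n : ℕ) : e n ≤ e (n + 1) := by
  by_contra! hlt
  have h : ∀ k : ℕ, e (n + k + 1) - e (n + k) ≤ e (n + 1) - e n ∧
      e (n + k) ≤ e n + k * (e (n + 1) - e n) := by
    intro k
    induction k with
    | zero => simp
    | succ k ih =>
      have := hconc (n + k)
      push_cast
      rw [← add_assoc]
      constructor <;> linarith
  obtain ⟨k, hk⟩ := exists_nat_gt (e n / (e n - e (n + 1)))
  rw [div_lt_iff₀ (by linarith)] at hk
  linarith [(h k).2, he (n + k)]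

theorem sum_div_pow_le_of_recurrence {s : ℝ} (hs : 0 < s) (T : ℕ → ℕ → ℝ) (hT : ∀ k n, 0 ≤ T k n)
    (hrec : ∀ k n, T (k + 1) (n + 2) = T k (n + 3) + s ^ 2 * T k (n + 1))
    (hle : ∀ k n, T k (n + 1) ≤ T (k + 1) n)
    (hsum : Summable fun k => T k 0 * (2 * s)⁻¹ ^ k) :
    ∃ B, ∀ N, ∑ n ∈ Finset.range N, T 0 (n + 2) / s ^ (n + 2) ≤ B := by
  set z := (2 * s)⁻¹ with hz
  have hz0 : 0 < z := by positivity
  have hsum' : ∀ n, Summable fun k => T k n * z ^ k := by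
    intro n
    induction n with
    | zero => exact hsum
    | succ n ih =>
      refine Summable.of_nonneg_of_le (fun k => mul_nonneg (hT _ _) (by positivity)) (fun k => ?_)
        (((summable_nat_add_iff 1).2 ih).mul_left z⁻¹)
      calc T k (n + 1) * z ^ k ≤ T (k + 1) n * z ^ k := by gcongr; exact hle k n
        _ = _ := by field_simp; ring
  set e : ℕ → ℝ := fun n => (∑' k, T k n * z ^ k) / s ^ n with he
  have he0 : ∀ n, 0 ≤ e n := fun n =>
    div_nonneg (tsum_nonneg fun k => mul_nonneg (hT _ _) (by positivity)) (by positivity)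
  have hstep : ∀ n, 2 * (T 0 (n + 2) / s ^ (n + 2)) = 2 * e (n + 2) - e (n + 3) - e (n + 1) := by
    intro n
    have h1 : ∑' k, T k (n + 2) * z ^ k = T 0 (n + 2) +
        z * (∑' k, T k (n + 3) * z ^ k + s ^ 2 * ∑' k, T k (n + 1) * z ^ k) := by
      rw [(hsum' (n + 2)).tsum_eq_zero_add, pow_zero, mul_one, ← tsum_mul_left (a := s ^ 2),
        ← (hsum' (n + 3)).tsum_add ((hsum' (n + 1)).mul_left _), ← tsum_mul_left]
      congr 1
      refine tsum_congr fun k => ?_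
      rw [hrec]
      ring
    simp only [he]
    rw [h1, hz]
    field_simp
    ring
  have hmono := le_succ_of_concave_of_nonneg (fun n => e (n + 1)) (fun n => he0 _) fun n => by
    have h1 := hstep n
    have h2 : 0 ≤ T 0 (n + 2) / s ^ (n + 2) := div_nonneg (hT _ _) (by positivity)
    change e (n + 3) + e (n + 1) ≤ 2 * e (n + 2)
    linarith
  refine ⟨(e 2 - e 1) / 2, fun N => ?_⟩
  have : ∑ n ∈ Finset.range N, T 0 (n + 2) / s ^ (n + 2) =
      ((e 2 - e 1) - (e (N + 2) - e (N + 1))) / 2 := by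
    induction N with
    | zero => simp
    | succ N ih =>
      rw [Finset.sum_range_succ, ih]
      have := hstep N
      change _ = ((e 2 - e 1) - (e (N + 3) - e (N + 2))) / 2
      linarith
  have h := hmono N
  change e (N + 1) ≤ e (N + 2) at h
  linarith

theorem le_of_recurrence_of_le {m : ℕ → ℕ → ℝ}
    (h0 : ∀ n, m (n + 1) 0 = 2 * m n 0 + 2 * m n 1)
    (hs : ∀ n j, m (n + 1) (j + 1) = m n (j + 2) + 2 * m n (j + 1) + m n j)
    {t α β : ℝ} (ht : t ≠ 0) (hle : ∀ j, m 0 j ≤ α * (t ^ j + t⁻¹ ^ j) + β) (n j : ℕ) :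
    m n j ≤ α * (t + 2 + t⁻¹) ^ n * (t ^ j + t⁻¹ ^ j) + β * 4 ^ n := by
  induction n generalizing j with
  | zero => simpa using hle j
  | succ n ih =>
    cases j with
    | zero =>
      rw [h0]
      have h1 := ih 0
      have h2 := ih 1
      simp only [pow_zero, pow_succ] at h1 h2 ⊢
      linarith
    | succ j =>
      rw [hs]
      have e1 : t ^ (j + 2) + 2 * t ^ (j + 1) + t ^ j = (t + 2 + t⁻¹) * t ^ (j + 1) := by
        field_simp; ring
      have e2 : t⁻¹ ^ (j + 2) + 2 * t⁻¹ ^ (j + 1) + t⁻¹ ^ j = (t + 2 + t⁻¹) * t⁻¹ ^ (j + 1) := by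
        linear_combination (-(t⁻¹ ^ j)) * mul_inv_cancel₀ ht
      have e3 : α * (t + 2 + t⁻¹) ^ (n + 1) * (t ^ (j + 1) + t⁻¹ ^ (j + 1)) =
          α * (t + 2 + t⁻¹) ^ n * (t ^ (j + 2) + t⁻¹ ^ (j + 2)) +
          2 * (α * (t + 2 + t⁻¹) ^ n * (t ^ (j + 1) + t⁻¹ ^ (j + 1))) +
          α * (t + 2 + t⁻¹) ^ n * (t ^ j + t⁻¹ ^ j) := by
        rw [pow_succ (t + 2 + t⁻¹)]
        linear_combination (-α) * (t + 2 + t⁻¹) ^ n * e1 + (-α) * (t + 2 + t⁻¹) ^ n * e2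
      rw [e3]
      have h1 := ih (j + 2)
      have h2 := ih (j + 1)
      have h3 := ih j
      rw [pow_succ (4 : ℝ)]
      linarith

theorem tendsto_const_mul_pow_rpow {c Y : ℝ} (hc : 0 < c) (hY : 0 < Y) :
    Tendsto (fun n : ℕ => (c * Y ^ n) ^ ((1 : ℝ) / (2 * n))) atTop (nhds √Y) := by
  have h1 : Tendsto (fun n : ℕ => c ^ ((1 : ℝ) / (2 * n))) atTop (nhds 1) := by
    have h2 : Tendsto (fun n : ℕ => (1 : ℝ) / (2 * n)) atTop (nhds 0) :=
      tendsto_const_nhds.div_atTop (tendsto_natCast_atTop_atTop.const_mul_atTop two_pos)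
    have := (Real.continuousAt_const_rpow hc.ne' (b := 0)).tendsto.comp h2
    simpa [Function.comp_def] using this
  have h3 := h1.mul_const √Y
  rw [one_mul] at h3
  refine h3.congr' ?_
  filter_upwards [eventually_gt_atTop 0] with n hn
  have hn' : (n : ℝ) ≠ 0 := by positivity
  rw [Real.mul_rpow hc.le (by positivity), ← Real.rpow_natCast, ← Real.rpow_mul hY.le,
    Real.sqrt_eq_rpow]
  congr 2
  field_simp

theorem root_limit_le {w : ℕ → ℝ} {q ρ C Y : ℝ} (hq : 0 < q) (hw : ∀ n, 0 ≤ w n)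
    (hρ : Tendsto (fun n : ℕ => (w n) ^ ((1 : ℝ) / (2 * n)) / (2 * √q)) atTop (nhds ρ))
    (hC : 0 < C) (hY : 0 < Y) (h : ∀ n, w n ≤ C * (q * Y) ^ n) : 2 * ρ ≤ √Y := by
  have h1 := (tendsto_const_mul_pow_rpow hC (mul_pos hq hY)).div_const (2 * √q)
  have h2 := le_of_tendsto_of_tendsto' hρ h1 fun n => by
    gcongr
    · exact hw n
    · exact h n
  rw [Real.sqrt_mul hq.le] at h2
  have : √q * √Y / (2 * √q) = √Y / 2 := by
    have := (Real.sqrt_pos.2 hq).ne'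
    field_simp
  linarith

theorem le_root_limit {w : ℕ → ℝ} {q ρ C Y : ℝ} (hq : 0 < q)
    (hρ : Tendsto (fun n : ℕ => (w n) ^ ((1 : ℝ) / (2 * n)) / (2 * √q)) atTop (nhds ρ))
    (hC : 0 < C) (hY : 0 < Y) (h : ∀ᶠ n in atTop, C * (q * Y) ^ n ≤ w n) : √Y ≤ 2 * ρ := by
  have h1 := (tendsto_const_mul_pow_rpow hC (mul_pos hq hY)).div_const (2 * √q)
  have h2 := le_of_tendsto_of_tendsto h1 hρ (h.mono fun n hn => by
    beta_reduce
    gcongr)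
  rw [Real.sqrt_mul hq.le] at h2
  have : √q * √Y / (2 * √q) = √Y / 2 := by
    have := (Real.sqrt_pos.2 hq).ne'
    field_simp
  linarith

theorem tendsto_zero_of_le_mul_add {y ε : ℕ → ℝ} {θ : ℝ} (hy : ∀ n, 0 ≤ y n) (hθ : 0 ≤ θ)
    (hθ1 : θ < 1) (hrec : ∀ᶠ n in atTop, y (n + 1) ≤ θ * y n + ε n)
    (hε : Tendsto ε atTop (nhds 0)) : Tendsto y atTop (nhds 0) := by
  refine tendsto_order.2 ⟨fun a ha => Eventually.of_forall fun n => ha.trans_le (hy n),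
    fun δ hδ => ?_⟩
  have hδ' : 0 < δ / 2 * (1 - θ) := mul_pos (half_pos hδ) (by linarith)
  obtain ⟨M, hM⟩ := eventually_atTop.1 (hrec.and (hε.eventually (gt_mem_nhds hδ')))
  have hk : ∀ k, y (M + k) ≤ θ ^ k * y M + δ / 2 := by
    intro k
    induction k with
    | zero => simp; linarith
    | succ k ih =>
      obtain ⟨h1, h2⟩ := hM (M + k) (by omega)
      have := mul_le_mul_of_nonneg_left ih hθ
      rw [← add_assoc, pow_succ]
      linarith
  have h0 : Tendsto (fun k => θ ^ k * y M) atTop (nhds 0) := by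
    simpa using (tendsto_pow_atTop_nhds_zero_of_lt_one hθ hθ1).mul_const (y M)
  obtain ⟨K, hK⟩ := eventually_atTop.1 (h0.eventually (gt_mem_nhds (half_pos hδ)))
  filter_upwards [eventually_ge_atTop (M + K)] with n hn
  have h1 := hk (n - M)
  have h2 := hK (n - M) (by omega)
  rw [show M + (n - M) = n by omega] at h1
  linarith

theorem tendsto_of_affine_recurrence {x u v : ℕ → ℝ} {a b : ℝ} (ha : 0 ≤ a) (ha1 : a < 1)
    (hu : Tendsto u atTop (nhds a)) (hv : Tendsto v atTop (nhds b))
    (hrec : ∀ᶠ n in atTop, x (n + 1) = u n * x n + v n) :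
    Tendsto x atTop (nhds (b / (1 - a))) := by
  rw [tendsto_iff_dist_tendsto_zero]
  set z := b / (1 - a) with hz
  have hzb : a * z + b - z = 0 := by
    have : 1 - a ≠ 0 := by linarith
    rw [hz]
    field_simp
    ring
  have hε : Tendsto (fun n => |u n * z + v n - z|) atTop (nhds 0) := by
    have := (((hu.mul_const z).add hv).sub_const z).abs
    rwa [hzb, abs_zero] at this
  refine tendsto_zero_of_le_mul_add (θ := (1 + a) / 2) (fun n => dist_nonneg) (by linarith)
    (by linarith) ?_ hε
  filter_upwards [hrec, hu.abs.eventually (gt_mem_nhds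
    (show |a| < (1 + a) / 2 by rw [abs_of_nonneg ha]; linarith))] with n hn hlt
  rw [hn, Real.dist_eq, Real.dist_eq,
    show u n * x n + v n - z = u n * (x n - z) + (u n * z + v n - z) by ring]
  refine (abs_add_le _ _).trans ?_
  rw [abs_mul]
  gcongr

theorem tendsto_ratio_of_sub_eq {a b : ℕ → ℝ} {q L : ℝ} (hq : 1 < q) (hL : 1 < L)
    (hb : ∀ᶠ n in atTop, 0 < b n) (hbL : Tendsto (fun n => b (n + 1) / b n) atTop (nhds L))
    (hab : ∀ᶠ n in atTop, a (n + 1) - a n = b (n + 1) - b n / q) :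
    Tendsto (fun n => a (n + 1) / a n) atTop (nhds L) := by
  have hL0 : L ≠ 0 := by linarith
  have hq0 : q ≠ 0 := by linarith
  have hu : Tendsto (fun n => b n / b (n + 1)) atTop (nhds L⁻¹) := by
    simpa only [inv_div] using hbL.inv₀ hL0
  have hv := (hu.div_const q).const_sub 1
  have hLi : L⁻¹ < 1 := inv_lt_one_of_one_lt₀ hL
  have hb' : ∀ᶠ n in atTop, 0 < b (n + 1) := (tendsto_add_atTop_nat 1).eventually hb
  have hx := tendsto_of_affine_recurrence (x := fun n => a n / b n) (by positivity) hLi hu hv (by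
    filter_upwards [hb, hb', hab] with n h1 h2 h3
    rw [show a (n + 1) = a n + b (n + 1) - b n / q by linarith]
    field_simp
    ring)
  have hpos : (1 - L⁻¹ / q) / (1 - L⁻¹) ≠ 0 := by
    have : L⁻¹ / q < 1 := (div_lt_one (by linarith)).2 (by linarith)
    exact (div_pos (by linarith) (by linarith)).ne'
  have h := ((hx.comp (tendsto_add_atTop_nat 1)).div hx hpos).mul hbL
  rw [div_self hpos, one_mul] at h
  refine h.congr' ?_
  filter_upwards [hb, hb'] with n h1 h2
  simp only [Function.comp_apply, Pi.div_apply]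
  field_simp

theorem add_inv_le_of_mul_growth {l : ℝ} (hl : 1 < l) {f : ℕ → ℝ} {M : ℕ}
    (hM : 0 < f M) (hf : ∀ n, 0 ≤ f n) (h : ∀ n, M ≤ n → l * f n ≤ f (n + 1)) :
    ∃ c, 0 < c ∧ ∃ C, ∀ n, c * (l ^ n + l⁻¹ ^ n) - C ≤ f n := by
  have hl0 : 0 < l := by linarith
  have hgrow : ∀ k, f M * l ^ k ≤ f (M + k) := by
    intro k
    induction k with
    | zero => simp
    | succ k ih =>
      have := h (M + k) (by omega)
      have := mul_le_mul_of_nonneg_left ih hl0.le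
      rw [← add_assoc, pow_succ]
      linarith
  refine ⟨f M / l ^ M, by positivity, 2 * f M, fun n => ?_⟩
  have h1 : f M / l ^ M * l⁻¹ ^ n ≤ f M := by
    have : l⁻¹ ^ n ≤ 1 := pow_le_one₀ (by positivity) (inv_le_one_of_one_le₀ hl.le)
    have h2 : f M / l ^ M ≤ f M := div_le_self hM.le (one_le_pow₀ hl.le)
    calc _ ≤ f M / l ^ M * 1 := by gcongr
      _ ≤ _ := by linarith
  rcases le_or_gt M n with hn | hn
  · have h2 := hgrow (n - M)
    rw [show M + (n - M) = n by omega] at h2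
    have h3 : f M / l ^ M * l ^ n = f M * l ^ (n - M) := by
      rw [show n = M + (n - M) by omega, pow_add]
      simp only [Nat.add_sub_cancel_left]
      field_simp
    linarith
  · have h2 : f M / l ^ M * l ^ n ≤ f M := by
      rw [div_mul_eq_mul_div]
      refine (div_le_iff₀ (by positivity)).2 ?_
      gcongr
      · exact hl.le
    have := hf n
    linarith

theorem exists_le_mul_pow {l : ℝ} (hl : 0 < l) {f : ℕ → ℝ}
    (h : ∀ᶠ n in atTop, f (n + 1) ≤ l * f n) : ∃ C, 0 < C ∧ ∀ n, f n ≤ C * l ^ n := by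
  obtain ⟨M, hM⟩ := eventually_atTop.1 h
  refine ⟨1 + ∑ i ∈ Finset.range (M + 1), |f i| / l ^ i, by positivity, fun n => ?_⟩
  induction n using Nat.strong_induction_on with
  | _ n ih =>
    rcases le_or_gt n M with hn | hn
    · have h1 : |f n| / l ^ n ≤ ∑ i ∈ Finset.range (M + 1), |f i| / l ^ i :=
        Finset.single_le_sum (f := fun i => |f i| / l ^ i) (fun i _ => by positivity)
          (Finset.mem_range.2 (by omega))
      have h2 : f n ≤ |f n| / l ^ n * l ^ n := by
        rw [div_mul_cancel₀ _ (by positivity)]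
        exact le_abs_self _
      refine h2.trans ?_
      gcongr
      linarith
    · obtain ⟨n, rfl⟩ : ∃ k, n = k + 1 := ⟨n - 1, by omega⟩
      have h1 := hM n (by omega)
      have h2 := mul_le_mul_of_nonneg_left (ih n (by omega)) hl.le
      rw [pow_succ]
      linarith

section DicksonMoments

open Polynomial

theorem dickson_one_zero_eq (q : ℝ) : dickson 1 q 0 = C 2 := by
  rw [dickson_zero, map_ofNat]
  norm_num

theorem X_sq_mul_dickson_zero (q : ℝ) :
    X ^ 2 * dickson 1 q 0 = C 2 * dickson 1 q 2 + C (2 * q) * dickson 1 q 0 := by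
  rw [dickson_two, dickson_one_zero_eq]
  simp only [map_mul, map_ofNat, Nat.cast_one]
  ring

theorem X_sq_mul_dickson_add_two (q : ℝ) (k : ℕ) :
    X ^ 2 * dickson 1 q (k + 2) =
      dickson 1 q (k + 4) + C (2 * q) * dickson 1 q (k + 2) + C (q ^ 2) * dickson 1 q k := by
  have h0 := dickson_add_two 1 q k
  have h1 := dickson_add_two 1 q (k + 1)
  have h2 := dickson_add_two 1 q (k + 2)
  simp only [map_mul, map_ofNat, map_pow] at *
  linear_combination -X * h1 - h2 - C q * h0

theorem linearMap_C_mul (φ : ℝ[X] →ₗ[ℝ] ℝ) (c : ℝ) (p : ℝ[X]) : φ (C c * p) = c * φ p := by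
  rw [← smul_eq_C_mul, map_smul, smul_eq_mul]

/-- The normalized even Dickson moments of a functional. -/
noncomputable def dicksonMoment (φ : ℝ[X] →ₗ[ℝ] ℝ) (q : ℝ) (n j : ℕ) : ℝ :=
  φ (X ^ (2 * n) * dickson 1 q (2 * j)) / q ^ (n + j)

variable {φ : ℝ[X] →ₗ[ℝ] ℝ} {q : ℝ}

theorem dicksonMoment_succ_zero (hq : q ≠ 0) (n : ℕ) :
    dicksonMoment φ q (n + 1) 0 = 2 * dicksonMoment φ q n 0 + 2 * dicksonMoment φ q n 1 := by
  have h : (X : ℝ[X]) ^ (2 * (n + 1)) * dickson 1 q (2 * 0) =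
      C 2 * (X ^ (2 * n) * dickson 1 q (2 * 1)) +
        C (2 * q) * (X ^ (2 * n) * dickson 1 q (2 * 0)) := by
    linear_combination X ^ (2 * n) * X_sq_mul_dickson_zero q
  simp only [dicksonMoment, h, map_add, linearMap_C_mul]
  field_simp
  ring

theorem dicksonMoment_succ_succ (hq : q ≠ 0) (n j : ℕ) :
    dicksonMoment φ q (n + 1) (j + 1) = dicksonMoment φ q n (j + 2) +
      2 * dicksonMoment φ q n (j + 1) + dicksonMoment φ q n j := by
  have h : (X : ℝ[X]) ^ (2 * (n + 1)) * dickson 1 q (2 * (j + 1)) =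
      X ^ (2 * n) * dickson 1 q (2 * (j + 2)) +
        C (2 * q) * (X ^ (2 * n) * dickson 1 q (2 * (j + 1))) +
        C (q ^ 2) * (X ^ (2 * n) * dickson 1 q (2 * j)) := by
    linear_combination X ^ (2 * n) * X_sq_mul_dickson_add_two q (2 * j)
  simp only [dicksonMoment, h, map_add, linearMap_C_mul]
  field_simp
  ring

theorem apply_X_pow_eq_dicksonMoment (hq : q ≠ 0) (n : ℕ) :
    φ (X ^ (2 * n)) = q ^ n * dicksonMoment φ q n 0 / 2 := by
  rw [dicksonMoment, mul_zero, dickson_one_zero_eq, mul_comm _ (C (2 : ℝ)), linearMap_C_mul,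
    add_zero]
  field_simp

theorem dicksonMoment_zero (j : ℕ) :
    dicksonMoment φ q 0 j = φ (dickson 1 q (2 * j)) / q ^ j := by
  simp [dicksonMoment]

theorem apply_X_pow_le_of_dicksonMoment_le (hq : 0 < q) {c t : ℝ} (hc : 0 ≤ c) (ht : 0 < t)
    (h : ∀ j, dicksonMoment φ q 0 j ≤ c * t ^ j) (n : ℕ) :
    φ (X ^ (2 * n)) ≤ c * (q * (t + 2 + t⁻¹)) ^ n := by
  have := le_of_recurrence_of_le (dicksonMoment_succ_zero (φ := φ) hq.ne')
    (dicksonMoment_succ_succ hq.ne') ht.ne' (α := c) (β := 0) (fun j => (h j).trans (by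
      have : 0 ≤ c * t⁻¹ ^ j := by positivity
      linarith)) n 0
  rw [apply_X_pow_eq_dicksonMoment hq.ne', mul_pow]
  calc _ ≤ q ^ n * (c * (t + 2 + t⁻¹) ^ n * (t ^ 0 + t⁻¹ ^ 0) + 0 * 4 ^ n) / 2 := by gcongr
    _ = _ := by rw [pow_zero, pow_zero]; ring

theorem le_apply_X_pow_of_le_dicksonMoment (hq : 0 < q) {c c' t : ℝ} (ht : 0 < t)
    (h : ∀ j, c * (t ^ j + t⁻¹ ^ j) - c' ≤ dicksonMoment φ q 0 j) (n : ℕ) :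
    c * (q * (t + 2 + t⁻¹)) ^ n - c' / 2 * (q * 4) ^ n ≤ φ (X ^ (2 * n)) := by
  have := le_of_recurrence_of_le (m := fun n j => -dicksonMoment φ q n j)
    (fun n => by rw [dicksonMoment_succ_zero hq.ne']; ring)
    (fun n j => by rw [dicksonMoment_succ_succ hq.ne']; ring) ht.ne' (α := -c) (β := c')
    (fun j => by linarith [h j]) n 0
  rw [apply_X_pow_eq_dicksonMoment hq.ne', mul_pow, mul_pow]
  calc _ = q ^ n * -(-c * (t + 2 + t⁻¹) ^ n * (t ^ 0 + t⁻¹ ^ 0) + c' * 4 ^ n) / 2 := by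
        rw [pow_zero, pow_zero]; ring
    _ ≤ _ := by gcongr; linarith

variable (hφ : ∀ p, 0 ≤ φ (p ^ 2)) (hφ1 : φ 1 = 1)

include hφ hφ1 in
theorem dicksonMoment_zero_add_two_nonneg (hq : 0 < q) (n : ℕ) :
    0 ≤ dicksonMoment φ q 0 n + 2 := by
  have h := hφ (dickson 1 q n)
  have h1 := dickson_add_mul_dickson q n 0
  rw [zero_add, zero_add, dickson_one_zero_eq, ← sq] at h1
  rw [h1, map_add, linearMap_C_mul, ← mul_one (C (2 : ℝ)), linearMap_C_mul, hφ1, mul_one] at h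
  rw [dicksonMoment_zero, div_add' _ _ _ (by positivity)]
  exact div_nonneg (by linarith) (by positivity)

include hφ hφ1 in
theorem dicksonMoment_zero_almost_logConvex (hq : 0 < q) (n : ℕ)
    (h4 : 4 ≤ dicksonMoment φ q 0 (n + 1) + 2) :
    (dicksonMoment φ q 0 (n + 1) + 2 - 4) ^ 2 ≤
      (dicksonMoment φ q 0 (n + 2) + 2) * (dicksonMoment φ q 0 n + 2) := by
  have hsq : ∀ k, φ (dickson 1 q k ^ 2) = q ^ k * (dicksonMoment φ q 0 k + 2) := by
    intro k
    have h1 := dickson_add_mul_dickson q k 0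
    rw [zero_add, zero_add, dickson_one_zero_eq, ← sq] at h1
    rw [h1, map_add, linearMap_C_mul, ← mul_one (C (2 : ℝ)), linearMap_C_mul, hφ1, mul_one,
      dicksonMoment_zero]
    field_simp
  have hmul : φ (dickson 1 q (n + 2) * dickson 1 q n) =
      q ^ (n + 1) * (dicksonMoment φ q 0 (n + 1) + dicksonMoment φ q 0 1) := by
    rw [add_comm n 2, dickson_add_mul_dickson q n 2, map_add, linearMap_C_mul,
      dicksonMoment_zero, dicksonMoment_zero, show 2 + 2 * n = 2 * (n + 1) by ring]
    field_simp
    ring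
  have hcs := linearMap_mul_sq_le φ hφ (dickson 1 q (n + 2)) (dickson 1 q n)
  rw [hmul, hsq, hsq, mul_pow,
    show q ^ (n + 2) * (dicksonMoment φ q 0 (n + 2) + 2) * (q ^ n * (dicksonMoment φ q 0 n + 2)) =
      (q ^ (n + 1)) ^ 2 * ((dicksonMoment φ q 0 (n + 2) + 2) * (dicksonMoment φ q 0 n + 2)) by
      ring] at hcs
  refine le_trans ?_ (le_of_mul_le_mul_left hcs (by positivity))
  have h1 := dicksonMoment_zero_add_two_nonneg hφ hφ1 hq 1
  gcongr
  all_goals linarith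

theorem dicksonMoment_zero_growth (hq : 0 < q) {ν : ℝ} (hν : 2 * √q < ν)
    (hgrow : ∀ c, ∃ n, c * ν ^ (2 * n) < φ (X ^ (2 * n))) :
    ∃ t, 1 < t ∧ ∀ c, ∃ n, c * t ^ n < dicksonMoment φ q 0 n + 2 := by
  have hν' : 4 * q < ν ^ 2 := by
    have := pow_lt_pow_left₀ hν (by positivity) two_ne_zero
    rwa [mul_pow, Real.sq_sqrt hq.le, show (2 : ℝ) ^ 2 = 4 by norm_num] at this
  have hpos : 0 < ν ^ 2 / q - 4 := by rw [sub_pos, lt_div_iff₀ hq]; exact hν'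
  set t := 1 + √(ν ^ 2 / q - 4) with ht
  have ht1 : 1 < t := by simpa [ht] using hpos
  have hY : q * (t + 2 + t⁻¹) ≤ ν ^ 2 := by
    have h1 : t + 2 + t⁻¹ = 4 + (t - 1) ^ 2 / t := by field_simp; ring
    have h2 : (t - 1) ^ 2 / t ≤ (t - 1) ^ 2 := div_le_self (sq_nonneg _) ht1.le
    have h3 : (t - 1) ^ 2 = ν ^ 2 / q - 4 := by
      rw [ht, add_sub_cancel_left, Real.sq_sqrt hpos.le]
    rw [← le_div_iff₀' hq]
    linarith
  refine ⟨t, ht1, fun c => ?_⟩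
  by_contra! hcon
  obtain ⟨n, hn⟩ := hgrow |c|
  have h := apply_X_pow_le_of_dicksonMoment_le (φ := φ) hq (abs_nonneg c) (t := t) (by linarith)
    (fun j => by
      have h1 := hcon j
      have h2 : c * t ^ j ≤ |c| * t ^ j := by gcongr; exact le_abs_self c
      linarith) n
  have h3 : |c| * (q * (t + 2 + t⁻¹)) ^ n ≤ |c| * (ν ^ 2) ^ n := by gcongr
  rw [← pow_mul] at h3
  linarith

end DicksonMoments

section RatioLimit

open Polynomial

theorem mul_le_succ_of_lt_ratio {f : ℕ → ℝ} (htop : Tendsto f atTop atTop) {l : ℝ}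
    (h : ∀ᶠ n in atTop, l ≤ f (n + 1) / f n) :
    ∃ M, 0 < f M ∧ ∀ n, M ≤ n → l * f n ≤ f (n + 1) := by
  obtain ⟨M, hM⟩ := eventually_atTop.1 (h.and (htop.eventually_gt_atTop 0))
  exact ⟨M, (hM M le_rfl).2, fun n hn => (le_div_iff₀ (hM n hn).2).1 (hM n hn).1⟩

theorem eventually_half_mul_pow_le {c c' Y : ℝ} (hc : 0 < c) (hY : 4 < Y) {q : ℝ} (hq : 0 < q) :
    ∀ᶠ n : ℕ in atTop, c / 2 * (q * Y) ^ n ≤ c * (q * Y) ^ n - c' * (q * 4) ^ n := by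
  have h0 : Tendsto (fun n : ℕ => |c'| * (4 / Y) ^ n) atTop (nhds 0) := by
    simpa using (tendsto_pow_atTop_nhds_zero_of_lt_one (r := 4 / Y) (by positivity)
      ((div_lt_one (by linarith)).2 hY)).const_mul |c'|
  filter_upwards [h0.eventually (gt_mem_nhds (half_pos hc))] with n hn
  have hY0 : 0 < Y := by linarith
  rw [div_pow, ← mul_div_assoc, div_lt_iff₀ (by positivity)] at hn
  have h1 : c' * 4 ^ n ≤ |c'| * 4 ^ n := by gcongr; exact le_abs_self _
  have h2 : q ^ n * (c' * 4 ^ n) ≤ q ^ n * (c / 2 * Y ^ n) :=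
    mul_le_mul_of_nonneg_left (by linarith) (by positivity)
  rw [mul_pow, mul_pow]
  linarith

theorem four_lt_add_inv {l : ℝ} (hl : 1 < l) : 4 < l + 2 + l⁻¹ := by
  have h : l + l⁻¹ - 2 = (l - 1) ^ 2 / l := by field_simp; ring
  have : 0 < (l - 1) ^ 2 / l := div_pos (pow_pos (by linarith) 2) (by linarith)
  linarith

theorem eq_sq_of_two_mul_eq_sqrt {L ρ : ℝ} (hL : 1 < L) (h : 2 * ρ = √(L + 2 + L⁻¹)) :
    L = (ρ + √(ρ ^ 2 - 1)) ^ 2 := by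
  have hy : 0 < √L := Real.sqrt_pos.2 (by linarith)
  have hyL : √L ^ 2 = L := Real.sq_sqrt (by linarith)
  have hy1 : 1 < √L := by rw [Real.lt_sqrt zero_le_one]; linarith
  set y := √L
  have h1 : 2 * ρ = y + y⁻¹ := by
    rw [h, Real.sqrt_eq_iff_mul_self_eq_of_pos (by positivity), ← hyL]
    field_simp
    ring
  have h2 : √(ρ ^ 2 - 1) = (y - y⁻¹) / 2 := by
    rw [show ρ = (y + y⁻¹) / 2 by linarith,
      show ((y + y⁻¹) / 2) ^ 2 - 1 = ((y - y⁻¹) / 2) ^ 2 by field_simp; ring]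
    exact Real.sqrt_sq (by linarith [inv_lt_one_of_one_lt₀ hy1])
  rw [h2, show ρ = (y + y⁻¹) / 2 by linarith, ← hyL]
  ring

theorem linearMap_spherePoly_ratio_tendsto (φ : ℝ[X] →ₗ[ℝ] ℝ) (hφ : ∀ p, 0 ≤ φ (p ^ 2))
    (hφ1 : φ 1 = 1) {q : ℝ} (hq : 1 < q)
    (hgrow : ∃ ν, 2 * √q < ν ∧ ∀ c, ∃ n, c * ν ^ (2 * n) < φ (X ^ (2 * n))) {ρ : ℝ}
    (hρ : Tendsto (fun n : ℕ => (φ (X ^ (2 * n))) ^ ((1 : ℝ) / (2 * n)) / (2 * √q))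
      atTop (nhds ρ)) :
    Tendsto (fun n : ℕ => φ (spherePoly q (2 * n + 2)) / φ (spherePoly q (2 * n))) atTop
      (nhds (q * (ρ + √(ρ ^ 2 - 1)) ^ 2)) := by
  have hq0 : 0 < q := by linarith
  have hX : ∀ n, 0 ≤ φ (X ^ (2 * n)) := fun n => by
    rw [mul_comm, pow_mul]
    exact hφ _
  set f : ℕ → ℝ := fun n => dicksonMoment φ q 0 n + 2 with hf
  have hf0 : ∀ n, 0 ≤ f n := dicksonMoment_zero_add_two_nonneg hφ hφ1 hq0
  obtain ⟨ν, hν, hνg⟩ := hgrow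
  obtain ⟨t, ht, htg⟩ := dicksonMoment_zero_growth hq0 hν hνg
  obtain ⟨htop, hlim⟩ := ratio_tendsto_of_almost_logConvex f
    (dicksonMoment_zero_almost_logConvex hφ hφ1 hq0) hf0 t ht htg
  have hlow : ∀ l, 1 < l → (∀ᶠ n in atTop, l ≤ f (n + 1) / f n) → √(l + 2 + l⁻¹) ≤ 2 * ρ := by
    intro l hl hev
    obtain ⟨M, hM0, hM⟩ := mul_le_succ_of_lt_ratio htop hev
    obtain ⟨c, hc, c', hcc⟩ := add_inv_le_of_mul_growth hl hM0 hf0 hM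
    refine le_root_limit hq0 hρ (half_pos hc) (by positivity) ?_
    filter_upwards [eventually_half_mul_pow_le (c' := (c' + 2) / 2) hc (four_lt_add_inv hl) hq0]
      with n hn
    refine hn.trans (le_apply_X_pow_of_le_dicksonMoment hq0 (by linarith) (fun j => ?_) n)
    linarith [hcc j]
  have hup : ∀ l, 1 < l → (∀ᶠ n in atTop, f (n + 1) / f n ≤ l) → 2 * ρ ≤ √(l + 2 + l⁻¹) := by
    intro l hl hev
    obtain ⟨c, hc, hcl⟩ := exists_le_mul_pow (l := l) (by linarith) (f := f) (by
      filter_upwards [hev, htop.eventually_gt_atTop 0] with n h1 h2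
      exact (div_le_iff₀ h2).1 h1)
    exact root_limit_le hq0 hX hρ hc (by positivity)
      (apply_X_pow_le_of_dicksonMoment_le hq0 hc.le (by linarith) fun j => by linarith [hcl j])
  obtain ⟨L, hL, hfL⟩ : ∃ L, 1 < L ∧ Tendsto (fun n => f (n + 1) / f n) atTop (nhds L) := by
    refine hlim.resolve_left fun hinf => ?_
    have h1 := hlow ((2 * ρ) ^ 2 + 2) (by nlinarith) (hinf.eventually_ge_atTop _)
    have h2 : 0 < ((2 * ρ) ^ 2 + 2)⁻¹ := by positivity
    linarith [(Real.sqrt_le_iff.1 h1).2]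
  have hcont : ContinuousAt (fun l : ℝ => √(l + 2 + l⁻¹)) L := by
    have : L ≠ 0 := by linarith
    fun_prop (disch := assumption)
  have hρL : 2 * ρ = √(L + 2 + L⁻¹) := by
    refine le_antisymm ?_ ?_
    · refine ge_of_tendsto (hcont.tendsto.mono_left (nhdsWithin_le_nhds (s := Set.Ioi L))) ?_
      filter_upwards [self_mem_nhdsWithin] with l hl
      exact hup l (hL.trans hl) ((hfL.eventually (gt_mem_nhds hl)).mono fun _ => le_of_lt)
    · refine le_of_tendsto (hcont.tendsto.mono_left (nhdsWithin_le_nhds (s := Set.Iio L))) ?_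
      filter_upwards [self_mem_nhdsWithin, nhdsWithin_le_nhds (lt_mem_nhds hL)] with l hl h1
      exact hlow l h1 ((hfL.eventually (lt_mem_nhds hl)).mono fun _ => le_of_lt)
  rw [← eq_sq_of_two_mul_eq_sqrt hL hρL]
  have hbtop : Tendsto (fun n => dicksonMoment φ q 0 n) atTop atTop := by
    simpa [hf] using tendsto_atTop_add_const_right atTop (-2) htop
  have hbL : Tendsto (fun n => dicksonMoment φ q 0 (n + 1) / dicksonMoment φ q 0 n) atTop
      (nhds L) := by
    have hinv := hbtop.inv_tendsto_atTop
    have h := (hfL.mul ((hinv.const_mul 2).const_add 1)).sub (hinv.const_mul 2)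
    rw [mul_zero, add_zero, mul_one, sub_zero] at h
    refine h.congr' ?_
    filter_upwards [hbtop.eventually_gt_atTop 0] with n hn
    simp only [hf, Pi.inv_apply]
    field_simp
    ring
  have ha := tendsto_ratio_of_sub_eq (a := fun n => φ (spherePoly q (2 * n)) / q ^ n) hq hL
    (hbtop.eventually_gt_atTop 0) hbL (by
      filter_upwards [eventually_gt_atTop 0] with n hn
      obtain ⟨k, rfl⟩ : ∃ k, n = k + 1 := ⟨n - 1, by omega⟩
      have h := congrArg φ (spherePoly_sub_eq_dickson_sub q (2 * k + 1))
      rw [map_sub, map_sub, linearMap_C_mul] at h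
      simp only [dicksonMoment_zero, show 2 * (k + 1 + 1) = 2 * k + 1 + 3 by ring,
        show 2 * (k + 1) = 2 * k + 1 + 1 by ring]
      field_simp
      linear_combination q ^ (k + 2) * h)
  refine (ha.const_mul q).congr fun n => ?_
  rw [show 2 * (n + 1) = 2 * n + 2 by ring]
  field_simp
  ring

end RatioLimit

section FreeGroupSphere

open FreeGroup

variable {α : Type*}

/-- The inverse of a letter of the alphabet of a free group. -/
def flipLetter : α × Bool ≃ α × Bool := (Equiv.refl α).prodCongr Equiv.boolNot

theorem flipLetter_flipLetter (s : α × Bool) : flipLetter (flipLetter s) = s := by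
  simp [flipLetter, Prod.map]

theorem mk_flipLetter (s : α × Bool) : mk [flipLetter s] = (mk [s])⁻¹ := rfl

theorem mk_singleton_eq_ite (s : α × Bool) :
    mk [s] = if s.2 then of s.1 else (of s.1)⁻¹ := by
  obtain ⟨a, b⟩ := s
  cases b <;> rfl

theorem compatible_iff_ne_flipLetter (a b : α × Bool) :
    (a.1 = b.1 → a.2 = b.2) ↔ a ≠ flipLetter b := by
  obtain ⟨a, i⟩ := a
  obtain ⟨b, j⟩ := b
  cases i <;> cases j <;> simp [flipLetter]

variable [DecidableEq α]

theorem isReduced_cons_toWord {x : FreeGroup α} {a : α × Bool} {L : List (α × Bool)}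
    (hx : x.toWord = a :: L) {s : α × Bool} (hs : s ≠ flipLetter a) :
    IsReduced (s :: x.toWord) := by
  rw [hx, isReduced_cons_cons, compatible_iff_ne_flipLetter, ← hx]
  exact ⟨hs, isReduced_toWord⟩

theorem norm_mk_inv_mul {x : FreeGroup α} {a : α × Bool} {L : List (α × Bool)}
    (hx : x.toWord = a :: L) (s : α × Bool) :
    norm ((mk [s])⁻¹ * x) = if s = a then L.length else L.length + 2 := by
  have hmk : mk (a :: L) = x := by rw [← hx, mk_toWord]
  split_ifs with h
  · have h1 : (mk [s])⁻¹ * x = mk L := by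
      rw [inv_mul_eq_iff_eq_mul, mul_mk, h, List.singleton_append, hmk]
    have h2 : IsReduced L := (isReduced_toWord (x := x)).infix ⟨[a], [], by simp [hx]⟩
    rw [h1, FreeGroup.norm, toWord_mk, h2.reduce_eq]
  · have h1 : (mk [s])⁻¹ * x = mk (flipLetter s :: x.toWord) := by
      calc _ = mk [flipLetter s] * mk x.toWord := by rw [mk_toWord, mk_flipLetter]
        _ = _ := rfl
    rw [h1, FreeGroup.norm, toWord_mk,
      (isReduced_cons_toWord hx (flipLetter.injective.ne h)).reduce_eq, hx]
    rfl

theorem norm_mk_singleton (s : α × Bool) : norm (mk [s]) = 1 := by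
  rw [FreeGroup.norm, toWord_mk, IsReduced.singleton.reduce_eq]
  rfl

variable [Fintype α]

theorem finite_norm_eq (n : ℕ) : {x : FreeGroup α | norm x = n}.Finite :=
  Set.Finite.of_finite_image ((List.finite_length_eq (α × Bool) n).subset (by
    rintro _ ⟨x, hx, rfl⟩
    exact hx)) toWord_injective.injOn

/-- The sphere of radius `n` in a free group. -/
noncomputable def sphere (α : Type*) [DecidableEq α] [Fintype α] (n : ℕ) :
    Finset (FreeGroup α) :=
  (finite_norm_eq n).toFinset

theorem mem_sphere {n : ℕ} {x : FreeGroup α} : x ∈ sphere α n ↔ norm x = n := by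
  simp [sphere]

/-- The sum in the group algebra of the elements of the sphere of radius `n`. -/
noncomputable def sphereSum (α : Type*) [DecidableEq α] [Fintype α] (n : ℕ) :
    MonoidAlgebra ℝ (FreeGroup α) :=
  ∑ x ∈ sphere α n, MonoidAlgebra.single x 1

theorem coeff_sphereSum (n : ℕ) (x : FreeGroup α) :
    (sphereSum α n).coeff x = if norm x = n then 1 else 0 := by
  simp [sphereSum, MonoidAlgebra.coeff_sum, Finsupp.single_apply, mem_sphere]

theorem sum_ite_norm_mk_inv_mul {x : FreeGroup α} (hx : x ≠ 1) (n : ℕ) :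
    ∑ s : α × Bool, (if norm ((mk [s])⁻¹ * x) = n then (1 : ℝ) else 0) =
      (if norm x = n + 1 then 1 else 0) +
        if norm x + 1 = n then (Fintype.card (α × Bool) - 1 : ℝ) else 0 := by
  obtain ⟨a, L, hL⟩ := List.exists_cons_of_ne_nil (mt toWord_eq_nil_iff.1 hx)
  have hnorm : norm x = L.length + 1 := by rw [FreeGroup.norm, hL]; rfl
  rw [← Finset.add_sum_erase _ _ (Finset.mem_univ a), norm_mk_inv_mul hL, if_pos rfl]
  have h : ∀ s ∈ Finset.univ.erase a, (if norm ((mk [s])⁻¹ * x) = n then (1 : ℝ) else 0) =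
      if norm x + 1 = n then 1 else 0 := fun s hs => by
    rw [norm_mk_inv_mul hL, if_neg (Finset.ne_of_mem_erase hs), hnorm]
  rw [Finset.sum_congr rfl h, Finset.sum_const, Finset.card_erase_of_mem (Finset.mem_univ _),
    Finset.card_univ, hnorm, nsmul_eq_mul,
    Nat.cast_pred (Fintype.card_pos_iff.2 ⟨a⟩), mul_ite, mul_one, mul_zero]
  simp only [add_left_inj]

theorem aeval_spherePoly_eq_sphereSum (n : ℕ) :
    Polynomial.aeval (stepSum fun s : α × Bool => mk [s])
      (spherePoly (Fintype.card (α × Bool) - 1) n) = sphereSum α n := by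
  set A := stepSum fun s : α × Bool => mk [s] with hA
  have hmul : ∀ n x, (A * sphereSum α n).coeff x =
      ∑ s : α × Bool, (if norm ((mk [s])⁻¹ * x) = n then (1 : ℝ) else 0) := fun n x => by
    rw [hA, coeff_stepSum_mul]
    simp only [coeff_sphereSum]
  have hmul1 : ∀ n, (A * sphereSum α n).coeff 1 =
      if n = 1 then (Fintype.card (α × Bool) : ℝ) else 0 := fun n => by
    rw [hmul]
    simp only [mul_one, norm_inv_eq, norm_mk_singleton, eq_comm (a := 1)]
    split_ifs <;> simp
  have h0 : sphereSum α 0 = 1 := by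
    ext x
    simp only [coeff_sphereSum, coeff_one_apply, FreeGroup.norm_eq_zero]
  have h1 : sphereSum α 1 = A := by
    rw [← mul_one A, ← h0]
    ext x
    by_cases hx : x = 1
    · rw [hx, hmul1, coeff_sphereSum]
      simp
    · rw [hmul, sum_ite_norm_mk_inv_mul hx, coeff_sphereSum]
      simp
  have h2 : A * sphereSum α 1 = sphereSum α 2 + (Fintype.card (α × Bool) : ℝ) • 1 := by
    ext x
    rw [MonoidAlgebra.coeff_add, Finsupp.add_apply, MonoidAlgebra.coeff_smul_apply,
      coeff_one_apply, coeff_sphereSum]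
    by_cases hx : x = 1
    · rw [hx, hmul1]
      simp
    · rw [hmul, sum_ite_norm_mk_inv_mul hx]
      simp [hx]
  have h3 : ∀ n, A * sphereSum α (n + 2) =
      sphereSum α (n + 3) + (Fintype.card (α × Bool) - 1 : ℝ) • sphereSum α (n + 1) := fun n => by
    ext x
    rw [MonoidAlgebra.coeff_add, Finsupp.add_apply, MonoidAlgebra.coeff_smul_apply,
      coeff_sphereSum, coeff_sphereSum]
    by_cases hx : x = 1
    · rw [hx, hmul1]
      simp
    · rw [hmul, sum_ite_norm_mk_inv_mul hx]
      simp
  have hind : ∀ n, Polynomial.aeval A (spherePoly (Fintype.card (α × Bool) - 1) n) = sphereSum α n ∧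
      Polynomial.aeval A (spherePoly (Fintype.card (α × Bool) - 1) (n + 1)) = sphereSum α (n + 1) ∧
      Polynomial.aeval A (spherePoly (Fintype.card (α × Bool) - 1) (n + 2)) =
        sphereSum α (n + 2) := by
    intro n
    induction n with
    | zero =>
      refine ⟨by simp [spherePoly, h0], by simp [spherePoly, h1], ?_⟩
      rw [← sub_eq_iff_eq_add.2 h2, h1]
      simp only [spherePoly, sq, sub_add_cancel, map_sub, _root_.map_mul, Polynomial.aeval_X,
        Polynomial.aeval_C, Algebra.algebraMap_eq_smul_one]
    | succ n ih =>
      refine ⟨ih.2.1, ih.2.2, ?_⟩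
      rw [show n + 1 + 2 = n + 3 by rfl, ← sub_eq_iff_eq_add.2 (h3 n), spherePoly, map_sub,
        _root_.map_mul,
        _root_.map_mul, ih.2.1, ih.2.2, Polynomial.aeval_X, Polynomial.aeval_C, Algebra.smul_def]
  exact (hind n).1

end FreeGroupSphere

section CogrowthLowerBound

open FreeGroup

variable {α : Type*} [DecidableEq α]

theorem toWord_conj {x : FreeGroup α} {s : α × Bool}
    (h : IsReduced (s :: (x.toWord ++ [flipLetter s]))) :
    (mk [s] * x * (mk [s])⁻¹).toWord = s :: (x.toWord ++ [flipLetter s]) := by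
  have h1 : mk [s] * x * (mk [s])⁻¹ = mk (s :: (x.toWord ++ [flipLetter s])) := by
    calc _ = mk [s] * mk x.toWord * mk [flipLetter s] := by rw [mk_toWord, mk_flipLetter]
      _ = _ := rfl
  rw [h1, toWord_mk, h.reduce_eq]

theorem isReduced_cons_append_flipLetter {x : FreeGroup α} {a s : α × Bool}
    {L : List (α × Bool)} (hx : x.toWord = a :: (L ++ [flipLetter a])) (hs : s ≠ flipLetter a) :
    IsReduced (s :: (x.toWord ++ [flipLetter s])) := by
  refine IsReduced.append_overlap (L₁ := [s]) (L₂ := x.toWord) (L₃ := [flipLetter s])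
    (isReduced_cons_toWord hx hs) ?_ (by simp [hx])
  refine List.isChain_append.2 ⟨isReduced_toWord, IsReduced.singleton, fun b hb c hc => ?_⟩
  have hb' : flipLetter a = b := by
    rw [hx, ← List.cons_append, List.getLast?_concat] at hb
    exact Option.mem_some_iff.1 hb
  have hc' : flipLetter s = c := by simpa using hc
  rw [compatible_iff_ne_flipLetter, ← hb', ← hc', flipLetter_flipLetter]
  exact hs.symm

variable [Fintype α]

theorem exists_mem_toWord_eq_cons_append {N : Subgroup (FreeGroup α)} (hN : N.Normal)
    (hNbot : N ≠ ⊥) (hα : 2 ≤ Fintype.card α) :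
    ∃ x ∈ N, ∃ a L, x.toWord = a :: (L ++ [flipLetter a]) := by
  obtain ⟨x, hx, hx1⟩ := N.bot_or_exists_ne_one.resolve_left hNbot
  have hne := mt toWord_eq_nil_iff.1 hx1
  obtain ⟨s, hs⟩ : ∃ s, s ∉ ({flipLetter (x.toWord.head hne), x.toWord.getLast hne} :
      Finset (α × Bool)) := by
    by_contra! h
    have h1 := Finset.card_le_card (fun s _ => h s : (Finset.univ : Finset (α × Bool)) ⊆ _)
    have h2 := h1.trans Finset.card_le_two
    rw [Finset.card_univ, Fintype.card_prod, Fintype.card_bool] at h2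
    omega
  simp only [Finset.mem_insert, Finset.mem_singleton, not_or] at hs
  refine ⟨mk [s] * x * (mk [s])⁻¹, hN.conj_mem x hx _, s, x.toWord, toWord_conj ?_⟩
  refine IsReduced.append_overlap (L₁ := [s]) (L₂ := x.toWord) (L₃ := [flipLetter s]) ?_ ?_ hne
  · exact isReduced_cons_toWord (List.cons_head_tail hne).symm hs.1
  · refine List.isChain_append.2 ⟨isReduced_toWord, IsReduced.singleton, fun a ha b hb => ?_⟩
    rw [List.getLast?_eq_some_getLast hne] at ha
    simp only [Option.mem_def, Option.some.injEq, List.head?_cons] at ha hb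
    rw [compatible_iff_ne_flipLetter, ← ha, ← hb, flipLetter_flipLetter]
    exact fun h => hs.2 h.symm

theorem exists_sphere_pow_le_card {N : Subgroup (FreeGroup α)} (hN : N.Normal)
    (hNbot : N ≠ ⊥) (hα : 2 ≤ Fintype.card α) :
    ∃ m, ∀ k, ∃ T : Finset (FreeGroup α), (Fintype.card (α × Bool) - 1) ^ k ≤ T.card ∧
      ∀ x ∈ T, x ∈ N ∧ norm x = m + 2 * k ∧
        ∃ a L, x.toWord = a :: (L ++ [flipLetter a]) := by
  obtain ⟨x, hxN, hx⟩ := exists_mem_toWord_eq_cons_append hN hNbot hα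
  refine ⟨norm x, fun k => ?_⟩
  induction k with
  | zero =>
    refine ⟨{x}, by simp, fun y hy => ?_⟩
    rw [Finset.mem_singleton.1 hy]
    exact ⟨hxN, rfl, hx⟩
  | succ k ih =>
    obtain ⟨T, hcard, hT⟩ := ih
    have hword : ∀ y ∈ T, ∃ a, ∀ s, s ≠ flipLetter a →
        (mk [s] * y * (mk [s])⁻¹).toWord = s :: (y.toWord ++ [flipLetter s]) := fun y hy => by
      obtain ⟨-, -, a, L, h⟩ := hT y hy
      exact ⟨a, fun s hs => toWord_conj (isReduced_cons_append_flipLetter h hs)⟩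
    have : Nonempty (α × Bool) := ⟨hx.choose⟩
    choose! c hc using hword
    set P := T.sigma fun y => Finset.univ.erase (flipLetter (c y)) with hP
    have hmem : ∀ p ∈ P, p.1 ∈ T ∧ (mk [p.2] * p.1 * (mk [p.2])⁻¹).toWord =
        p.2 :: (p.1.toWord ++ [flipLetter p.2]) := fun p hp => by
      rw [hP, Finset.mem_sigma, Finset.mem_erase] at hp
      exact ⟨hp.1, hc p.1 hp.1 p.2 hp.2.1⟩
    refine ⟨P.image fun p => mk [p.2] * p.1 * (mk [p.2])⁻¹, ?_, ?_⟩
    · rw [Finset.card_image_of_injOn, hP, Finset.card_sigma]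
      · simp only [Finset.card_erase_of_mem (Finset.mem_univ _), Finset.card_univ,
          Finset.sum_const, smul_eq_mul, pow_succ]
        gcongr
      · intro p hp p' hp' h
        have h1 := congrArg toWord h
        simp only [(hmem p hp).2, (hmem p' hp').2, List.cons.injEq] at h1
        obtain ⟨y, s⟩ := p
        obtain ⟨y', s'⟩ := p'
        obtain ⟨rfl, -⟩ := h1
        simpa using h
    · intro z hz
      obtain ⟨p, hp, rfl⟩ := Finset.mem_image.1 hz
      obtain ⟨h1, h2⟩ := hmem p hp
      obtain ⟨hpN, hnorm, -⟩ := hT p.1 h1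
      refine ⟨hN.conj_mem _ hpN _, ?_, p.2, p.1.toWord, h2⟩
      rw [FreeGroup.norm, h2, List.length_cons, List.length_append, ← FreeGroup.norm, hnorm]
      simp only [List.length_singleton]
      ring

end CogrowthLowerBound

section GroupAlgebraMap

theorem mapDomainAlgHom_stepSum {F G S : Type*} [Group F] [Group G] [Fintype S] (f : F →* G)
    (g : S → F) :
    MonoidAlgebra.mapDomainAlgHom ℝ ℝ f (stepSum g) = stepSum fun s => f (g s) := by
  simp [stepSum]

theorem stepSum_pow {G S : Type*} [Group G] [Fintype S] (g : S → G) (n : ℕ) :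
    stepSum g ^ n =
      ∑ s : Fin n → S, MonoidAlgebra.single (List.ofFn fun i => g (s i)).prod (1 : ℝ) := by
  induction n with
  | zero => simp [MonoidAlgebra.one_def]
  | succ n ih =>
    rw [pow_succ', ih, ← (Fin.consEquiv fun _ => S).sum_comp, Fintype.sum_prod_type, stepSum,
      Finset.sum_mul_sum]
    simp [MonoidAlgebra.single_mul_single, List.ofFn_succ]

theorem coeff_one_stepSum_pow {G S : Type*} [Group G] [Fintype S] (g : S → G) (n : ℕ) :
    (stepSum g ^ n).coeff 1 =
      Nat.card {s : Fin n → S // (List.ofFn fun i => g (s i)).prod = 1} := by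
  classical
  rw [stepSum_pow, coeff_sum_apply]
  simp only [MonoidAlgebra.coeff_single, Finsupp.single_apply]
  rw [Finset.sum_boole, Nat.card_eq_fintype_card, Fintype.card_subtype]

theorem coeff_mapDomainAlgHom_sphereSum {α G : Type*} [DecidableEq α] [Fintype α] [Group G]
    [DecidableEq G] (f : FreeGroup α →* G) (n : ℕ) (y : G) :
    (MonoidAlgebra.mapDomainAlgHom ℝ ℝ f (sphereSum α n)).coeff y =
      ((sphere α n).filter fun x => f x = y).card := by
  rw [sphereSum, map_sum, coeff_sum_apply]
  simp [Finsupp.single_apply]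

end GroupAlgebraMap

section Kesten

open Polynomial

variable {G S : Type*} [Group G] [Fintype S] (g : S → G) (e : S ≃ S)
  (he : ∀ s, g (e s) = (g s)⁻¹)

theorem coeff_stepSum_pow_mul_nonneg (f : MonoidAlgebra ℝ G) (hf : ∀ x, 0 ≤ f.coeff x) (k : ℕ)
    (x : G) : 0 ≤ (stepSum g ^ k * f).coeff x := by
  induction k generalizing x with
  | zero => simpa using hf x
  | succ k ih =>
    rw [pow_succ', mul_assoc]
    exact coeff_stepSum_mul_nonneg g _ ih x

include he in
/-- A lower bound for the cogrowth forces the walk to have spectral radius greater than `1`. -/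
theorem exists_walk_growth {s : ℝ} (hs : 1 < s) (hS : (Fintype.card S : ℝ) = s ^ 2 + 1)
    (hnn : ∀ n x, 0 ≤ (aeval (stepSum g) (spherePoly (s ^ 2) n)).coeff x) {m : ℕ}
    (hlow : ∀ k, (s ^ 2) ^ k ≤ (aeval (stepSum g) (spherePoly (s ^ 2) (m + 2 * k))).coeff 1) :
    ∃ ν, 2 * s < ν ∧ ∀ c, ∃ n, c * ν ^ (2 * n) < (stepSum g ^ (2 * n)).coeff 1 := by
  classical
  by_contra! hcon
  have hs0 : 0 < s := by linarith
  have hsum := summable_walk_of_growth g e he (μ := 2 * s) (by positivity)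
    (by rw [hS]; nlinarith) hcon
  set T : ℕ → ℕ → ℝ :=
    fun k n => (stepSum g ^ k * aeval (stepSum g) (spherePoly (s ^ 2) n)).coeff 1 with hT
  have hT0 : ∀ k n, 0 ≤ T k n := fun k n => coeff_stepSum_pow_mul_nonneg g _ (hnn n) k 1
  have hXmul : ∀ k (p : ℝ[X]), stepSum g ^ (k + 1) * aeval (stepSum g) p =
      stepSum g ^ k * aeval (stepSum g) (X * p) := fun k p => by
    rw [map_mul, aeval_X, pow_succ, mul_assoc]
  have hadd : ∀ k (p : ℝ[X]) (c : ℝ) p',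
      (stepSum g ^ k * aeval (stepSum g) (p + C c * p')).coeff 1 =
      (stepSum g ^ k * aeval (stepSum g) p).coeff 1 +
        c * (stepSum g ^ k * aeval (stepSum g) p').coeff 1 := fun k p c p' => by
    rw [map_add, map_mul, aeval_C, ← Algebra.smul_def, mul_add, mul_smul_comm,
      MonoidAlgebra.coeff_add, Finsupp.add_apply, MonoidAlgebra.coeff_smul_apply, smul_eq_mul]
  have hrec : ∀ k n, T (k + 1) (n + 2) = T k (n + 3) + s ^ 2 * T k (n + 1) := fun k n => by
    simp only [hT, hXmul, ← hadd]
    rw [spherePoly, sub_add_cancel]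
  have hle : ∀ k n, T k (n + 1) ≤ T (k + 1) n := fun k n => by
    match n with
    | 0 => simp [hT, pow_succ, spherePoly]
    | 1 =>
      have h : X * spherePoly (s ^ 2) 1 = spherePoly (s ^ 2) 2 + C (s ^ 2 + 1) * 1 := by
        simp only [spherePoly]
        ring
      have h1 : 0 ≤ (stepSum g ^ k * aeval (stepSum g) (1 : ℝ[X])).coeff 1 := by
        simpa using coeff_stepSum_pow_nonneg g k 1
      simp only [hT, hXmul, h, hadd]
      have : 0 ≤ (s ^ 2 + 1) * (stepSum g ^ k * aeval (stepSum g) (1 : ℝ[X])).coeff 1 :=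
        mul_nonneg (by positivity) h1
      linarith
    | n + 2 =>
      rw [hrec]
      have : 0 ≤ s ^ 2 * T k (n + 1) := mul_nonneg (by positivity) (hT0 _ _)
      linarith
  obtain ⟨B, hB⟩ := sum_div_pow_le_of_recurrence hs0 T hT0 hrec hle
    (by simpa [hT, spherePoly] using hsum)
  have hlim := (summable_of_sum_range_le
    (fun n => div_nonneg (hT0 0 (n + 2)) (pow_nonneg hs0.le _)) hB).tendsto_atTop_zero
  have hsub : Tendsto (fun k : ℕ => m + 2 * k) atTop atTop :=
    tendsto_atTop_mono (fun k => show k ≤ m + 2 * k by omega) tendsto_id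
  have hge := ge_of_tendsto' (hlim.comp hsub) (b := (s ^ m)⁻¹) fun k => by
    have h := hlow (k + 1)
    simp only [Function.comp_apply, hT, pow_zero, one_mul]
    rw [show m + 2 * k + 2 = m + 2 * (k + 1) by ring, le_div_iff₀ (by positivity), pow_add,
      inv_mul_cancel_left₀ (by positivity), pow_mul]
    exact h
  have : 0 < (s ^ m)⁻¹ := by positivity
  linarith

end Kesten

/-- Let `r ≥ 2`, `q = 2r - 1`, and let `N` be a nontrivial normal subgroup
of the free group on `r` generators. Let `γ n` be the number of elements of `N` of reduced
length `n`, `W n` the number of `n`-tuples of generators and inverses whose product lies in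
`N`, and `ρ = lim (W (2n))^(1/(2n)) / (2√q)` the spectral radius of the associated random
walk. Then `γ (2n+2) / γ (2n) → q · (ρ + √(ρ² - 1))²`. -/
theorem cogrowth_ratio_tendsto
    (r : ℕ) (hr : 2 ≤ r)
    (N : Subgroup (FreeGroup (Fin r))) (hNnormal : N.Normal) (hNbot : N ≠ ⊥)
    (γ : ℕ → ℕ)
    (hγ : ∀ n, γ n = Nat.card {x : FreeGroup (Fin r) // x ∈ N ∧ FreeGroup.norm x = n})
    (W : ℕ → ℕ)
    (hW : ∀ n, W n = Nat.card {s : Fin n → Fin r × Bool //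
      (List.ofFn (fun i => if (s i).2 then FreeGroup.of (s i).1
        else (FreeGroup.of (s i).1)⁻¹)).prod ∈ N})
    (ρ : ℝ)
    (hρ : Tendsto
      (fun n : ℕ => ((W (2 * n) : ℝ)) ^ ((1 : ℝ) / (2 * n)) / (2 * Real.sqrt (2 * r - 1)))
      atTop (nhds ρ)) :
    Tendsto (fun n : ℕ => (γ (2 * n + 2) : ℝ) / (γ (2 * n) : ℝ)) atTop
      (nhds ((2 * r - 1) * (ρ + Real.sqrt (ρ ^ 2 - 1)) ^ 2)) := by
  classical
  set q : ℝ := 2 * r - 1 with hq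
  have hq1 : 1 < q := by
    have : (2 : ℝ) ≤ r := by exact_mod_cast hr
    linarith
  have hcard : (Fintype.card (Fin r × Bool) : ℝ) - 1 = q := by
    simp [hq, mul_comm]
  set f := QuotientGroup.mk' N with hf
  set g : Fin r × Bool → FreeGroup (Fin r) ⧸ N := fun s => f (FreeGroup.mk [s]) with hg
  have he : ∀ s, g (flipLetter s) = (g s)⁻¹ := fun s => by
    simp only [hg, mk_flipLetter, map_inv]
  have hWg : ∀ n, (stepSum g ^ n).coeff 1 = W n := fun n => by
    rw [coeff_one_stepSum_pow, hW]
    refine congrArg Nat.cast (Nat.card_congr (Equiv.subtypeEquivRight fun s => ?_))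
    rw [← QuotientGroup.eq_one_iff, ← QuotientGroup.mk'_apply, map_list_prod, List.map_ofFn]
    simp only [hg, hf, mk_singleton_eq_ite, Function.comp_def]
  have hσ : ∀ n, Polynomial.aeval (stepSum g) (spherePoly q n) =
      MonoidAlgebra.mapDomainAlgHom ℝ ℝ f (sphereSum (Fin r) n) := fun n => by
    rw [← aeval_spherePoly_eq_sphereSum, hcard, ← Polynomial.aeval_algHom_apply,
      mapDomainAlgHom_stepSum]
  have hγσ : ∀ n, (Polynomial.aeval (stepSum g) (spherePoly q n)).coeff 1 = γ n := fun n => by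
    rw [hσ, coeff_mapDomainAlgHom_sphereSum, hγ, Nat.subtype_card]
    intro x
    rw [Finset.mem_filter, mem_sphere, hf, QuotientGroup.mk'_apply, QuotientGroup.eq_one_iff,
      and_comm]
  have hs2 : √q ^ 2 = q := Real.sq_sqrt (by linarith)
  obtain ⟨m, hm⟩ := exists_sphere_pow_le_card hNnormal hNbot (by simpa using hr)
  have hgrow := exists_walk_growth g flipLetter he (s := √q) (m := m)
    (by rw [Real.lt_sqrt zero_le_one]; linarith) (by rw [hs2]; linarith)
    (fun n x => by
      rw [hs2, hσ, coeff_mapDomainAlgHom_sphereSum]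
      positivity)
    (fun k => by
      obtain ⟨T, hT, hTN⟩ := hm k
      rw [hs2, hσ, coeff_mapDomainAlgHom_sphereSum, ← hcard]
      have h1 : T ⊆ (sphere (Fin r) (m + 2 * k)).filter fun x => f x = 1 := fun x hx => by
        rw [Finset.mem_filter, mem_sphere, hf, QuotientGroup.mk'_apply, QuotientGroup.eq_one_iff]
        exact ⟨(hTN x hx).2.1, (hTN x hx).1⟩
      have h2 := hT.trans (Finset.card_le_card h1)
      have h3 : 1 ≤ Fintype.card (Fin r × Bool) := by simp; omega
      rw [← Nat.cast_one, ← Nat.cast_sub h3]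
      exact_mod_cast h2)
  set φ : Polynomial ℝ →ₗ[ℝ] ℝ :=
    { toFun := fun p => (Polynomial.aeval (stepSum g) p).coeff 1
      map_add' := fun p p' => by simp
      map_smul' := fun c p => by simp } with hφ
  have hφX : ∀ n, φ (Polynomial.X ^ n) = W n := fun n => by
    rw [← hWg]
    simp [hφ]
  have hφσ : ∀ n, φ (spherePoly q n) = γ n := hγσ
  have := linearMap_spherePoly_ratio_tendsto φ (coeff_aeval_stepSum_sq_nonneg g flipLetter he)
    (by simp [hφ]) hq1 (by simpa only [hφX, hWg] using hgrow)
    (by simpa only [hφX] using hρ)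
  simpa only [hφσ] using this
end

section
/- Let r ≥ 2, q = 2r − 1, and let N be a nontrivial normal subgroup of the free group F_r on r generators. With γ_n the number of elements of N of reduced length n, γ = lim_{n→∞}(γ_{2n})^{1/(2n)} the cogrowth exponent, and ρ = lim_{n→∞}(W_{2n})^{1/(2n)}/(2√q) the spectral radius of the random walk (where W_n is the number of n-tuples of generators and inverses whose product lies in N), one has γ = √q · (ρ + √(ρ² − 1)). -/
open Filter

/-- `treeWalk q n k` is the number of walks of length `n` in the `(q + 1)`-regular tree joining two
given vertices at distance `k`. -/
def treeWalk (q : ℕ) : ℕ → ℕ → ℕ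
  | 0, 0 => 1
  | 0, _ + 1 => 0
  | n + 1, 0 => (q + 1) * treeWalk q n 1
  | n + 1, k + 1 => treeWalk q n k + q * treeWalk q n (k + 2)

theorem treeWalk_eq_zero_of_lt (q : ℕ) : ∀ {n k : ℕ}, n < k → treeWalk q n k = 0
  | 0, k + 1, _ => by simp [treeWalk]
  | n + 1, k + 1, h => by
    simp [treeWalk, treeWalk_eq_zero_of_lt q (show n < k by omega),
      treeWalk_eq_zero_of_lt q (show n < k + 2 by omega)]

theorem treeWalk_eq_zero_of_odd (q : ℕ) : ∀ {n k : ℕ}, Odd (n + k) → treeWalk q n k = 0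
  | 0, 0, h => by simp at h
  | 0, k + 1, _ => by simp [treeWalk]
  | n + 1, 0, h => by simp [treeWalk, treeWalk_eq_zero_of_odd q (n := n) (k := 1) (by simpa using h)]
  | n + 1, k + 1, h => by
    have h₁ : Odd (n + k) := by grind
    have h₂ : Odd (n + (k + 2)) := by grind
    simp [treeWalk, treeWalk_eq_zero_of_odd q h₁, treeWalk_eq_zero_of_odd q h₂]

theorem sum_treeWalk_mul_pow_le {q : ℕ} (hq : 0 < q) {x : ℝ} (hx : 0 < x) (hxq : x ≤ q) (n : ℕ) :
    ∑ k ∈ Finset.range (n + 1), treeWalk q n k * x ^ k ≤ 2 * (x + q / x) ^ n := by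
  have hq' : (1 : ℝ) ≤ q := by exact_mod_cast hq
  have key (n : ℕ) : ∑ k ∈ Finset.range (n + 1), treeWalk q n k * x ^ k
      - treeWalk q n 0 / (q + 1) ≤ (x + q / x) ^ n := by
    induction n with
    | zero =>
      simp only [zero_add, Finset.sum_range_one, treeWalk, Nat.cast_one, pow_zero, mul_one]
      have : (0 : ℝ) ≤ 1 / (q + 1) := by positivity
      linarith
    | succ n ih =>
      set S := ∑ k ∈ Finset.range (n + 1), treeWalk q n k * x ^ k with hS
      have hS' : S = ∑ k ∈ Finset.range (n + 1), treeWalk q n (k + 2) * x ^ (k + 2)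
          + treeWalk q n 1 * x + treeWalk q n 0 := by
        have h : S = ∑ k ∈ Finset.range (n + 1 + 2), treeWalk q n k * x ^ k := by
          rw [Finset.sum_range_succ, Finset.sum_range_succ,
            treeWalk_eq_zero_of_lt q (show n < n + 1 by omega),
            treeWalk_eq_zero_of_lt q (show n < n + 1 + 1 by omega)]
          simp [hS]
        rw [h, Finset.sum_range_succ', Finset.sum_range_succ']
        simp
      have hsucc : ∑ k ∈ Finset.range (n + 1 + 1), treeWalk q (n + 1) k * x ^ k =
          (x + q / x) * S + treeWalk q n 1 - q / x * treeWalk q n 0 := by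
        rw [Finset.sum_range_succ']
        have h₁ : ∑ k ∈ Finset.range (n + 1), (treeWalk q (n + 1) (k + 1) : ℝ) * x ^ (k + 1) =
            x * S + q / x *
              ∑ k ∈ Finset.range (n + 1), treeWalk q n (k + 2) * x ^ (k + 2) := by
          rw [hS, Finset.mul_sum, Finset.mul_sum, ← Finset.sum_add_distrib]
          refine Finset.sum_congr rfl fun k _ => ?_
          simp only [treeWalk, Nat.cast_add, Nat.cast_mul]
          field_simp
          ring
        rw [h₁, eq_sub_of_add_eq (eq_sub_of_add_eq hS'.symm)]
        simp only [treeWalk, Nat.cast_mul, Nat.cast_add, Nat.cast_one]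
        field_simp
        ring
      rw [hsucc, pow_succ']
      have hstep : (x + q / x) / (q + 1) ≤ q / x := by
        rw [div_le_iff₀ (by positivity)]
        have : x * x ≤ q * q := by gcongr
        field_simp
        nlinarith
      have h0 : (0 : ℝ) ≤ treeWalk q n 0 := by positivity
      have h₂ : (treeWalk q (n + 1) 0 : ℝ) / (q + 1) = treeWalk q n 1 := by
        simp only [treeWalk, Nat.cast_mul, Nat.cast_add, Nat.cast_one]
        field_simp
      have h₃ := mul_le_mul_of_nonneg_left ih (show 0 ≤ x + q / x by positivity)
      have h₄ := mul_le_mul_of_nonneg_right hstep h0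
      rw [h₂]
      refine le_trans (le_of_eq_of_le ?_ (add_le_add_right h₄ ((x + q / x) * (S -
        treeWalk q n 0 / (q + 1)) - q / x * treeWalk q n 0))) ?_
      · ring
      · linarith
  have h0 : (treeWalk q n 0 : ℝ) ≤ ∑ k ∈ Finset.range (n + 1), treeWalk q n k * x ^ k := by
    have := Finset.single_le_sum (f := fun k => (treeWalk q n k : ℝ) * x ^ k)
      (fun k _ => by positivity) (Finset.mem_range.2 n.succ_pos)
    simpa using this
  have h1 : (treeWalk q n 0 : ℝ) / (q + 1) ≤ treeWalk q n 0 / 2 := by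
    gcongr
    linarith
  linarith [key n]

theorem summable_treeWalk_mul_pow {q : ℕ} (hq : 0 < q) {w : ℝ} (hw : 0 ≤ w)
    (hqw : 2 * √q * w < 1) (k : ℕ) : Summable fun n => treeWalk q n k * w ^ n := by
  have hq' : (1 : ℝ) ≤ q := by exact_mod_cast hq
  have hs : 0 < √(q : ℝ) := by positivity
  have hsq : √(q : ℝ) * √q = q := Real.mul_self_sqrt (by positivity)
  have hg := summable_geometric_of_lt_one (r := 2 * √q * w) (by positivity) hqw
  refine (hg.mul_left (2 / √q ^ k)).of_nonneg_of_le (fun n => by positivity) fun n => ?_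
  have h₁ : treeWalk q n k * √q ^ k ≤ 2 * (2 * √q) ^ n := by
    have hle := sum_treeWalk_mul_pow_le hq hs (by nlinarith [Real.one_le_sqrt.2 hq']) n
    have hdiv : (q : ℝ) / √q = √q := Real.div_sqrt
    rw [hdiv, ← two_mul] at hle
    refine le_trans ?_ hle
    rcases lt_or_ge n k with h | h
    · rw [treeWalk_eq_zero_of_lt q h]
      simpa using Finset.sum_nonneg fun k _ => by positivity
    · exact Finset.single_le_sum (f := fun k => (treeWalk q n k : ℝ) * √q ^ k)
        (fun k _ => by positivity) (Finset.mem_range.2 (by omega))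
  rw [mul_pow _ w, ← mul_assoc]
  gcongr
  rw [div_mul_eq_mul_div, le_div_iff₀ (by positivity)]
  exact h₁

/-- A nonnegative solution of the recurrence dominates the decaying exponential solution. -/
theorem mul_le_succ_of_recurrence {q z : ℝ} (hq : 0 < q) (hz : 0 < z) (hqz : q * z ^ 2 < 1)
    {H : ℕ → ℝ} (hH : ∀ k, 0 ≤ H k)
    (hrec : ∀ k, (1 + q * z ^ 2) * H (k + 1) = z * (H k + q * H (k + 2))) (k : ℕ) :
    z * H k ≤ H (k + 1) := by
  have hD (j : ℕ) : (q * z) ^ j * (H (k + j + 1) - z * H (k + j)) = H (k + 1) - z * H k := by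
    induction j with
    | zero => simp
    | succ j ih =>
      rw [← ih, pow_succ, ← add_assoc]
      linear_combination -(q * z) ^ j * hrec (k + j)
  have hE (j : ℕ) : q * z * H (k + j + 1) - H (k + j) = z ^ j * (q * z * H (k + 1) - H k) := by
    induction j with
    | zero => simp
    | succ j ih =>
      rw [pow_succ', mul_assoc z, ← ih, ← add_assoc]
      linear_combination -hrec (k + j)
  have hlim : Tendsto (fun j => (q * z ^ 2) ^ j * (q * z * H (k + 1) - H k)) atTop (nhds 0) := by
    simpa using (tendsto_pow_atTop_nhds_zero_of_lt_one (by positivity) hqz).mul_const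
      (q * z * H (k + 1) - H k)
  have hle := le_of_tendsto' hlim (b := q * z * (H (k + 1) - z * H k)) fun j => by
    have h := mul_nonneg (mul_nonneg (pow_nonneg (mul_pos hq hz).le j) (sub_nonneg.2 hqz.le))
      (hH (k + j))
    rw [← hD j, show (q * z ^ 2) ^ j = (q * z) ^ j * z ^ j by rw [← mul_pow]; ring, mul_assoc,
      ← hE j]
    linarith
  exact sub_nonneg.1 (nonneg_of_mul_nonneg_right hle (mul_pos hq hz))

theorem two_mul_sqrt_mul_lt_one_add {q z : ℝ} (hq : 0 ≤ q) (hz : 0 ≤ z) (hqz : q * z ^ 2 < 1) :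
    2 * √q * z < 1 + q * z ^ 2 := by
  have hs := Real.sq_sqrt hq
  have : √q * z < 1 := by
    rw [← abs_of_nonneg (by positivity : 0 ≤ √q * z), ← sq_lt_one_iff_abs_lt_one, mul_pow, hs]
    exact hqz
  nlinarith [sq_pos_of_pos (sub_pos.2 this)]

/-- The Green function of the tree decays at most as fast as the powers of `z`. -/
theorem pow_le_tsum_treeWalk_mul_pow {q : ℕ} (hq : 0 < q) {z : ℝ} (hz : 0 < z)
    (hqz : q * z ^ 2 < 1) (k : ℕ) :
    z ^ k ≤ ∑' n, treeWalk q n k * (z / (1 + q * z ^ 2)) ^ n := by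
  set w := z / (1 + q * z ^ 2) with hw
  have hd : 0 < 1 + q * z ^ 2 := by positivity
  have hw0 : 0 ≤ w := by positivity
  have hsum := summable_treeWalk_mul_pow hq hw0 (by
    rw [hw, mul_div_assoc', div_lt_one hd]
    exact two_mul_sqrt_mul_lt_one_add (by positivity) hz.le hqz)
  have hrec (k : ℕ) : (1 + q * z ^ 2) * ∑' n, treeWalk q n (k + 1) * w ^ n =
      z * (∑' n, treeWalk q n k * w ^ n + q * ∑' n, treeWalk q n (k + 2) * w ^ n) := by
    have hwz : (1 + q * z ^ 2) * w = z := by rw [hw]; field_simp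
    have hstep : ∑' n, treeWalk q (n + 1) (k + 1) * w ^ (n + 1) =
        w * (∑' n, treeWalk q n k * w ^ n + q * ∑' n, treeWalk q n (k + 2) * w ^ n) := by
      rw [← tsum_mul_left (a := (q : ℝ)), ← (hsum k).tsum_add ((hsum (k + 2)).mul_left _),
        ← tsum_mul_left]
      refine tsum_congr fun n => ?_
      simp only [treeWalk, Nat.cast_add, Nat.cast_mul]
      ring
    rw [(hsum (k + 1)).tsum_eq_zero_add, hstep, treeWalk, Nat.cast_zero, zero_mul, zero_add,
      ← mul_assoc, hwz]
  induction k with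
  | zero =>
    have := (hsum 0).le_tsum 0 (fun n _ => by positivity)
    simpa [treeWalk] using this
  | succ k ih =>
    refine le_trans ?_ (mul_le_succ_of_recurrence (by positivity) hz hqz
      (H := fun k => ∑' n, treeWalk q n k * w ^ n)
      (fun k => tsum_nonneg fun n => by positivity) hrec k)
    rw [pow_succ']
    gcongr

theorem pow_le_tsum_treeWalk_two_mul {q : ℕ} (hq : 0 < q) {z : ℝ} (hz : 0 < z)
    (hqz : q * z ^ 2 < 1) (k : ℕ) :
    Summable (fun n => treeWalk q (2 * n) (2 * k) * (z / (1 + q * z ^ 2)) ^ (2 * n)) ∧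
    z ^ (2 * k) ≤ ∑' n, treeWalk q (2 * n) (2 * k) * (z / (1 + q * z ^ 2)) ^ (2 * n) := by
  have hinj : Function.Injective fun n : ℕ => 2 * n := fun a b h => by simpa using h
  have hd : 0 < 1 + q * z ^ 2 := by positivity
  have hsum := summable_treeWalk_mul_pow hq (w := z / (1 + q * z ^ 2)) (by positivity) (by
    rw [mul_div_assoc', div_lt_one hd]
    exact two_mul_sqrt_mul_lt_one_add (by positivity) hz.le hqz) (2 * k)
  refine ⟨hsum.comp_injective hinj, ?_⟩
  refine (pow_le_tsum_treeWalk_mul_pow hq hz hqz (2 * k)).trans_eq (hinj.tsum_eq ?_).symm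
  intro n hn
  by_contra h
  refine hn ?_
  simp only
  rw [treeWalk_eq_zero_of_odd]
  · simp
  · have : Odd n := by
      rw [← Nat.not_even_iff_odd]
      rintro ⟨m, rfl⟩
      exact h ⟨m, by ring⟩
    exact this.add_even (even_two_mul k)

theorem rpow_one_div_pow_two_mul {a : ℝ} (ha : 0 ≤ a) {n : ℕ} (hn : n ≠ 0) :
    (a ^ ((1 : ℝ) / (2 * n))) ^ (2 * n) = a := by
  rw [one_div, show (2 * n : ℝ) = ((2 * n : ℕ) : ℝ) by push_cast; rfl]
  exact Real.rpow_inv_natCast_pow ha (by omega)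

theorem eventually_le_pow_of_tendsto_root {a : ℕ → ℝ} (ha : ∀ n, 0 ≤ a n) {l x : ℝ}
    (h : Tendsto (fun n : ℕ => a n ^ ((1 : ℝ) / (2 * n))) atTop (nhds l)) (hx : l < x) :
    ∀ᶠ n in atTop, a n ≤ x ^ (2 * n) := by
  filter_upwards [h.eventually_lt_const hx, eventually_ne_atTop 0] with n hn hn0
  rw [← rpow_one_div_pow_two_mul (ha n) hn0]
  have := ha n
  gcongr

theorem eventually_pow_le_of_tendsto_root {a : ℕ → ℝ} (ha : ∀ n, 0 ≤ a n) {l x : ℝ} (hx0 : 0 ≤ x)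
    (h : Tendsto (fun n : ℕ => a n ^ ((1 : ℝ) / (2 * n))) atTop (nhds l)) (hx : x < l) :
    ∀ᶠ n in atTop, x ^ (2 * n) ≤ a n := by
  filter_upwards [h.eventually_const_lt hx, eventually_ne_atTop 0] with n hn hn0
  rw [← rpow_one_div_pow_two_mul (ha n) hn0]
  gcongr

theorem exists_forall_le_mul_of_eventually_le {a b : ℕ → ℝ} (ha : ∀ n, 0 ≤ a n)
    (hb : ∀ n, 0 < b n) (h : ∀ᶠ n in atTop, a n ≤ b n) : ∃ C, 0 < C ∧ ∀ n, a n ≤ C * b n := by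
  obtain ⟨n₀, hn₀⟩ := eventually_atTop.1 h
  have hnn (n) : 0 ≤ a n / b n := div_nonneg (ha n) (hb n).le
  have hs : 0 ≤ ∑ n ∈ Finset.range n₀, a n / b n := Finset.sum_nonneg fun n _ => hnn n
  refine ⟨1 + ∑ n ∈ Finset.range n₀, a n / b n, by positivity, fun n => ?_⟩
  rw [← div_le_iff₀ (hb n)]
  rcases lt_or_ge n n₀ with hn | hn
  · have := Finset.single_le_sum (f := fun n => a n / b n) (fun n _ => hnn n)
      (Finset.mem_range.2 hn)
    linarith
  · have := (div_le_one (hb n)).2 (hn₀ n hn)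
    linarith

theorem le_of_eventually_pow_le_mul_pow {x y C : ℝ} (hx : 0 < x)
    (h : ∀ᶠ n : ℕ in atTop, y ^ (2 * n) ≤ C * x ^ (2 * n)) : y ≤ x := by
  by_contra! hxy
  have h1 : 1 < (y / x) ^ 2 := one_lt_pow₀ ((one_lt_div hx).2 hxy) two_ne_zero
  obtain ⟨n, hn, hn'⟩ := (h.and ((tendsto_pow_atTop_atTop_of_one_lt h1).eventually_gt_atTop C)).exists
  rw [← pow_mul, div_pow, lt_div_iff₀ (by positivity)] at hn'
  linarith

theorem add_div_le_add_div {q x y : ℝ} (hx : 0 < x) (hxy : x ≤ y) (hq : q ≤ x * y) :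
    x + q / x ≤ y + q / y := by
  have hy : 0 < y := hx.trans_le hxy
  rw [← sub_nonneg]
  have : y + q / y - (x + q / x) = (y - x) * (x * y - q) / (x * y) := by
    field_simp
    ring
  rw [this]
  exact div_nonneg (mul_nonneg (sub_nonneg.2 hxy) (sub_nonneg.2 hq)) (by positivity)

theorem sum_div_pow_le_tsum_div_pow {q : ℕ} (hq : 0 < q) {γ W : ℕ → ℕ}
    (hW : ∀ n, W n = ∑ k ∈ Finset.range (n + 1), γ k * treeWalk q n k) {x : ℝ} (hx : 0 < x)
    (hqx : q < x ^ 2) (hs : Summable fun n => (W (2 * n) : ℝ) / (x + q / x) ^ (2 * n)) (K : ℕ) :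
    ∑ k ∈ Finset.range K, (γ (2 * k) : ℝ) / x ^ (2 * k) ≤
      ∑' n, (W (2 * n) : ℝ) / (x + q / x) ^ (2 * n) := by
  have hqz : q * x⁻¹ ^ 2 < 1 := by
    rw [inv_pow, ← div_eq_mul_inv, div_lt_one (by positivity)]
    exact hqx
  have hw : x⁻¹ / (1 + q * x⁻¹ ^ 2) = (x + q / x)⁻¹ := by
    field_simp
  have hT := pow_le_tsum_treeWalk_two_mul hq (inv_pos.2 hx) hqz
  rw [hw] at hT
  calc ∑ k ∈ Finset.range K, (γ (2 * k) : ℝ) / x ^ (2 * k)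
      ≤ ∑ k ∈ Finset.range K, ∑' n, (γ (2 * k) : ℝ) *
          (treeWalk q (2 * n) (2 * k) * (x + q / x)⁻¹ ^ (2 * n)) := by
        refine Finset.sum_le_sum fun k _ => ?_
        rw [tsum_mul_left, div_eq_mul_inv, ← inv_pow]
        gcongr
        exact (hT k).2
    _ = ∑' n, ∑ k ∈ Finset.range K, (γ (2 * k) : ℝ) *
          (treeWalk q (2 * n) (2 * k) * (x + q / x)⁻¹ ^ (2 * n)) :=
        (Summable.tsum_finsetSum fun k _ => (hT k).1.mul_left _).symm
    _ ≤ _ := by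
        refine Summable.tsum_le_tsum (fun n => ?_)
          (summable_sum fun k _ => (hT k).1.mul_left _) hs
        simp only [← mul_assoc, ← Finset.sum_mul]
        rw [inv_pow, ← div_eq_mul_inv]
        gcongr
        have hz (k : ℕ) (hk : 2 * n < k) : γ k * treeWalk q (2 * n) k = 0 := by
          rw [treeWalk_eq_zero_of_lt q hk, mul_zero]
        have : ∑ k ∈ Finset.range K, γ (2 * k) * treeWalk q (2 * n) (2 * k) ≤ W (2 * n) := by
          rw [hW, ← Finset.sum_image (s := Finset.range K) (g := fun k => 2 * k)
            (f := fun k => γ k * treeWalk q (2 * n) k) (fun a _ b _ h => by simpa using h)]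
          refine Finset.sum_le_sum_of_ne_zero fun k _ hk => ?_
          rw [Finset.mem_range]
          by_contra h
          exact hk (hz k (by omega))
        exact_mod_cast this

section Cogrowth

variable {q : ℕ} {γ W : ℕ → ℕ} {c R : ℝ}

theorem sqrt_le_of_tendsto_root {m : ℕ} (hq : 0 < q) (hγ : ∀ k, q ^ k ≤ γ (2 * (k + m)))
    (hc : Tendsto (fun n : ℕ => (γ (2 * n) : ℝ) ^ ((1 : ℝ) / (2 * n))) atTop (nhds c)) :
    √q ≤ c := by
  have hc0 : 0 ≤ c := ge_of_tendsto' hc fun n => by positivity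
  refine le_of_forall_gt_imp_ge_of_dense fun x hx => ?_
  have hx0 := hc0.trans_lt hx
  have h := eventually_le_pow_of_tendsto_root (a := fun n => γ (2 * n)) (fun n => by positivity)
    hc hx
  refine le_of_eventually_pow_le_mul_pow (C := x ^ (2 * m)) hx0 ?_
  filter_upwards [(tendsto_add_atTop_nat m).eventually h] with k hk
  rw [pow_mul, Real.sq_sqrt (by positivity), ← pow_add, add_comm, ← mul_add]
  refine le_trans ?_ hk
  exact_mod_cast hγ k

theorem le_add_div_of_tendsto_root (hq : 0 < q)
    (hW : ∀ n, W n = ∑ k ∈ Finset.range (n + 1), γ k * treeWalk q n k)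
    (hWle : ∀ n, W n ≤ (q + 1) ^ n) (hc0 : 0 < c)
    (hc : Tendsto (fun n : ℕ => (γ (2 * n) : ℝ) ^ ((1 : ℝ) / (2 * n))) atTop (nhds c))
    (hR : Tendsto (fun n : ℕ => (W (2 * n) : ℝ) ^ ((1 : ℝ) / (2 * n))) atTop (nhds R)) :
    R ≤ c + q / c := by
  have hR0 : 0 ≤ R := ge_of_tendsto' hR fun n => by positivity
  have hq' : (1 : ℝ) ≤ q := by exact_mod_cast hq
  rw [← sub_le_iff_le_add]
  refine le_of_forall_gt_imp_ge_of_dense fun x hx => ?_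
  have hx0 := hc0.trans hx
  have hxc : x + q / x ≤ x + q / c := by gcongr
  rw [sub_le_iff_le_add]
  refine le_trans ?_ hxc
  obtain ⟨C, hC⟩ : ∃ C : ℝ, ∀ n, (W (2 * n) : ℝ) ≤ C * (x + q / x) ^ (2 * n) := by
    rcases le_total x q with hxq | hxq
    · obtain ⟨C, hC0, hC⟩ := exists_forall_le_mul_of_eventually_le (fun n => by positivity)
        (fun n => by positivity) (eventually_le_pow_of_tendsto_root (a := fun n => γ (2 * n))
          (fun n => by positivity) hc hx)
      refine ⟨C * 2, fun n => ?_⟩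
      rw [mul_assoc]
      refine le_trans ?_ (mul_le_mul_of_nonneg_left (sum_treeWalk_mul_pow_le hq hx0 hxq (2 * n))
        hC0.le)
      rw [hW, Finset.mul_sum, Nat.cast_sum]
      refine Finset.sum_le_sum fun k _ => ?_
      rcases Nat.even_or_odd k with hk | hk
      · obtain ⟨j, rfl⟩ := even_iff_exists_two_mul.1 hk
        rw [Nat.cast_mul, mul_left_comm, mul_comm]
        gcongr
        exact hC j
      · rw [treeWalk_eq_zero_of_odd q ((even_two_mul n).add_odd hk)]
        simp
    · refine ⟨1, fun n => ?_⟩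
      have : (q : ℝ) + 1 ≤ x + q / x := by
        have := add_div_le_add_div (q := q) one_pos (hq'.trans hxq) (by simpa using hxq)
        rw [div_one] at this
        linarith
      rw [one_mul]
      refine le_trans ?_ (pow_le_pow_left₀ (by positivity) this _)
      exact_mod_cast hWle (2 * n)
  refine le_of_forall_lt_imp_le_of_dense fun y hy => ?_
  rcases le_total y 0 with hy0 | hy0
  · exact hy0.trans (by positivity)
  refine le_of_eventually_pow_le_mul_pow (C := C) (by positivity) ?_
  filter_upwards [eventually_pow_le_of_tendsto_root (a := fun n => W (2 * n))
    (fun n => by positivity) hy0 hR hy] with n hn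
  exact hn.trans (hC n)

theorem add_div_le_of_eventually_le {δ x : ℝ} (hq : 0 < q)
    (hW : ∀ n, W n = ∑ k ∈ Finset.range (n + 1), γ k * treeWalk q n k)
    (hR : Tendsto (fun n : ℕ => (W (2 * n) : ℝ) ^ ((1 : ℝ) / (2 * n))) atTop (nhds R))
    (hx : √q ≤ x) (hδ : 0 < δ) (hγ : ∀ᶠ n in atTop, δ * x ^ (2 * n) ≤ γ (2 * n)) :
    x + q / x ≤ R := by
  by_contra! h
  have hR0 : 0 ≤ R := ge_of_tendsto' hR fun n => by positivity
  have hx0 : 0 < x := lt_of_lt_of_le (by positivity) hx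
  obtain ⟨y, hRy, hy⟩ := exists_between h
  have hy0 : 0 < y := hR0.trans_lt hRy
  obtain ⟨C, hC0, hC⟩ := exists_forall_le_mul_of_eventually_le (fun n => by positivity)
    (fun n => by positivity) (eventually_le_pow_of_tendsto_root (a := fun n => W (2 * n))
      (fun n => by positivity) hR hRy)
  have hs : Summable fun n => (W (2 * n) : ℝ) / (x + q / x) ^ (2 * n) := by
    have hg := summable_geometric_of_lt_one (r := (y / (x + q / x)) ^ 2) (by positivity)
      (pow_lt_one₀ (by positivity) ((div_lt_one (by positivity)).2 hy) two_ne_zero)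
    refine (hg.mul_left C).of_nonneg_of_le (fun n => by positivity) fun n => ?_
    rw [← pow_mul, div_pow, mul_div_assoc']
    gcongr
    exact hC n
  have hbound (K : ℕ) : ∑ k ∈ Finset.range K, (γ (2 * k) : ℝ) / x ^ (2 * k) ≤
      ∑' n, (W (2 * n) : ℝ) / (x + q / x) ^ (2 * n) := by
    have hcont : ContinuousWithinAt
        (fun t => ∑ k ∈ Finset.range K, (γ (2 * k) : ℝ) / t ^ (2 * k)) (Set.Ioi x) x := by
      refine ContinuousAt.continuousWithinAt ?_
      fun_prop (disch := positivity)
    refine le_of_tendsto hcont (eventually_mem_nhdsWithin.mono fun t ht => ?_)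
    have ht : x < t := ht
    have ht0 := hx0.trans ht
    have hmono : x + q / x ≤ t + q / t := by
      refine add_div_le_add_div hx0 ht.le ?_
      rw [← Real.mul_self_sqrt (Nat.cast_nonneg q)]
      gcongr
      exact hx.trans ht.le
    have hle (n : ℕ) : (W (2 * n) : ℝ) / (t + q / t) ^ (2 * n) ≤
        (W (2 * n) : ℝ) / (x + q / x) ^ (2 * n) := by gcongr
    have hst := hs.of_nonneg_of_le (fun n => by positivity) hle
    have hqt : q < t ^ 2 := (Real.sqrt_lt' ht0).1 (hx.trans_lt ht)
    exact (sum_div_pow_le_tsum_div_pow hq hW ht0 hqt hst K).trans (hst.tsum_le_tsum hle hs)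
  have hzero := (summable_of_sum_range_le (fun k => by positivity) hbound).tendsto_atTop_zero
  refine hδ.not_ge (ge_of_tendsto hzero (hγ.mono fun n hn => ?_))
  rwa [le_div_iff₀ (by positivity)]

theorem add_div_le_of_tendsto_root {m : ℕ} (hq : 0 < q)
    (hW : ∀ n, W n = ∑ k ∈ Finset.range (n + 1), γ k * treeWalk q n k)
    (hγ : ∀ k, q ^ k ≤ γ (2 * (k + m)))
    (hc : Tendsto (fun n : ℕ => (γ (2 * n) : ℝ) ^ ((1 : ℝ) / (2 * n))) atTop (nhds c))
    (hR : Tendsto (fun n : ℕ => (W (2 * n) : ℝ) ^ ((1 : ℝ) / (2 * n))) atTop (nhds R)) :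
    c + q / c ≤ R := by
  have hs : 0 < √(q : ℝ) := by positivity
  have hqc := sqrt_le_of_tendsto_root hq hγ hc
  rcases hqc.eq_or_lt with rfl | hlt
  · refine add_div_le_of_eventually_le (δ := ((q : ℝ) ^ m)⁻¹) hq hW hR le_rfl (by positivity) ?_
    filter_upwards [eventually_ge_atTop m] with n hn
    obtain ⟨k, rfl⟩ := Nat.exists_eq_add_of_le' hn
    rw [pow_mul, Real.sq_sqrt (by positivity), pow_add, inv_mul_eq_div,
      mul_div_cancel_right₀ _ (by positivity)]
    exact_mod_cast hγ k
  · rw [← le_sub_iff_add_le]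
    refine le_of_forall_lt_imp_le_of_dense fun y hy => ?_
    obtain ⟨x, hx, hxc⟩ := exists_between (max_lt hy hlt)
    obtain ⟨hyx, hx⟩ := max_lt_iff.1 hx
    have hx0 := hs.trans hx
    have := add_div_le_of_eventually_le (x := x) (δ := 1) hq hW hR hx.le one_pos (by
      simpa using eventually_pow_le_of_tendsto_root (a := fun n => γ (2 * n))
        (fun n => by positivity) hx0.le hc hxc)
    have : (q : ℝ) / c ≤ q / x := by gcongr
    linarith

end Cogrowth

theorem eq_mul_add_sqrt_of_add_div_eq {s c ρ : ℝ} (hs : 0 < s) (hsc : s ≤ c)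
    (h : c + s ^ 2 / c = 2 * s * ρ) : c = s * (ρ + √(ρ ^ 2 - 1)) := by
  have hc : 0 < c := hs.trans_le hsc
  have hρ : ρ = (c + s ^ 2 / c) / (2 * s) := by
    rw [h]
    field_simp
  have hsq : ρ ^ 2 - 1 = ((c - s ^ 2 / c) / (2 * s)) ^ 2 := by
    rw [hρ]
    field_simp
    ring
  have hnn : 0 ≤ (c - s ^ 2 / c) / (2 * s) := by
    refine div_nonneg (sub_nonneg.2 ?_) (by positivity)
    rw [div_le_iff₀ hc]
    nlinarith
  rw [hsq, Real.sqrt_sq hnn, hρ]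
  field_simp
  ring

namespace FreeGroup

variable {α : Type*} [DecidableEq α]

theorem norm_mk_singleton_mul_of_cons {x : FreeGroup α} {a : α × Bool} {t : List (α × Bool)}
    (hx : x.toWord = a :: t) (p : α × Bool) :
    norm (mk [p] * x) = if p = (a.1, !a.2) then t.length else t.length + 2 := by
  have h : (mk [p] * x).toWord = reduce (p :: a :: t) := by
    rw [← hx, ← mk_toWord (x := x), ← mul_mk.symm, toWord_mk, mk_toWord]; simp
  have hr : reduce (a :: t) = a :: t := by rw [← hx, reduce_toWord]
  rw [norm, h, reduce.cons, hr]
  by_cases hp : p = (a.1, !a.2)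
  · simp [hp]
  · have : ¬ (p.1 = a.1 ∧ p.2 = !a.2) := fun h' => hp (Prod.ext h'.1 h'.2)
    simp [hp, this]

theorem sum_norm_mk_singleton_mul [Fintype α] (f : ℕ → ℕ) (x : FreeGroup α) :
    ∑ p : α × Bool, f (norm (mk [p] * x)) =
      if norm x = 0 then 2 * Fintype.card α * f 1
      else f (norm x - 1) + (2 * Fintype.card α - 1) * f (norm x + 1) := by
  rcases hx : x.toWord with _ | ⟨a, t⟩
  · obtain rfl := toWord_eq_nil_iff.1 hx
    have (p : α × Bool) : norm (mk [p]) = 1 := by simp [norm, toWord_mk]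
    simp [this, mul_comm]
  · have hn : norm x = t.length + 1 := by simp [norm, hx]
    simp only [norm_mk_singleton_mul_of_cons hx, hn, apply_ite f]
    rw [Finset.sum_ite]
    simp [Finset.filter_eq', Finset.filter_ne', Finset.card_erase_of_mem, mul_comm]

theorem norm_mul_mod_two (x y : FreeGroup α) : norm (x * y) % 2 = (norm x + norm y) % 2 := by
  have h := (reduce.red (L := x.toWord ++ y.toWord)).length
  rw [← toWord_mul, List.length_append] at h
  obtain ⟨n, hn⟩ := h
  simp only [norm]
  omega

theorem finite_norm_eq [Finite α] (n : ℕ) : {x : FreeGroup α | norm x = n}.Finite :=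
  Set.Finite.of_finite_image (f := toWord) ((List.finite_length_eq (α × Bool) n).subset
    (by rintro _ ⟨x, hx, rfl⟩; exact hx)) toWord_injective.injOn

theorem card_filter_ofFn_prod_eq [Fintype α] [Nonempty α] (n : ℕ) (x : FreeGroup α) :
    (Finset.univ.filter fun s : Fin n → α × Bool => (List.ofFn fun i => mk [s i]).prod = x).card =
      treeWalk (2 * Fintype.card α - 1) n (norm x) := by
  induction n generalizing x with
  | zero =>
    rcases eq_or_ne x 1 with rfl | hx
    · simp [treeWalk]
    · obtain ⟨k, hk⟩ := Nat.exists_eq_succ_of_ne_zero (norm_eq_zero.not.2 hx)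
      simp [hk, treeWalk, hx.symm]
  | succ n ih =>
    have hcons : (Finset.univ.filter fun s : Fin (n + 1) → α × Bool =>
        (List.ofFn fun i => mk [s i]).prod = x).card =
        ∑ p : α × Bool, (Finset.univ.filter fun s : Fin n → α × Bool =>
          (List.ofFn fun i => mk [s i]).prod = (mk [p])⁻¹ * x).card := by
      rw [← Finset.card_sigma]
      refine Finset.card_bij' (fun s _ => ⟨s 0, Fin.tail s⟩) (fun s _ => Fin.cons s.1 s.2)
        ?_ ?_ ?_ ?_
      · intro s hs
        simpa [Fin.tail, List.ofFn_succ, eq_inv_mul_iff_mul_eq, -inv_mk] using hs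
      · rintro ⟨p, s⟩ hs
        simpa [List.ofFn_succ, eq_inv_mul_iff_mul_eq, -inv_mk] using hs
      · intro s _
        simp
      · intro s _
        simp
    have hinv : Function.Involutive fun p : α × Bool => (p.1, !p.2) := fun p => by simp
    rw [hcons]
    simp only [ih]
    rw [← Equiv.sum_comp hinv.toPerm]
    simp only [Function.Involutive.coe_toPerm, inv_mk, invRev, List.map_cons, List.map_nil,
      List.reverse_singleton, Bool.not_not, Prod.mk.eta]
    rw [sum_norm_mk_singleton_mul (treeWalk (2 * Fintype.card α - 1) n)]
    have hα := Fintype.card_pos (α := α)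
    split_ifs with h
    · rw [h, treeWalk, Nat.sub_add_cancel (by omega)]
    · obtain ⟨k, hk⟩ := Nat.exists_eq_succ_of_ne_zero h
      simp [hk, treeWalk]

/-- The number of words of length `n` with product in a given set, sorted by the norm of the
product. -/
theorem card_filter_ofFn_prod_mem [Fintype α] [Nonempty α] (N : Set (FreeGroup α)) (n : ℕ) :
    Nat.card {s : Fin n → α × Bool // (List.ofFn fun i => mk [s i]).prod ∈ N} =
      ∑ k ∈ Finset.range (n + 1), {x | x ∈ N ∧ norm x = k}.ncard *
        treeWalk (2 * Fintype.card α - 1) n k := by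
  classical
  have hle (s : Fin n → α × Bool) : norm (List.ofFn fun i => mk [s i]).prod < n + 1 := by
    have : (List.ofFn fun i => mk [s i]).prod = mk (List.ofFn s) := by
      rw [show (fun i => mk [s i]) = (fun p => mk [p]) ∘ s from rfl, ← List.map_ofFn]
      generalize List.ofFn s = l
      induction l with
      | nil => simp [one_eq_mk]
      | cons p l ih => simp [ih]
    rw [this]
    exact Nat.lt_succ_of_le (norm_mk_le.trans (by simp))
  rw [Nat.card_eq_fintype_card, Fintype.card_subtype,
    Finset.card_eq_sum_card_fiberwise
      (f := fun s : Fin n → α × Bool => norm (List.ofFn fun i => mk [s i]).prod)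
      (t := Finset.range (n + 1)) (fun s _ => by simpa using hle s)]
  refine Finset.sum_congr rfl fun k _ => ?_
  have hfin : {x | x ∈ N ∧ norm x = k}.Finite := (finite_norm_eq k).subset fun x hx => hx.2
  rw [Set.ncard_eq_toFinset_card _ hfin, Finset.card_eq_sum_card_fiberwise
      (f := fun s : Fin n → α × Bool => (List.ofFn fun i => mk [s i]).prod)
      (t := hfin.toFinset) (fun s hs => by simpa using hs), ← smul_eq_mul, ← Finset.sum_const]
  refine Finset.sum_congr rfl fun x hx => ?_
  simp only [Set.Finite.mem_toFinset, Set.mem_ofPred_eq] at hx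
  rw [← hx.2, ← card_filter_ofFn_prod_eq]
  congr 1
  ext s
  simp only [Finset.mem_filter, Finset.mem_univ, true_and]
  constructor
  · exact fun h => h.2
  · intro h
    exact ⟨⟨h ▸ hx.1, by rw [h]⟩, h⟩

/-- The elements of norm `n` whose reduced word ends with the inverse of its first letter. -/
def conjSphere (N : Set (FreeGroup α)) (n : ℕ) : Set (FreeGroup α) :=
  {x | x ∈ N ∧ norm x = n ∧ ∃ a L, x.toWord = a :: (L ++ [(a.1, !a.2)])}

theorem toWord_conj {x : FreeGroup α} {p : α × Bool} (hx : x ≠ 1)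
    (hhead : ∀ a ∈ x.toWord.head?, p ≠ (a.1, !a.2)) (hlast : ∀ b ∈ x.toWord.getLast?, p ≠ b) :
    (mk [p] * x * (mk [p])⁻¹).toWord = p :: (x.toWord ++ [(p.1, !p.2)]) := by
  have hmk : mk [p] * x * (mk [p])⁻¹ = mk (p :: (x.toWord ++ [(p.1, !p.2)])) := by
    conv_lhs => rw [← mk_toWord (x := x)]
    simp [invRev]
  have hred := isReduced_toWord (x := x)
  have hne : x.toWord ≠ [] := toWord_eq_nil_iff.not.2 hx
  rw [hmk, toWord_mk]
  apply IsReduced.reduce_eq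
  rw [IsReduced, List.isChain_cons, List.isChain_append]
  refine ⟨fun a ha h => ?_, hred, List.isChain_singleton _, fun b hb c hc h => ?_⟩
  · rw [List.head?_append_of_ne_nil _ hne] at ha
    by_contra h'
    exact hhead a ha (Prod.ext h (by simpa [Bool.eq_not] using h'))
  · obtain rfl : (p.1, !p.2) = c := by simpa using hc
    by_contra h'
    exact hlast b hb (Prod.ext h.symm (by simpa [Bool.eq_not, eq_comm] using h'))

theorem exists_conjSphere_nonempty [Fintype α] (hα : 2 ≤ Fintype.card α) (N : Subgroup (FreeGroup α))
    [hN : N.Normal] (h : N ≠ ⊥) : ∃ m, (conjSphere (N : Set (FreeGroup α)) (2 * m)).Nonempty := by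
  obtain ⟨g, hg, hg1⟩ := N.bot_or_exists_ne_one.resolve_left h
  have hx1 : g ^ 2 ≠ 1 := by simpa using hg1
  have hxN : g ^ 2 ∈ N := N.pow_mem hg 2
  have hxe : norm (g ^ 2) % 2 = 0 := by rw [sq, norm_mul_mod_two]; omega
  generalize g ^ 2 = x at hx1 hxN hxe
  have hne : x.toWord ≠ [] := toWord_eq_nil_iff.not.2 hx1
  obtain ⟨p, hp⟩ : ∃ p : α × Bool,
      p ∉ ({((x.toWord.head hne).1, !(x.toWord.head hne).2), x.toWord.getLast hne} : Finset _) := by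
    apply Finset.exists_mem_notMem_of_card_lt_card (t := Finset.univ) ?_ |>.imp fun _ h => h.2
    refine Finset.card_le_two.trans_lt ?_
    simp
    omega
  simp only [Finset.mem_insert, Finset.mem_singleton, not_or] at hp
  have hw := toWord_conj hx1 (p := p)
    (fun a ha => by
      rw [List.head?_eq_some_head hne] at ha; obtain rfl := Option.mem_some_iff.1 ha; exact hp.1)
    (fun a ha => by
      rw [List.getLast?_eq_some_getLast hne] at ha
      obtain rfl := Option.mem_some_iff.1 ha; exact hp.2)
  refine ⟨norm x / 2 + 1, mk [p] * x * (mk [p])⁻¹, hN.conj_mem x hxN _, ?_, p, _, hw⟩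
  have : x.toWord.length % 2 = 0 := hxe
  simp only [norm, hw, List.length_cons, List.length_append, List.length_nil]
  omega

theorem mul_ncard_conjSphere_le [Fintype α] (N : Subgroup (FreeGroup α)) [hN : N.Normal] (n : ℕ) :
    (2 * Fintype.card α - 1) * (conjSphere (N : Set (FreeGroup α)) n).ncard ≤
      (conjSphere (N : Set (FreeGroup α)) (n + 2)).ncard := by
  have hfin (n) : (conjSphere (N : Set (FreeGroup α)) n).Finite :=
    (finite_norm_eq n).subset fun x hx => hx.2.1
  have hword {x : FreeGroup α} (hx : x ∈ conjSphere (N : Set (FreeGroup α)) n) {p : α × Bool}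
      (hp : p ∉ x.toWord.getLast?) :
      (mk [p] * x * (mk [p])⁻¹).toWord = p :: (x.toWord ++ [(p.1, !p.2)]) := by
    obtain ⟨-, -, a, L, hL⟩ := hx
    apply toWord_conj (by rintro rfl; simp at hL)
    · rintro b hb rfl
      obtain rfl : a = b := by simpa [hL] using hb
      simp [hL, List.getLast?_cons] at hp
    · rintro b hb rfl
      exact hp hb
  rw [Set.ncard_eq_toFinset_card _ (hfin n), Set.ncard_eq_toFinset_card _ (hfin (n + 2))]
  calc _ = ((hfin n).toFinset.sigma fun x =>
        Finset.univ.filter fun p : α × Bool => p ∉ x.toWord.getLast?).card := by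
        rw [Finset.card_sigma, mul_comm, ← smul_eq_mul, ← Finset.sum_const]
        refine Finset.sum_congr rfl fun x hx => ?_
        obtain ⟨-, -, a, L, hL⟩ := (hfin n).mem_toFinset.1 hx
        simp [hL, List.getLast?_cons, Finset.filter_ne, Finset.card_erase_of_mem, mul_comm]
    _ ≤ _ := by
        refine Finset.card_le_card_of_injOn (fun s => mk [s.2] * s.1 * (mk [s.2])⁻¹) ?_ ?_
        · rintro ⟨x, p⟩ hs
          simp only [Finset.coe_sigma, Set.mem_sigma_iff, Finset.mem_coe, Set.Finite.mem_toFinset,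
            Finset.mem_filter, Finset.mem_univ, true_and] at hs ⊢
          have hw := hword hs.1 hs.2
          refine ⟨hN.conj_mem x hs.1.1 _, ?_, p, _, hw⟩
          have : x.toWord.length = n := hs.1.2.1
          simp only [norm, hw, List.length_cons, List.length_append, List.length_nil, this]
        · rintro ⟨x, p⟩ hs ⟨y, p'⟩ hs' h
          simp only [Finset.coe_sigma, Set.mem_sigma_iff, Finset.mem_coe, Set.Finite.mem_toFinset,
            Finset.mem_filter, Finset.mem_univ, true_and] at hs hs' h
          have hw := congrArg toWord h
          rw [hword hs.1 hs.2, hword hs'.1 hs'.2] at hw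
          obtain ⟨rfl, hw⟩ := List.cons_eq_cons.1 hw
          simpa [toWord_inj] using hw

theorem exists_pow_le_ncard_norm_eq [Fintype α] (hα : 2 ≤ Fintype.card α)
    (N : Subgroup (FreeGroup α)) [N.Normal] (h : N ≠ ⊥) :
    ∃ m, ∀ k, (2 * Fintype.card α - 1) ^ k ≤ {x | x ∈ N ∧ norm x = 2 * (k + m)}.ncard := by
  obtain ⟨m, hm⟩ := exists_conjSphere_nonempty hα N h
  refine ⟨m, fun k => ?_⟩
  have hfin (n) : {x | x ∈ N ∧ norm x = n}.Finite := (finite_norm_eq n).subset fun x hx => hx.2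
  have hsub (n) : conjSphere (N : Set (FreeGroup α)) n ⊆ {x | x ∈ N ∧ norm x = n} :=
    fun x hx => ⟨hx.1, hx.2.1⟩
  refine le_trans ?_ (Set.ncard_le_ncard (hsub _) (hfin _))
  induction k with
  | zero => simpa [Nat.one_le_iff_ne_zero, Set.ncard_eq_zero ((hfin _).subset (hsub _)),
      Set.nonempty_iff_ne_empty] using hm
  | succ k ih =>
    rw [pow_succ', show 2 * (k + 1 + m) = 2 * (k + m) + 2 by ring]
    exact (Nat.mul_le_mul_left _ ih).trans (mul_ncard_conjSphere_le N _)

end FreeGroup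

/-- With `γ n` the cogrowth coefficients of a nontrivial normal subgroup
`N` of the free group on `r ≥ 2` generators, `c = lim (γ (2n))^(1/(2n))` the cogrowth
exponent, `W n` the number of `n`-tuples of generators and inverses with product in `N`,
and `ρ = lim (W (2n))^(1/(2n)) / (2√q)` the spectral radius (`q = 2r - 1`), one has
`c = √q · (ρ + √(ρ² - 1))`. -/
theorem cogrowth_exponent_eq
    (r : ℕ) (hr : 2 ≤ r)
    (N : Subgroup (FreeGroup (Fin r))) (hNnormal : N.Normal) (hNbot : N ≠ ⊥)
    (γ : ℕ → ℕ)
    (hγ : ∀ n, γ n = Nat.card {x : FreeGroup (Fin r) // x ∈ N ∧ FreeGroup.norm x = n})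
    (W : ℕ → ℕ)
    (hW : ∀ n, W n = Nat.card {s : Fin n → Fin r × Bool //
      (List.ofFn (fun i => if (s i).2 then FreeGroup.of (s i).1
        else (FreeGroup.of (s i).1)⁻¹)).prod ∈ N})
    (c : ℝ)
    (hc : Tendsto (fun n : ℕ => ((γ (2 * n) : ℝ)) ^ ((1 : ℝ) / (2 * n))) atTop (nhds c))
    (ρ : ℝ)
    (hρ : Tendsto
      (fun n : ℕ => ((W (2 * n) : ℝ)) ^ ((1 : ℝ) / (2 * n)) / (2 * Real.sqrt (2 * r - 1)))
      atTop (nhds ρ)) :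
    c = Real.sqrt (2 * r - 1) * (ρ + Real.sqrt (ρ ^ 2 - 1)) := by
  have hr' : (1 : ℝ) ≤ r := by exact_mod_cast (by omega : 1 ≤ r)
  have : Nonempty (Fin r) := ⟨⟨0, by omega⟩⟩
  have hq : 0 < 2 * r - 1 := by omega
  have hqr : ((2 * r - 1 : ℕ) : ℝ) = 2 * r - 1 := by
    rw [Nat.cast_sub (by omega)]
    push_cast
    rfl
  have hs : 0 < √(2 * (r : ℝ) - 1) := Real.sqrt_pos.2 (by linarith)
  have hγ' : γ = fun n => {x | x ∈ N ∧ FreeGroup.norm x = n}.ncard := funext hγ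
  have hletter (p : Fin r × Bool) :
      (if p.2 then FreeGroup.of p.1 else (FreeGroup.of p.1)⁻¹) = FreeGroup.mk [p] := by
    rcases p with ⟨a, _ | _⟩ <;> simp [FreeGroup.of, FreeGroup.invRev]
  simp only [hletter] at hW
  have hWsum (n : ℕ) : W n = ∑ k ∈ Finset.range (n + 1), γ k * treeWalk (2 * r - 1) n k := by
    have := FreeGroup.card_filter_ofFn_prod_mem (N : Set (FreeGroup (Fin r))) n
    rw [Fintype.card_fin] at this
    rw [hW, hγ']
    exact this
  have hWle (n : ℕ) : W n ≤ (2 * r - 1 + 1) ^ n := by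
    rw [hW, Nat.sub_add_cancel (by omega)]
    refine (Finite.card_subtype_le _).trans_eq ?_
    simp [mul_comm]
  obtain ⟨m, hm⟩ := FreeGroup.exists_pow_le_ncard_norm_eq (by simpa using hr) N hNbot
  have hm' (k : ℕ) : (2 * r - 1) ^ k ≤ γ (2 * (k + m)) := by
    simpa [hγ'] using hm k
  have hR : Tendsto (fun n : ℕ => (W (2 * n) : ℝ) ^ ((1 : ℝ) / (2 * n))) atTop
      (nhds (2 * √(2 * (r : ℝ) - 1) * ρ)) :=
    (hρ.const_mul (2 * √(2 * (r : ℝ) - 1))).congr fun n => by field_simp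
  have hsc := sqrt_le_of_tendsto_root hq hm' hc
  have h₂ := add_div_le_of_tendsto_root hq hWsum hm' hc hR
  rw [hqr] at hsc
  have h₁ := le_add_div_of_tendsto_root hq hWsum hWle (hs.trans_le hsc) hc hR
  rw [hqr] at h₁ h₂
  refine eq_mul_add_sqrt_of_add_div_eq hs hsc ?_
  rw [Real.sq_sqrt (by linarith)]
  exact le_antisymm h₂ h₁
end
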